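/- arXiv:2105.02180 — 5 statements merged into one kernel-verified Lean document; each statement's English description precedes it below -/
import Mathlib

section
/- Let π be a Borel probability measure on ℝ with finite second moment, let τ₁ > 0, and let F₀ : ℝ → ℝ be Lipschitz with E[F₀(γ̄)²] ≤ τ₁², where γ̄ ∼ π. Let k ≥ 2, let Σ ∈ ℝ^{(k−1)×(k−1)} be symmetric positive definite, let (G₁,…,G_{k−1}) ∼ N_{k−1}(0, Σ) be independent of γ̄, and let f₁,…,f_{k−1} : ℝ² → ℝ be Lipschitz functions such that for each ℓ ∈ {1,…,k−1}, π({y ∈ ℝ : x ↦ f_ℓ(x,y) is non-constant}) > 0. Then the symmetric k×k matrix T defined by T_{1,1} := τ₁², T_{1,ℓ} = T_{ℓ,1} := E[F₀(γ̄) · f_{ℓ−1}(G_{ℓ−1}, γ̄)] for 2 ≤ ℓ ≤ k, and T_{j,ℓ} := E[f_{j−1}(G_{j−1}, γ̄) · f_{ℓ−1}(G_{ℓ−1}, γ̄)] for 2 ≤ j, ℓ ≤ k, is positive definite; equivalently, for every nonzero a ∈ ℝ^k, E[(a₁F₀(γ̄) + Σ_{ℓ=2}^k a_ℓ f_{ℓ−1}(G_{ℓ−1},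 γ̄))²] + a₁²(τ₁² − E[F₀(γ̄)²]) > 0. -/
open MeasureTheory ProbabilityTheory Matrix

open scoped MatrixOrder in
lemma amp_openpos_mvg {n : ℕ} (S : Matrix (Fin n) (Fin n) ℝ) (hS : S.PosDef) :
    (multivariateGaussian (0 : EuclideanSpace ℝ (Fin n)) S).IsOpenPosMeasure := by
  have h0 : (gaussianReal 0 1).IsOpenPosMeasure :=
    (gaussianReal_absolutelyContinuous' 0 one_ne_zero).isOpenPosMeasure
  have h1 : (stdGaussian (EuclideanSpace ℝ (Fin n))).IsOpenPosMeasure := by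
    rw [← map_pi_eq_stdGaussian]
    exact (PiLp.continuous_toLp 2 _).isOpenPosMeasure_map (WithLp.toLp_surjective 2)
  rw [multivariateGaussian]
  have hu : IsUnit (CFC.sqrt S) := by
    have := hS.isUnit
    have h2 := CFC.sqrt_mul_sqrt_self S hS.posSemidef.nonneg
    rw [← h2] at this
    exact isUnit_of_mul_isUnit_left this
  refine Continuous.isOpenPosMeasure_map (by fun_prop) ?_
  intro y
  obtain ⟨B, hB⟩ := hu.exists_right_inv
  refine ⟨toEuclideanCLM (𝕜 := ℝ) B y, ?_⟩
  have : toEuclideanCLM (𝕜 := ℝ) (CFC.sqrt S) (toEuclideanCLM (𝕜 := ℝ) B y)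
    = toEuclideanCLM (𝕜 := ℝ) (CFC.sqrt S * B) y := by simp
  simp [-toEuclideanCLM_toLp, this, hB]

lemma amp_openpos_map {Ω : Type*} [MeasurableSpace Ω] (P : Measure Ω) [IsProbabilityMeasure P]
    {n : ℕ} (S : Matrix (Fin n) (Fin n) ℝ) (hS : S.PosDef)
    (G : Ω → Fin n → ℝ) (hGmeas : Measurable G)
    (hGgauss : ∀ a : Fin n → ℝ,
      P.map (fun ω => ∑ i, a i * G ω i) =
        gaussianReal 0 (Real.toNNReal (∑ i, ∑ j, a i * S i j * a j))) :
    (P.map G).IsOpenPosMeasure := by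
  have key : P.map (fun ω => WithLp.toLp 2 (G ω)) =
      multivariateGaussian (0 : EuclideanSpace ℝ (Fin n)) S := by
    have hm : Measurable (fun ω => WithLp.toLp 2 (G ω)) := by fun_prop
    have : IsProbabilityMeasure (P.map (fun ω => WithLp.toLp 2 (G ω))) :=
      Measure.isProbabilityMeasure_map hm.aemeasurable
    apply Measure.ext_of_charFun
    ext t
    rw [charFun_multivariateGaussian hS.posSemidef]
    have h1 := congrArg (fun μ => charFun μ 1) (hGgauss t)
    simp only [charFun_gaussianReal] at h1
    have hnn : 0 ≤ ∑ i, ∑ j, t i * S i j * t j := by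
      have := hS.posSemidef.dotProduct_mulVec_nonneg t.ofLp
      simpa [dotProduct, mulVec, Finset.mul_sum, mul_assoc] using this
    rw [charFun_apply, integral_map (by fun_prop) (by fun_prop)] at h1 ⊢
    rw [Real.coe_toNNReal _ hnn] at h1
    have e : (t ⬝ᵥ S *ᵥ t) = ∑ i, ∑ j, t i * S i j * t j := by
      simp [dotProduct, mulVec, Finset.mul_sum, mul_assoc]
    rw [e]
    simpa [PiLp.inner_apply, mul_comm] using h1
  have h2 : P.map G = (P.map (fun ω => WithLp.toLp 2 (G ω))).map WithLp.ofLp := by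
    rw [Measure.map_map (by fun_prop) (by fun_prop)]; rfl
  have := amp_openpos_mvg S hS
  rw [h2, key]
  exact (PiLp.continuous_ofLp 2 _).isOpenPosMeasure_map (WithLp.ofLp_surjective 2)


lemma amp_lip_memLp {Ω : Type*} [MeasurableSpace Ω] {P : Measure Ω} [IsProbabilityMeasure P]
    {E : Type*} [NormedAddCommGroup E] {L : NNReal} {g : E → ℝ} (hg : LipschitzWith L g)
    {X : Ω → E} (hX : MemLp X 2 P) : MemLp (fun ω => g (X ω)) 2 P := by
  have h1 : LipschitzWith L (fun x => g x - g 0) :=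
    LipschitzWith.of_dist_le_mul fun x y => by
      simpa [Real.dist_eq] using hg.dist_le_mul x y
  have h2 := (h1.comp_memLp (by simp) hX).add (memLp_const (g 0))
  convert h2 using 1
  ext ω; simp

lemma amp_core
    {Ω : Type*} [MeasurableSpace Ω] (P : Measure Ω) [IsProbabilityMeasure P]
    (n : ℕ)
    (π : Measure ℝ) [IsProbabilityMeasure π] (hπ2 : Integrable (fun x => x ^ 2) π)
    (τ₁ : ℝ) (hτ₁ : 0 < τ₁)
    (F₀ : ℝ → ℝ) (hF₀lip : ∃ L : NNReal, LipschitzWith L F₀)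
    (γb : Ω → ℝ) (hγbmeas : Measurable γb) (hγblaw : P.map γb = π)
    (hF₀mom : ∫ y, (F₀ y) ^ 2 ∂π ≤ τ₁ ^ 2)
    (S : Matrix (Fin n) (Fin n) ℝ) (hS : S.PosDef)
    (G : Ω → Fin n → ℝ) (hGmeas : Measurable G)
    (hGgauss : ∀ a : Fin n → ℝ,
      P.map (fun ω => ∑ i, a i * G ω i) =
        gaussianReal 0 (Real.toNNReal (∑ i, ∑ j, a i * S i j * a j)))
    (hindep : IndepFun γb G P)
    (f : Fin n → ℝ → ℝ → ℝ)
    (hflip : ∀ ℓ, ∃ L : NNReal, LipschitzWith L (fun q : ℝ × ℝ => f ℓ q.1 q.2))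
    (hfnc : ∀ ℓ, 0 < π {y | ∃ x x' : ℝ, f ℓ x y ≠ f ℓ x' y})
    (T : Matrix (Fin (n+1)) (Fin (n+1)) ℝ)
    (hT00 : T 0 0 = τ₁ ^ 2)
    (hT0j : ∀ j : Fin n, T 0 j.succ = ∫ ω, F₀ (γb ω) * f j (G ω j) (γb ω) ∂P)
    (hTj0 : ∀ j : Fin n, T j.succ 0 = ∫ ω, F₀ (γb ω) * f j (G ω j) (γb ω) ∂P)
    (hTij : ∀ i j : Fin n,
      T i.succ j.succ = ∫ ω, f i (G ω i) (γb ω) * f j (G ω j) (γb ω) ∂P) :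
    T.PosDef ∧
    ∀ a : Fin (n+1) → ℝ, a ≠ 0 →
      0 < (∫ ω, (a 0 * F₀ (γb ω) + ∑ j : Fin n, a j.succ * f j (G ω j) (γb ω)) ^ 2 ∂P) +
          (a 0) ^ 2 * (τ₁ ^ 2 - ∫ ω, (F₀ (γb ω)) ^ 2 ∂P) := by
  have hop := amp_openpos_map P S hS G hGmeas hGgauss
  obtain ⟨L0, hL0⟩ := hF₀lip
  have hγ2 : MemLp γb 2 P := by
    have : MemLp (fun x : ℝ => x) 2 (P.map γb) := by
      rw [hγblaw, memLp_two_iff_integrable_sq (by fun_prop)]; exact hπ2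
    exact this.comp_of_map hγbmeas.aemeasurable
  have hG2 : ∀ j, MemLp (fun ω => G ω j) 2 P := by
    intro j
    have h := hGgauss (Pi.single j 1)
    have e : (fun ω => ∑ i, (Pi.single j 1 : Fin n → ℝ) i * G ω i) = fun ω => G ω j := by
      ext ω; simp [Pi.single_apply]
    rw [e] at h
    have : MemLp id 2 (P.map (fun ω => G ω j)) := by
      rw [h]; exact memLp_id_gaussianReal 2
    exact this.comp_of_map (by fun_prop)
  have hX0 : MemLp (fun ω => F₀ (γb ω)) 2 P := amp_lip_memLp hL0 hγ2
  have hXj : ∀ j, MemLp (fun ω => f j (G ω j) (γb ω)) 2 P := by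
    intro j
    obtain ⟨L, hL⟩ := hflip j
    have hp : MemLp (fun ω => (G ω j, γb ω)) 2 P := by
      refine ((hG2 j).norm.add hγ2.norm).of_le (by fun_prop) (ae_of_all _ fun ω => ?_)
      simp only [Prod.norm_mk, Pi.add_apply]
      have h3 := le_abs_self (‖G ω j‖ + ‖γb ω‖)
      have h4 := norm_nonneg (G ω j)
      have h5 := norm_nonneg (γb ω)
      rw [Real.norm_eq_abs (‖G ω j‖ + ‖γb ω‖)]
      exact max_le (by linarith) (by linarith)
    exact amp_lip_memLp hL hp
  have hmom : ∫ ω, (F₀ (γb ω)) ^ 2 ∂P ≤ τ₁ ^ 2 := by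
    rw [← hγblaw, integral_map hγbmeas.aemeasurable] at hF₀mom
    · exact hF₀mom
    · exact (hL0.continuous.pow 2).aestronglyMeasurable
  have hfc : ∀ j, Continuous (fun q : ℝ × ℝ => f j q.1 q.2) := fun j =>
    (hflip j).choose_spec.continuous
  have hquad : ∀ a : Fin (n+1) → ℝ, a ≠ 0 →
      0 < (∫ ω, (a 0 * F₀ (γb ω) + ∑ j : Fin n, a j.succ * f j (G ω j) (γb ω)) ^ 2 ∂P) +
          (a 0) ^ 2 * (τ₁ ^ 2 - ∫ ω, (F₀ (γb ω)) ^ 2 ∂P) := by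
    intro a ha
    by_cases hz : ∀ j : Fin n, a j.succ = 0
    · have ha0 : a 0 ≠ 0 := by
        intro h0
        apply ha
        ext i
        refine Fin.cases h0 hz i
      simp only [hz, zero_mul, Finset.sum_const_zero, add_zero, mul_pow]
      rw [integral_const_mul, ← mul_add]
      have : 0 < a 0 ^ 2 * τ₁ ^ 2 := by positivity
      convert this using 2
      ring
    · push Not at hz
      obtain ⟨j, hj⟩ := hz
      have h1 : 0 ≤ a 0 ^ 2 * (τ₁ ^ 2 - ∫ ω, (F₀ (γb ω)) ^ 2 ∂P) :=
        mul_nonneg (sq_nonneg _) (sub_nonneg.2 hmom)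
      refine add_pos_of_pos_of_nonneg ?_ h1
      have hY : MemLp (fun ω => a 0 * F₀ (γb ω) + ∑ j : Fin n, a j.succ * f j (G ω j) (γb ω))
          2 P :=
        (hX0.const_mul _).add (memLp_finsetSum _ fun i _ => (hXj i).const_mul _)
      refine lt_of_le_of_ne (integral_nonneg fun ω => sq_nonneg _) fun h0 => ?_
      rw [eq_comm, integral_eq_zero_iff_of_nonneg (fun ω => sq_nonneg _) hY.integrable_sq] at h0
      have hcont : Continuous (fun q : ℝ × (Fin n → ℝ) =>
          a 0 * F₀ q.1 + ∑ j : Fin n, a j.succ * f j (q.2 j) q.1) := by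
        refine (continuous_const.mul (hL0.continuous.comp continuous_fst)).add
          (continuous_finsetSum _ fun i _ => continuous_const.mul ?_)
        have hc : Continuous (fun q : ℝ × (Fin n → ℝ) => (q.2 i, q.1)) := by fun_prop
        exact (hfc i).comp hc
      have hprod := (indepFun_iff_map_prod_eq_prod_map_map hγbmeas.aemeasurable
        hGmeas.aemeasurable).1 hindep
      have hae : ∀ᵐ q ∂((P.map γb).prod (P.map G)),
          a 0 * F₀ q.1 + ∑ j : Fin n, a j.succ * f j (q.2 j) q.1 = 0 := by
        rw [← hprod, ae_map_iff (by fun_prop)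
          (isClosed_eq hcont continuous_const).measurableSet]
        filter_upwards [h0] with ω hω
        simpa using hω
      have : IsProbabilityMeasure (P.map G) :=
        Measure.isProbabilityMeasure_map hGmeas.aemeasurable
      have hae2 := Measure.ae_ae_of_ae_prod hae
      rw [hγblaw] at hae2
      refine (hfnc j).ne' ?_
      refine measure_mono_null ?_ (ae_iff.1 hae2)
      rintro y ⟨x, x', hx⟩ hy
      have hall : (fun g : Fin n → ℝ => a 0 * F₀ y + ∑ j : Fin n, a j.succ * f j (g j) y)
          = fun _ => 0 :=
        Measure.eq_of_ae_eq (μ := P.map G) hy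
          (hcont.comp (continuous_const.prodMk continuous_id)) continuous_const
      have e1 := congrFun hall (Function.update 0 j x)
      have e2 := congrFun hall (Function.update 0 j x')
      rw [← Finset.add_sum_erase _ _ (Finset.mem_univ j)] at e1 e2
      have e3 : ∀ z : ℝ, ∑ i ∈ Finset.univ.erase j,
          a i.succ * f i ((Function.update (0 : Fin n → ℝ) j z) i) y =
          ∑ i ∈ Finset.univ.erase j, a i.succ * f i 0 y := by
        intro z
        refine Finset.sum_congr rfl fun i hi => ?_
        rw [Function.update_of_ne (Finset.ne_of_mem_erase hi)]; rfl
      rw [e3, Function.update_self] at e1 e2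
      apply hx
      apply mul_left_cancel₀ hj
      linarith
  refine ⟨?_, hquad⟩
  refine PosDef.of_dotProduct_mulVec_pos ?_ ?_
  · ext i j
    simp only [conjTranspose_apply, star_trivial]
    refine Fin.cases ?_ (fun i => ?_) i <;> refine Fin.cases ?_ (fun j => ?_) j
    · rfl
    · rw [hT0j, hTj0]
    · rw [hT0j, hTj0]
    · rw [hTij, hTij]; simp only [mul_comm]
  · intro a ha
    refine (hquad a ha).trans_eq ?_
    let X : Fin (n+1) → Ω → ℝ := Fin.cons (fun ω => F₀ (γb ω)) (fun j ω => f j (G ω j) (γb ω))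
    have hX : ∀ i, MemLp (X i) 2 P := fun i => Fin.cases hX0 hXj i
    have hint : ∀ i j, Integrable (fun ω => X i ω * X j ω) P := fun i j =>
      (hX i).integrable_mul (hX j)
    have e1 : (∫ ω, (a 0 * F₀ (γb ω) + ∑ j : Fin n, a j.succ * f j (G ω j) (γb ω)) ^ 2 ∂P)
        = ∑ i, ∑ j, a i * a j * ∫ ω, X i ω * X j ω ∂P := by
      have : ∀ ω, (a 0 * F₀ (γb ω) + ∑ j : Fin n, a j.succ * f j (G ω j) (γb ω)) ^ 2
          = ∑ i, ∑ j, a i * a j * (X i ω * X j ω) := by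
        intro ω
        have h : a 0 * F₀ (γb ω) + ∑ j : Fin n, a j.succ * f j (G ω j) (γb ω)
          = ∑ i, a i * X i ω := by rw [Fin.sum_univ_succ]; rfl
        rw [h, sq, Finset.sum_mul_sum]
        refine Finset.sum_congr rfl fun i _ => Finset.sum_congr rfl fun j _ => by ring
      simp_rw [this]
      rw [integral_finsetSum _ fun i _ => integrable_finsetSum _ fun j _ =>
        (hint i j).const_mul _]
      refine Finset.sum_congr rfl fun i _ => ?_
      rw [integral_finsetSum _ fun j _ => (hint i j).const_mul _]
      refine Finset.sum_congr rfl fun j _ => ?_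
      rw [integral_const_mul]
    rw [e1]
    simp only [dotProduct, mulVec, star_trivial, Finset.mul_sum]
    simp only [Fin.sum_univ_succ, hT00, hT0j, hTj0, hTij, X, Fin.cons_zero, Fin.cons_succ]
    have s1 : ∀ j, ∫ ω, f j (G ω j) (γb ω) * F₀ (γb ω) ∂P =
      ∫ ω, F₀ (γb ω) * f j (G ω j) (γb ω) ∂P := fun j => by simp only [mul_comm]
    have s2 : ∫ ω, F₀ (γb ω) * F₀ (γb ω) ∂P = ∫ ω, F₀ (γb ω) ^ 2 ∂P := by simp only [sq]
    simp only [s1, s2, mul_assoc, mul_comm, mul_left_comm]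
    ring



/-- **Positive definiteness of the limiting AMP covariance matrices** (Lemma 2.2 /
inductive step of the paper).  Given `τ₁ > 0`, a Lipschitz `F₀` with `E[F₀(γ̄)²] ≤ τ₁²`,
a positive definite covariance `Σ` of the Gaussian vector `(G₁,…,G_{k−1})` independent of
`γ̄ ∼ π`, and Lipschitz functions `f₁,…,f_{k−1}` which are non-constant in their first
argument on a set of `π`-positive measure, the matrix `T` with
`T₁₁ = τ₁²`, `T_{1,ℓ} = E[F₀(γ̄) f_{ℓ−1}(G_{ℓ−1}, γ̄)]` and
`T_{j,ℓ} = E[f_{j−1}(G_{j−1}, γ̄) f_{ℓ−1}(G_{ℓ−1}, γ̄)]` is positive definite;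
equivalently the displayed quadratic form is strictly positive for nonzero `a`. -/
theorem amp_covariance_posDef
    {Ω : Type*} [MeasurableSpace Ω] (P : Measure Ω) [IsProbabilityMeasure P]
    (k : ℕ) (hk : 2 ≤ k)
    (π : Measure ℝ) [IsProbabilityMeasure π] (hπ2 : Integrable (fun x => x ^ 2) π)
    (τ₁ : ℝ) (hτ₁ : 0 < τ₁)
    (F₀ : ℝ → ℝ) (hF₀lip : ∃ L : NNReal, LipschitzWith L F₀)
    (γb : Ω → ℝ) (hγbmeas : Measurable γb) (hγblaw : P.map γb = π)
    (hF₀mom : ∫ y, (F₀ y) ^ 2 ∂π ≤ τ₁ ^ 2)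
    (S : Matrix (Fin (k - 1)) (Fin (k - 1)) ℝ) (hS : S.PosDef)
    (G : Ω → Fin (k - 1) → ℝ) (hGmeas : Measurable G)
    -- (G₁,…,G_{k−1}) ∼ N_{k−1}(0, Σ): every linear functional is centred Gaussian with
    -- the appropriate variance
    (hGgauss : ∀ a : Fin (k - 1) → ℝ,
      P.map (fun ω => ∑ i, a i * G ω i) =
        gaussianReal 0 (Real.toNNReal (∑ i, ∑ j, a i * S i j * a j)))
    (hindep : IndepFun γb G P)
    (f : ℕ → ℝ → ℝ → ℝ)
    (hflip : ∀ ℓ, 1 ≤ ℓ → ℓ ≤ k - 1 →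
      ∃ L : NNReal, LipschitzWith L (fun q : ℝ × ℝ => f ℓ q.1 q.2))
    (hfnc : ∀ ℓ, 1 ≤ ℓ → ℓ ≤ k - 1 → 0 < π {y | ∃ x x' : ℝ, f ℓ x y ≠ f ℓ x' y})
    (T : Matrix (Fin k) (Fin k) ℝ)
    (hT00 : T ⟨0, by omega⟩ ⟨0, by omega⟩ = τ₁ ^ 2)
    (hT0j : ∀ j : Fin (k - 1),
      T ⟨0, by omega⟩ ⟨(j : ℕ) + 1, by have := j.isLt; omega⟩ =
        ∫ ω, F₀ (γb ω) * f ((j : ℕ) + 1) (G ω j) (γb ω) ∂P)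
    (hTj0 : ∀ j : Fin (k - 1),
      T ⟨(j : ℕ) + 1, by have := j.isLt; omega⟩ ⟨0, by omega⟩ =
        ∫ ω, F₀ (γb ω) * f ((j : ℕ) + 1) (G ω j) (γb ω) ∂P)
    (hTij : ∀ i j : Fin (k - 1),
      T ⟨(i : ℕ) + 1, by have := i.isLt; omega⟩ ⟨(j : ℕ) + 1, by have := j.isLt; omega⟩ =
        ∫ ω, f ((i : ℕ) + 1) (G ω i) (γb ω) * f ((j : ℕ) + 1) (G ω j) (γb ω) ∂P) :
    T.PosDef ∧
    ∀ a : Fin k → ℝ, a ≠ 0 →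
      0 < (∫ ω, (a ⟨0, by omega⟩ * F₀ (γb ω) +
            ∑ j : Fin (k - 1), a ⟨(j : ℕ) + 1, by have := j.isLt; omega⟩ *
              f ((j : ℕ) + 1) (G ω j) (γb ω)) ^ 2 ∂P) +
          (a ⟨0, by omega⟩) ^ 2 * (τ₁ ^ 2 - ∫ ω, (F₀ (γb ω)) ^ 2 ∂P) := by
  obtain ⟨n, rfl⟩ : ∃ n, k = n + 1 := ⟨k - 1, by omega⟩
  exact amp_core P n π hπ2 τ₁ hτ₁ F₀ hF₀lip γb hγbmeas hγblaw hF₀mom S hS G hGmeas hGgauss hindep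
    (fun j => f ((j : ℕ) + 1)) (fun j => hflip _ (by omega) (by have := j.isLt; omega))
    (fun j => hfnc _ (by omega) (by have := j.isLt; omega)) T hT00 hT0j hTj0 hTij
end

section
/- Fix D ∈ ℕ and r ∈ [1,∞). There exists a countable set T_r ⊆ PL_D(r) such that for every P ∈ 𝒫_D(r) and every sequence (P_n) in 𝒫_D(r), the following are equivalent as n → ∞: (i) ∫ ψ dP_n → ∫ ψ dP for all ψ ∈ T_r; (ii) d̃_r(P_n, P) → 0; (iii) d_r(P_n, P) → 0. Moreover, each of these conditions implies that ∫ ψ dP_n → ∫ ψ dP for every ψ ∈ PL_D(r). -/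
open MeasureTheory Filter

/-- The Euclidean norm on `ℝ^D`. -/
noncomputable def euclNorm {D : ℕ} (x : Fin D → ℝ) : ℝ :=
  Real.sqrt (∑ i, (x i) ^ 2)

/-- Pseudo-Lipschitz functions of order `r` with constant `L` on `ℝ^D` (the class
`PL_D(r, L)`), with respect to the Euclidean norm. -/
def PLD {D : ℕ} (r L : ℝ) (ψ : (Fin D → ℝ) → ℝ) : Prop :=
  ∀ x y : Fin D → ℝ, |ψ x - ψ y| ≤
    L * euclNorm (fun i => x i - y i) *
      (1 + euclNorm x ^ (r - 1) + euclNorm y ^ (r - 1))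

/-- The `r`-Wasserstein distance on `ℝ^D` (with values in `ℝ≥0∞`):
`d_r(P,Q) = inf over couplings γ of (∫ ‖x − y‖^r dγ)^{1/r}`. -/
noncomputable def wassR (D : ℕ) (r : ℝ) (P Q : Measure (Fin D → ℝ)) : ENNReal :=
  ⨅ γ : {γ : Measure ((Fin D → ℝ) × (Fin D → ℝ)) //
      γ.map Prod.fst = P ∧ γ.map Prod.snd = Q},
    (∫⁻ q, ENNReal.ofReal (euclNorm (fun i => q.1 i - q.2 i) ^ r) ∂γ.1) ^ (1 / r)

open scoped ENNReal in
lemma plw_coupling {X : Type*} [MeasurableSpace X] (P Q : Measure X) [IsProbabilityMeasure P]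
    [IsProbabilityMeasure Q] (f : ℕ → X → ℝ≥0∞) (hf : ∀ i, Measurable (f i)) (N : ℕ)
    (hS : ∀ x, ∑ i ∈ Finset.range N, f i x ≤ 1) (w : X → ℝ≥0∞) (hw : Measurable w)
    (c : X × X → ℝ≥0∞) (d C lam : ℝ≥0∞) (hlam : 1 ≤ lam)
    (h1 : ∀ i x y, f i x ≠ 0 → f i y ≠ 0 → c (x, y) ≤ d)
    (h2 : ∀ x y, c (x, y) ≤ C * (w x + w y))
    (h3 : ∀ i x y, f i x ≠ 0 → f i y ≠ 0 → w y ≤ lam * w x) :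
    ∃ γ : Measure (X × X), γ.map Prod.fst = P ∧ γ.map Prod.snd = Q ∧ ∃ R S : ℝ≥0∞,
      ∫⁻ q, c q ∂γ ≤ d + C * (R + S) ∧
      ∫⁻ x, w x ∂Q + R ≤ lam * ∫⁻ x, w x ∂P + S ∧
      S + ∑ i ∈ Finset.range N, (min (∫⁻ x, f i x ∂P) (∫⁻ x, f i x ∂Q) * (∫⁻ x, f i x ∂Q)⁻¹) *
        ∫⁻ x, f i x * w x ∂Q = ∫⁻ x, w x ∂Q := by
  classical
  set a : ℕ → ℝ≥0∞ := fun i => ∫⁻ x, f i x ∂P with ha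
  set b : ℕ → ℝ≥0∞ := fun i => ∫⁻ x, f i x ∂Q with hb
  set m : ℕ → ℝ≥0∞ := fun i => min (a i) (b i) with hm
  -- WLOG-type restriction: truncated family
  have hf1 : ∀ i ∈ Finset.range N, ∀ x, f i x ≤ 1 := fun i hi x =>
    (Finset.single_le_sum (f := fun i => f i x) (fun _ _ => zero_le) hi).trans (hS x)
  have hfin : ∀ (μ : Measure X) [IsProbabilityMeasure μ], ∀ i ∈ Finset.range N,
      ∫⁻ x, f i x ∂μ ≤ 1 := by
    intro μ _ i hi
    calc ∫⁻ x, f i x ∂μ ≤ ∫⁻ x, 1 ∂μ := lintegral_mono (hf1 i hi)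
      _ = 1 := by simp
  have key : ∀ s t : ℝ≥0∞, s ≤ 1 → t ≤ 1 → min s t * s⁻¹ ≤ 1 ∧ min s t * s⁻¹ * s = min s t ∧
      min s t * (s⁻¹ * t⁻¹) * t = min s t * s⁻¹ := by
    intro s t hs ht
    have hs' : s ≠ ⊤ := ne_top_of_le_ne_top ENNReal.one_ne_top hs
    have ht' : t ≠ ⊤ := ne_top_of_le_ne_top ENNReal.one_ne_top ht
    rcases eq_or_ne s 0 with rfl | hs0
    · simp
    rcases eq_or_ne t 0 with rfl | ht0
    · simp
    refine ⟨?_, ?_, ?_⟩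
    · calc min s t * s⁻¹ ≤ s * s⁻¹ := by gcongr; exact min_le_left _ _
        _ = 1 := ENNReal.mul_inv_cancel hs0 hs'
    · rw [mul_assoc, ENNReal.inv_mul_cancel hs0 hs', mul_one]
    · rw [← mul_assoc, mul_assoc (min s t * s⁻¹), ENNReal.inv_mul_cancel ht0 ht', mul_one]
  set α : ℕ → ℝ≥0∞ := fun i => m i * (a i)⁻¹ with hα
  set β : ℕ → ℝ≥0∞ := fun i => m i * (b i)⁻¹ with hβ
  have kP := fun i hi => key (a i) (b i) (hfin P i hi) (hfin Q i hi)
  have kQ := fun i hi => key (b i) (a i) (hfin Q i hi) (hfin P i hi)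
  -- generic decomposition
  have dec : ∀ (μ : Measure X) [IsProbabilityMeasure μ] (κ : ℕ → ℝ≥0∞),
      (∀ i ∈ Finset.range N, κ i ≤ 1) →
      ∃ ρ : Measure X, IsFiniteMeasure ρ ∧
        μ = ∑ i ∈ Finset.range N, κ i • μ.withDensity (f i) + ρ := by
    intro μ _ κ hκ
    have hgm : Measurable (fun x => ∑ i ∈ Finset.range N, κ i * f i x) :=
      Finset.measurable_sum _ (fun i _ => (hf i).const_mul _)
    have hg1 : ∀ x, ∑ i ∈ Finset.range N, κ i * f i x ≤ 1 := by
      intro x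
      refine le_trans (Finset.sum_le_sum (fun i hi => ?_)) (hS x)
      calc κ i * f i x ≤ 1 * f i x := by gcongr; exact hκ i hi
        _ = f i x := one_mul _
    refine ⟨μ.withDensity (fun x => 1 - ∑ i ∈ Finset.range N, κ i * f i x), ?_, ?_⟩
    · refine isFiniteMeasure_withDensity (ne_top_of_le_ne_top ENNReal.one_ne_top ?_)
      calc _ ≤ ∫⁻ x, 1 ∂μ := lintegral_mono (fun x => tsub_le_self)
        _ = 1 := by simp
    · have e1 : ∑ i ∈ Finset.range N, κ i • μ.withDensity (f i)
          = μ.withDensity (fun x => ∑ i ∈ Finset.range N, κ i * f i x) := by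
        ext s hs
        rw [withDensity_apply _ hs, lintegral_finsetSum _ (fun i _ => (hf i).const_mul _)]
        simp only [Measure.coe_finsetSum, Finset.sum_apply, Measure.smul_apply, smul_eq_mul]
        refine Finset.sum_congr rfl (fun i _ => ?_)
        rw [withDensity_apply _ hs, lintegral_const_mul _ (hf i)]
      rw [e1, ← withDensity_add_left hgm]
      conv_lhs => rw [← withDensity_one (μ := μ)]
      congr 1
      ext x
      simp only [Pi.add_apply, Pi.one_apply]
      rw [add_tsub_cancel_of_le (hg1 x)]
  have kQ1 : ∀ i ∈ Finset.range N, β i ≤ 1 := fun i hi => by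
    have := (kQ i hi).1; rwa [min_comm] at this
  have kQ2 : ∀ i ∈ Finset.range N, β i * b i = m i := fun i hi => by
    have := (kQ i hi).2.1; rwa [min_comm] at this
  have kQ3 : ∀ i ∈ Finset.range N, m i * ((a i)⁻¹ * (b i)⁻¹) * a i = β i := fun i hi => by
    have := (kQ i hi).2.2; rwa [min_comm, mul_comm (b i)⁻¹] at this
  obtain ⟨ρ, hρf, hρ⟩ := dec P α (fun i hi => (kP i hi).1)
  obtain ⟨σ, hσf, hσ⟩ := dec Q β kQ1
  have hmass : ρ Set.univ = σ Set.univ := by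
    have e1 := congrArg (fun μ : Measure X => μ Set.univ) hρ
    have e2 := congrArg (fun μ : Measure X => μ Set.univ) hσ
    simp only [measure_univ, Measure.coe_add, Measure.coe_finsetSum, Pi.add_apply,
      Finset.sum_apply, Measure.smul_apply, smul_eq_mul, withDensity_apply _ MeasurableSet.univ,
      Measure.restrict_univ] at e1 e2
    have e1' : (1 : ℝ≥0∞) = ∑ i ∈ Finset.range N, m i + ρ Set.univ := by
      rw [e1]; congr 1; exact Finset.sum_congr rfl (fun i hi => (kP i hi).2.1)
    have e2' : (1 : ℝ≥0∞) = ∑ i ∈ Finset.range N, m i + σ Set.univ := by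
      rw [e2]; congr 1; exact Finset.sum_congr rfl (fun i hi => kQ2 i hi)
    have hne : ∑ i ∈ Finset.range N, m i ≠ ⊤ :=
      ne_top_of_le_ne_top ENNReal.one_ne_top (by rw [e1']; exact le_self_add)
    exact (ENNReal.add_right_inj hne).1 (e1'.symm.trans e2')
  set π : Measure (X × X) := ∑ i ∈ Finset.range N, (m i * ((a i)⁻¹ * (b i)⁻¹)) •
    (P.withDensity (f i)).prod (Q.withDensity (f i)) with hπ
  set τ : Measure (X × X) := (ρ Set.univ)⁻¹ • ρ.prod σ with hτ
  have fP : ∀ i ∈ Finset.range N, IsFiniteMeasure (P.withDensity (f i)) := fun i hi =>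
    isFiniteMeasure_withDensity (ne_top_of_le_ne_top ENNReal.one_ne_top (hfin P i hi))
  have fQ : ∀ i ∈ Finset.range N, IsFiniteMeasure (Q.withDensity (f i)) := fun i hi =>
    isFiniteMeasure_withDensity (ne_top_of_le_ne_top ENNReal.one_ne_top (hfin Q i hi))
  have msum : ∀ (g : X × X → X), Measurable g → ∀ (μs : ℕ → Measure (X × X)),
      (∑ i ∈ Finset.range N, μs i).map g = ∑ i ∈ Finset.range N, (μs i).map g := by
    intro g hg μs
    ext s hs
    rw [Measure.map_apply hg hs]
    simp only [Measure.coe_finsetSum, Finset.sum_apply]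
    exact Finset.sum_congr rfl (fun i _ => (Measure.map_apply hg hs).symm)
  have π1 : π.map Prod.fst = ∑ i ∈ Finset.range N, α i • P.withDensity (f i) := by
    rw [hπ, msum _ measurable_fst]
    refine Finset.sum_congr rfl (fun i hi => ?_)
    have := fP i hi
    have := fQ i hi
    rw [Measure.map_smul, Measure.map_fst_prod, smul_smul, withDensity_apply _ MeasurableSet.univ,
      Measure.restrict_univ, (kP i hi).2.2]
  have π2 : π.map Prod.snd = ∑ i ∈ Finset.range N, β i • Q.withDensity (f i) := by
    rw [hπ, msum _ measurable_snd]
    refine Finset.sum_congr rfl (fun i hi => ?_)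
    have := fP i hi
    have := fQ i hi
    rw [Measure.map_smul, Measure.map_snd_prod, smul_smul, withDensity_apply _ MeasurableSet.univ,
      Measure.restrict_univ, kQ3 i hi]
  have τ1 : τ.map Prod.fst = ρ := by
    rw [hτ, Measure.map_smul, Measure.map_fst_prod, smul_smul, ← hmass]
    rcases eq_or_ne (ρ Set.univ) 0 with h0 | h0
    · have h00 : ρ = 0 := Measure.measure_univ_eq_zero.1 h0
      rw [h00, smul_zero]
    · rw [ENNReal.inv_mul_cancel h0 (measure_ne_top _ _), one_smul]
  have τ2 : τ.map Prod.snd = σ := by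
    rw [hτ, Measure.map_smul, Measure.map_snd_prod, smul_smul]
    rcases eq_or_ne (ρ Set.univ) 0 with h0 | h0
    · have h00 : σ = 0 := Measure.measure_univ_eq_zero.1 (hmass.symm.trans h0)
      rw [h00, smul_zero]
    · rw [ENNReal.inv_mul_cancel h0 (measure_ne_top _ _), one_smul]
  have hae : ∀ᵐ q ∂π, c q ≤ d ∧ w q.2 ≤ lam * w q.1 := by
    have : ∀ i ∈ Finset.range N, ∀ᵐ q ∂((m i * ((a i)⁻¹ * (b i)⁻¹)) •
        (P.withDensity (f i)).prod (Q.withDensity (f i))), c q ≤ d ∧ w q.2 ≤ lam * w q.1 := by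
      intro i hi
      have := fP i hi
      have := fQ i hi
      refine Measure.ae_smul_measure ?_ _
      have p1 : ∀ᵐ x ∂(P.withDensity (f i)), f i x ≠ 0 := by
        rw [ae_withDensity_iff (hf i)]; exact Eventually.of_forall (fun _ h => h)
      have p2 : ∀ᵐ x ∂(Q.withDensity (f i)), f i x ≠ 0 := by
        rw [ae_withDensity_iff (hf i)]; exact Eventually.of_forall (fun _ h => h)
      filter_upwards [Measure.quasiMeasurePreserving_fst.ae p1,
        Measure.quasiMeasurePreserving_snd.ae p2] with q hq1 hq2
      exact ⟨h1 i q.1 q.2 hq1 hq2, h3 i q.1 q.2 hq1 hq2⟩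
    rw [ae_iff, hπ, Measure.coe_finsetSum, Finset.sum_apply]
    exact Finset.sum_eq_zero (fun i hi => ae_iff.1 (this i hi))
  have hPd : P = π.map Prod.fst + ρ := by rw [π1]; exact hρ
  have hQd : Q = π.map Prod.snd + σ := by rw [π2]; exact hσ
  have hπm : π Set.univ ≤ 1 := by
    have := congrArg (fun μ : Measure X => μ Set.univ) hPd
    simp only [measure_univ, Measure.coe_add, Pi.add_apply,
      Measure.map_apply measurable_fst MeasurableSet.univ, Set.preimage_univ] at this
    rw [this]; exact le_self_add
  have lP : ∫⁻ x, w x ∂P = ∫⁻ q, w q.1 ∂π + ∫⁻ x, w x ∂ρ := by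
    conv_lhs => rw [hPd]
    rw [lintegral_add_measure, lintegral_map hw measurable_fst]
  have lQ : ∫⁻ x, w x ∂Q = ∫⁻ q, w q.2 ∂π + ∫⁻ x, w x ∂σ := by
    conv_lhs => rw [hQd]
    rw [lintegral_add_measure, lintegral_map hw measurable_snd]
  refine ⟨π + τ, ?_, ?_, ∫⁻ x, w x ∂ρ, ∫⁻ x, w x ∂σ, ?_, ?_, ?_⟩
  · rw [Measure.map_add _ _ measurable_fst, τ1]; exact hPd.symm
  · rw [Measure.map_add _ _ measurable_snd, τ2]; exact hQd.symm
  · rw [lintegral_add_measure]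
    refine add_le_add ?_ ?_
    · calc ∫⁻ q, c q ∂π ≤ ∫⁻ q, d ∂π := lintegral_mono_ae (hae.mono fun q h => h.1)
        _ = d * π Set.univ := by simp
        _ ≤ d * 1 := by gcongr
        _ = d := mul_one d
    · calc ∫⁻ q, c q ∂τ ≤ ∫⁻ q, C * (w q.1 + w q.2) ∂τ := lintegral_mono (fun q => h2 q.1 q.2)
        _ = C * (∫⁻ q, w q.1 ∂τ + ∫⁻ q, w q.2 ∂τ) := by
          rw [lintegral_const_mul, lintegral_add_left]
          · exact hw.comp measurable_fst
          · exact (hw.comp measurable_fst).add (hw.comp measurable_snd)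
        _ = _ := by
          have q1 : ∫⁻ q, w q.1 ∂τ = ∫⁻ x, w x ∂ρ := by
            conv_rhs => rw [← τ1]
            rw [lintegral_map hw measurable_fst]
          have q2 : ∫⁻ q, w q.2 ∂τ = ∫⁻ x, w x ∂σ := by
            conv_rhs => rw [← τ2]
            rw [lintegral_map hw measurable_snd]
          rw [q1, q2]
  · rw [lP, lQ]
    have : ∫⁻ q, w q.2 ∂π ≤ lam * ∫⁻ q, w q.1 ∂π := by
      rw [← lintegral_const_mul lam (show Measurable fun q : X × X => w q.1 from hw.comp measurable_fst)]
      exact lintegral_mono_ae (hae.mono fun q h => h.2)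
    calc ∫⁻ q, w q.2 ∂π + ∫⁻ x, w x ∂σ + ∫⁻ x, w x ∂ρ
        ≤ lam * ∫⁻ q, w q.1 ∂π + ∫⁻ x, w x ∂σ + lam * ∫⁻ x, w x ∂ρ := by
          gcongr
          exact le_mul_of_one_le_left zero_le hlam
      _ = _ := by ring
  · rw [lQ, add_comm]
    congr 1
    rw [← lintegral_map hw measurable_snd, π2, lintegral_finsetSum_measure]
    refine Finset.sum_congr rfl (fun i _ => ?_)
    rw [lintegral_smul_measure, lintegral_withDensity_eq_lintegral_mul _ (hf i) hw]
    rfl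

lemma plw_eq {D : ℕ} (x : Fin D → ℝ) : euclNorm x = ‖WithLp.toLp 2 x‖ := by
  simp [euclNorm, EuclideanSpace.norm_eq]

lemma plw_nonneg {D : ℕ} (x : Fin D → ℝ) : 0 ≤ euclNorm x := Real.sqrt_nonneg _

lemma plw_sub {D : ℕ} (x y : Fin D → ℝ) :
    euclNorm (fun i => x i - y i) = ‖WithLp.toLp 2 x - WithLp.toLp 2 y‖ := by
  rw [plw_eq]; rfl

lemma plw_comm {D : ℕ} (x y : Fin D → ℝ) :
    euclNorm (fun i => x i - y i) = euclNorm (fun i => y i - x i) := by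
  rw [plw_sub, plw_sub, norm_sub_rev]

lemma plw_tri {D : ℕ} (x y z : Fin D → ℝ) :
    euclNorm (fun i => x i - z i) ≤ euclNorm (fun i => x i - y i) + euclNorm (fun i => y i - z i) := by
  rw [plw_sub, plw_sub, plw_sub]; exact norm_sub_le_norm_sub_add_norm_sub _ _ _

lemma plw_le_add {D : ℕ} (x y : Fin D → ℝ) :
    euclNorm x ≤ euclNorm y + euclNorm (fun i => x i - y i) := by
  rw [plw_sub, plw_eq, plw_eq]; exact norm_le_norm_add_norm_sub' _ _

lemma plw_sub_le {D : ℕ} (x y : Fin D → ℝ) :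
    euclNorm (fun i => x i - y i) ≤ euclNorm x + euclNorm y := by
  rw [plw_sub, plw_eq, plw_eq]; exact norm_sub_le _ _

lemma plw_cont {D : ℕ} : Continuous (euclNorm : (Fin D → ℝ) → ℝ) := by
  unfold euclNorm; fun_prop

lemma plw_zero {D : ℕ} : euclNorm (0 : Fin D → ℝ) = 0 := by simp [euclNorm]

/-- PL functions are continuous. -/
lemma plw_PLD_cont {D : ℕ} {r L : ℝ} (hr : 1 ≤ r) {ψ : (Fin D → ℝ) → ℝ} (h : PLD r L ψ) :
    Continuous ψ := by
  rw [continuous_iff_continuousAt]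
  intro y
  rw [ContinuousAt, tendsto_iff_dist_tendsto_zero]
  have hc : Continuous (fun x : Fin D → ℝ => L * euclNorm (fun i => x i - y i) *
      (1 + euclNorm x ^ (r - 1) + euclNorm y ^ (r - 1))) := by
    have h1 : Continuous (fun x : Fin D → ℝ => euclNorm (fun i => x i - y i)) :=
      plw_cont.comp (by fun_prop)
    have h2 : Continuous (fun x : Fin D → ℝ => euclNorm x ^ (r - 1)) :=
      plw_cont.rpow_const (fun _ => Or.inr (by linarith))
    fun_prop
  have h0 := hc.tendsto y
  have e : (fun i => y i - y i) = (0 : Fin D → ℝ) := by ext; simp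
  simp only [e, plw_zero, mul_zero, zero_mul] at h0
  exact squeeze_zero (fun _ => dist_nonneg) (fun x => by rw [Real.dist_eq]; exact h x y) h0

/-- The weight. -/
noncomputable def plwW {D : ℕ} (r : ℝ) (x : Fin D → ℝ) : ℝ := (1 + euclNorm x) ^ r

lemma plwW_cont {D : ℕ} {r : ℝ} (hr : 1 ≤ r) : Continuous (plwW r : (Fin D → ℝ) → ℝ) :=
  (continuous_const.add plw_cont).rpow_const (fun _ => Or.inr (by linarith))

lemma plwW_one_le {D : ℕ} {r : ℝ} (hr : 1 ≤ r) (x : Fin D → ℝ) : 1 ≤ plwW r x :=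
  Real.one_le_rpow (by linarith [plw_nonneg x]) (by linarith)

lemma plw_pow_add {s a : ℝ} (hs : 0 ≤ s) (ha : 0 ≤ a) :
    (1 + a) ^ s ≤ 2 ^ s * (1 + a ^ s) := by
  have h2 : (0 : ℝ) ≤ 2 ^ s := by positivity
  have ha' : 0 ≤ a ^ s := by positivity
  rcases le_total a 1 with h | h
  · calc (1 + a) ^ s ≤ 2 ^ s := Real.rpow_le_rpow (by linarith) (by linarith) hs
      _ ≤ _ := by nlinarith
  · calc (1 + a) ^ s ≤ (2 * a) ^ s := Real.rpow_le_rpow (by linarith) (by linarith) hs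
      _ = 2 ^ s * a ^ s := Real.mul_rpow (by norm_num) ha
      _ ≤ _ := by nlinarith

lemma plw_rpow_sub {r A B : ℝ} (hr : 1 ≤ r) (hA : 0 < A) (hB : 0 < B) :
    A ^ r - B ^ r ≤ r * |A - B| * (A ^ (r - 1) + B ^ (r - 1)) := by
  have hA' : 0 < A ^ (r - 1) := by positivity
  have hB' : 0 < B ^ (r - 1) := by positivity
  have hb := one_add_mul_self_le_rpow_one_add (s := B / A - 1)
    (by have : 0 < B / A := by positivity
        linarith) hr
  have e : (1 + (B / A - 1)) ^ r = B ^ r / A ^ r := by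
    rw [add_sub_cancel, Real.div_rpow hB.le hA.le]
  rw [e, le_div_iff₀ (by positivity)] at hb
  have eA : A ^ r = A ^ (r - 1) * A := by
    rw [Real.rpow_sub_one hA.ne']; field_simp
  have e2 : (1 + r * (B / A - 1)) * A ^ r = A ^ r - r * (A - B) * A ^ (r - 1) := by
    rw [eA]; field_simp; ring
  have h3 : r * (A - B) * A ^ (r - 1) ≤ r * |A - B| * A ^ (r - 1) := by
    gcongr; exact le_abs_self _
  have h4 : 0 ≤ r * |A - B| * B ^ (r - 1) := by positivity
  rw [e2] at hb
  nlinarith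

lemma plw_abs_sub {D : ℕ} (x y : Fin D → ℝ) :
    |euclNorm x - euclNorm y| ≤ euclNorm (fun i => x i - y i) := by
  rw [abs_le]
  have h1 := plw_le_add x y
  have h2 := plw_le_add y x
  rw [plw_comm y x] at h2
  constructor <;> linarith

lemma plwW_PLD {D : ℕ} {r : ℝ} (hr : 1 ≤ r) :
    PLD r (r * (2 ^ (r - 1) * 2)) (plwW r : (Fin D → ℝ) → ℝ) := by
  intro x y
  have hx := plw_nonneg x
  have hy := plw_nonneg y
  have h1 := plw_rpow_sub hr (show 0 < 1 + euclNorm x by linarith) (show 0 < 1 + euclNorm y by linarith)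
  have h2 := plw_rpow_sub hr (show 0 < 1 + euclNorm y by linarith) (show 0 < 1 + euclNorm x by linarith)
  have h3 := plw_pow_add (s := r - 1) (by linarith) hx
  have h4 := plw_pow_add (s := r - 1) (by linarith) hy
  have h5 := plw_abs_sub x y
  have e1 : (1 + euclNorm x) - (1 + euclNorm y) = euclNorm x - euclNorm y := by ring
  have e2 : (1 + euclNorm y) - (1 + euclNorm x) = -(euclNorm x - euclNorm y) := by ring
  rw [e1] at h1
  rw [e2, abs_neg] at h2
  have h6 : |plwW r x - plwW r y| ≤ r * |euclNorm x - euclNorm y| *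
      ((1 + euclNorm x) ^ (r - 1) + (1 + euclNorm y) ^ (r - 1)) := by
    unfold plwW
    rw [abs_le]
    constructor <;> linarith
  have ht := plw_nonneg (fun i => x i - y i)
  have p : (0 : ℝ) < 2 ^ (r - 1) := by positivity
  have px : 0 ≤ euclNorm x ^ (r - 1) := by positivity
  have py : 0 ≤ euclNorm y ^ (r - 1) := by positivity
  calc _ ≤ _ := h6
    _ ≤ r * euclNorm (fun i => x i - y i) *
      (2 ^ (r - 1) * 2 * (1 + euclNorm x ^ (r - 1) + euclNorm y ^ (r - 1))) := by
      refine mul_le_mul (by gcongr) (by nlinarith) (by positivity) (by positivity)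
    _ = _ := by ring

lemma plwW_le {D : ℕ} {r : ℝ} (x y : Fin D → ℝ) (hr : 1 ≤ r) :
    plwW r y ≤ (1 + euclNorm (fun i => x i - y i)) ^ r * plwW r x := by
  have hx := plw_nonneg x
  have hy := plw_nonneg y
  have ht := plw_nonneg (fun i => x i - y i)
  unfold plwW
  rw [← Real.mul_rpow (by linarith) (by linarith)]
  refine Real.rpow_le_rpow (by linarith) ?_ (by linarith)
  have h2 := plw_le_add y x
  rw [plw_comm y x] at h2
  nlinarith

lemma plw_cost_le {D : ℕ} {r : ℝ} (x y : Fin D → ℝ) (hr : 1 ≤ r) :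
    euclNorm (fun i => x i - y i) ^ r ≤ 2 ^ r * (plwW r x + plwW r y) := by
  have hx := plw_nonneg x
  have hy := plw_nonneg y
  have ht := plw_nonneg (fun i => x i - y i)
  have h := plw_sub_le x y
  have p : (0 : ℝ) < 2 ^ r := by positivity
  have px := plwW_one_le hr x
  have py := plwW_one_le hr y
  rcases le_total (euclNorm x) (euclNorm y) with hl | hl
  · calc _ ≤ (2 * (1 + euclNorm y)) ^ r := Real.rpow_le_rpow ht (by linarith) (by linarith)
      _ = 2 ^ r * plwW r y := Real.mul_rpow (by norm_num) (by linarith)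
      _ ≤ _ := by nlinarith
  · calc _ ≤ (2 * (1 + euclNorm x)) ^ r := Real.rpow_le_rpow ht (by linarith) (by linarith)
      _ = 2 ^ r * plwW r x := Real.mul_rpow (by norm_num) (by linarith)
      _ ≤ _ := by nlinarith

lemma plw_young {D : ℕ} {r θ : ℝ} (hr : 1 ≤ r) (hθ : 0 < θ) (hθ1 : θ ≤ 1) (x y : Fin D → ℝ) :
    euclNorm (fun i => x i - y i) * (1 + euclNorm x ^ (r - 1) + euclNorm y ^ (r - 1)) ≤
      θ * (3 * 2 ^ (r - 1)) * plwW r y +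
        3 * (2 / θ) ^ (r - 1) * euclNorm (fun i => x i - y i) ^ r := by
  have hx := plw_nonneg x
  have hy := plw_nonneg y
  have ht := plw_nonneg (fun i => x i - y i)
  have h := plw_le_add x y
  set t := euclNorm (fun i => x i - y i)
  set a := euclNorm x
  set b := euclNorm y
  have hr1 : 0 ≤ r - 1 := by linarith
  have split : ∀ z : ℝ, 0 < z → z ^ r = z ^ (r - 1) * z := fun z hz => by
    rw [Real.rpow_sub_one hz.ne']; field_simp
  have bd : ∀ M : ℝ, 1 ≤ M → a ≤ M → b ≤ M → 1 + a ^ (r - 1) + b ^ (r - 1) ≤ 3 * M ^ (r - 1) := by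
    intro M hM ha hb
    have := Real.one_le_rpow hM hr1
    have := Real.rpow_le_rpow hx ha hr1
    have := Real.rpow_le_rpow hy hb hr1
    linarith
  have pw : 0 ≤ plwW r y := by have := plwW_one_le hr y; linarith
  rcases le_or_gt t (θ * (1 + b)) with hc | hc
  · have := bd (2 * (1 + b)) (by linarith) (by nlinarith) (by linarith)
    calc t * (1 + a ^ (r - 1) + b ^ (r - 1)) ≤ (θ * (1 + b)) * (3 * (2 * (1 + b)) ^ (r - 1)) := by
          gcongr
      _ = θ * (3 * 2 ^ (r - 1)) * plwW r y := by
          rw [Real.mul_rpow (by norm_num) (by linarith), plwW, split (1 + euclNorm y) (by positivity)]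
          ring
      _ ≤ _ := le_add_of_nonneg_right (by positivity)
  · have t0 : 0 < t := lt_of_le_of_lt (by positivity) hc
    have hc' : 1 + b ≤ t / θ := by rw [le_div_iff₀ hθ]; linarith
    have htt : t ≤ t / θ := by rw [le_div_iff₀ hθ]; nlinarith
    have e : 2 / θ * t = 2 * (t / θ) := by ring
    have := bd (2 / θ * t) (by rw [e]; linarith) (by rw [e]; linarith) (by rw [e]; linarith)
    calc t * (1 + a ^ (r - 1) + b ^ (r - 1)) ≤ t * (3 * (2 / θ * t) ^ (r - 1)) := by gcongr
      _ = 3 * (2 / θ) ^ (r - 1) * t ^ r := by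
          rw [Real.mul_rpow (by positivity) ht, split t t0]; ring
      _ ≤ _ := le_add_of_nonneg_left (by positivity)

/-- bumps -/
noncomputable def plwU {D : ℕ} (δ : ℝ) (i : ℕ) (x : Fin D → ℝ) : ℝ :=
  max 0 (min 1 (2 - euclNorm (fun j => x j - TopologicalSpace.denseSeq (Fin D → ℝ) i j) / δ))

noncomputable def plwS {D : ℕ} (δ : ℝ) : ℕ → (Fin D → ℝ) → ℝ
  | 0 => fun _ => 0
  | n + 1 => fun x => max (plwS δ n x) (plwU δ n x)

noncomputable def plwPhi {D : ℕ} (δ : ℝ) (i : ℕ) (x : Fin D → ℝ) : ℝ :=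
  plwS δ (i + 1) x - plwS δ i x

lemma plwU_lip {D : ℕ} {δ : ℝ} (hδ : 0 < δ) (i : ℕ) (x y : Fin D → ℝ) :
    |plwU δ i x - plwU δ i y| ≤ euclNorm (fun j => x j - y j) / δ := by
  unfold plwU
  set q := TopologicalSpace.denseSeq (Fin D → ℝ) i
  refine (abs_max_sub_max_le_max _ _ _ _).trans ?_
  have ht := plw_nonneg (fun i => x i - y i)
  have h1 := plw_tri x y q
  have h2 := plw_tri y x q
  rw [plw_comm y x] at h2
  refine max_le (by simp; positivity) ?_
  refine (abs_min_sub_min_le_max _ _ _ _).trans ?_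
  refine max_le (by simp; positivity) ?_
  rw [show ∀ a b : ℝ, 2 - a / δ - (2 - b / δ) = (b - a) / δ by intros; ring, abs_div, abs_of_pos hδ]
  gcongr
  rw [abs_le]; constructor <;> linarith

lemma plwS_lip {D : ℕ} {δ : ℝ} (hδ : 0 < δ) (i : ℕ) (x y : Fin D → ℝ) :
    |plwS δ i x - plwS δ i y| ≤ euclNorm (fun j => x j - y j) / δ := by
  have ht := plw_nonneg (fun i => x i - y i)
  induction i with
  | zero => simp [plwS]; positivity
  | succ n ih =>
    simp only [plwS]
    exact (abs_max_sub_max_le_max _ _ _ _).trans (max_le ih (plwU_lip hδ n x y))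

lemma plwS_mem {D : ℕ} (δ : ℝ) (i : ℕ) (x : Fin D → ℝ) : 0 ≤ plwS δ i x ∧ plwS δ i x ≤ 1 := by
  induction i with
  | zero => simp [plwS]
  | succ n ih =>
    simp only [plwS]
    exact ⟨le_max_of_le_left ih.1, max_le ih.2 (max_le zero_le_one (min_le_left _ _))⟩

lemma plwS_mono {D : ℕ} (δ : ℝ) (x : Fin D → ℝ) : Monotone (fun i => plwS δ i x) :=
  monotone_nat_of_le_succ (fun n => by simp only [plwS]; exact le_max_left _ _)

lemma plwPhi_nonneg {D : ℕ} (δ : ℝ) (i : ℕ) (x : Fin D → ℝ) : 0 ≤ plwPhi δ i x :=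
  sub_nonneg.2 (plwS_mono δ x (Nat.le_succ i))

lemma plwPhi_sum {D : ℕ} (δ : ℝ) (N : ℕ) (x : Fin D → ℝ) :
    ∑ i ∈ Finset.range N, plwPhi δ i x = plwS δ N x := by
  unfold plwPhi
  rw [Finset.sum_range_sub (fun i => plwS δ i x)]; simp [plwS]

lemma plwPhi_supp {D : ℕ} {δ : ℝ} (hδ : 0 < δ) (i : ℕ) (x : Fin D → ℝ) (h : 0 < plwPhi δ i x) :
    euclNorm (fun j => x j - TopologicalSpace.denseSeq (Fin D → ℝ) i j) < 2 * δ := by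
  by_contra! hc
  have : 2 ≤ euclNorm (fun j => x j - TopologicalSpace.denseSeq (Fin D → ℝ) i j) / δ := by
    rwa [le_div_iff₀ hδ]
  have u0 : plwU δ i x = 0 := by
    unfold plwU
    exact max_eq_left ((min_le_right _ _).trans (by linarith))
  simp only [plwPhi, plwS, u0, max_eq_left (plwS_mem δ i x).1] at h
  linarith

lemma plwPhi_supp2 {D : ℕ} {δ : ℝ} (hδ : 0 < δ) (i : ℕ) (x y : Fin D → ℝ) (h : 0 < plwPhi δ i x)
    (h' : 0 < plwPhi δ i y) : euclNorm (fun j => x j - y j) ≤ 4 * δ := by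
  have h1 := plwPhi_supp hδ i x h
  have h2 := plwPhi_supp hδ i y h'
  have h3 := plw_tri x (TopologicalSpace.denseSeq (Fin D → ℝ) i) y
  rw [plw_comm (TopologicalSpace.denseSeq (Fin D → ℝ) i) y] at h3
  linarith

lemma plwPhi_PLD {D : ℕ} {r δ : ℝ} (hδ : 0 < δ) (i : ℕ) :
    PLD r (2 / δ) (plwPhi δ i : (Fin D → ℝ) → ℝ) := by
  intro x y
  have ht := plw_nonneg (fun i => x i - y i)
  have h1 := plwS_lip hδ i x y
  have h2 := plwS_lip hδ (i + 1) x y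
  have hx : 0 ≤ euclNorm x ^ (r - 1) := Real.rpow_nonneg (plw_nonneg x) _
  have hy : 0 ≤ euclNorm y ^ (r - 1) := Real.rpow_nonneg (plw_nonneg y) _
  have : |plwPhi δ i x - plwPhi δ i y| ≤ 2 / δ * euclNorm (fun i => x i - y i) := by
    rw [div_mul_eq_mul_div, mul_div_assoc]
    unfold plwPhi
    rw [abs_le] at *
    constructor <;> linarith
  refine this.trans (le_mul_of_one_le_right (by positivity) (by linarith))

lemma plwS_eventually {D : ℕ} {δ : ℝ} (hδ : 0 < δ) (x : Fin D → ℝ) :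
    ∃ N, ∀ n ≥ N, plwS δ n x = 1 := by
  have hopen : IsOpen {q : Fin D → ℝ | euclNorm (fun j => x j - q j) < δ} :=
    isOpen_lt (plw_cont.comp (by fun_prop)) continuous_const
  have hne : {q : Fin D → ℝ | euclNorm (fun j => x j - q j) < δ}.Nonempty := ⟨x, by
    have e : (fun i => x i - x i) = (0 : Fin D → ℝ) := by ext; simp
    simp only [Set.mem_ofPred_eq, e, plw_zero]; exact hδ⟩
  obtain ⟨q, hq, i, rfl⟩ := (TopologicalSpace.denseRange_denseSeq (Fin D → ℝ)).exists_mem_open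
    hopen hne |>.elim (fun i hi => (⟨_, hi, i, rfl⟩ :
      ∃ q, q ∈ {q : Fin D → ℝ | euclNorm (fun j => x j - q j) < δ} ∧ ∃ i,
        TopologicalSpace.denseSeq (Fin D → ℝ) i = q))
  refine ⟨i + 1, fun n hn => le_antisymm (plwS_mem δ n x).2 ?_⟩
  refine le_trans ?_ (plwS_mono δ x hn)
  simp only [plwS]
  refine le_max_of_le_right (le_max_of_le_right (le_min le_rfl ?_))
  have : euclNorm (fun j => x j - TopologicalSpace.denseSeq (Fin D → ℝ) i j) / δ ≤ 1 := by
    rw [div_le_one hδ]; exact le_of_lt hq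
  linarith

lemma plwW_fin {D : ℕ} {r : ℝ} (hr : 1 ≤ r) (μ : Measure (Fin D → ℝ)) [IsProbabilityMeasure μ]
    (h : (∫⁻ x, ENNReal.ofReal (euclNorm x ^ r) ∂μ) ≠ ⊤) :
    Integrable (plwW r) μ := by
  have hm : Measurable (fun x : Fin D → ℝ => euclNorm x ^ r) :=
    (plw_cont.rpow_const (fun _ => Or.inr (by linarith))).measurable
  have hi : Integrable (fun x : Fin D → ℝ => euclNorm x ^ r) μ := by
    refine ⟨hm.aestronglyMeasurable, ?_⟩
    rw [hasFiniteIntegral_iff_ofReal (Eventually.of_forall fun x => Real.rpow_nonneg (plw_nonneg x) _)]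
    exact lt_top_iff_ne_top.2 h
  refine Integrable.mono' (((integrable_const (1 : ℝ)).add hi).const_mul (2 ^ r))
    (plwW_cont hr).aestronglyMeasurable (Eventually.of_forall fun x => ?_)
  rw [Real.norm_of_nonneg (by linarith [plwW_one_le hr x])]
  exact plw_pow_add (by linarith) (plw_nonneg x)

lemma plw_PLD_int {D : ℕ} {r L : ℝ} (hr : 1 ≤ r) (hL : 0 < L) {ψ : (Fin D → ℝ) → ℝ}
    (h : PLD r L ψ) (μ : Measure (Fin D → ℝ)) [IsProbabilityMeasure μ]
    (hW : Integrable (plwW r) μ) : Integrable ψ μ := by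
  have hb : ∀ x, ‖ψ x‖ ≤ |ψ 0| + L * (1 * (3 * 2 ^ (r - 1)) * plwW r (0 : Fin D → ℝ) +
      3 * (2 / 1) ^ (r - 1) * plwW r x) := by
    intro x
    have h1 := h x 0
    have h2 := plw_young hr one_pos le_rfl x 0
    have e : (fun i => x i - (0 : Fin D → ℝ) i) = x := by ext; simp
    rw [e] at h1 h2
    have h3 : euclNorm x ^ r ≤ plwW r x :=
      Real.rpow_le_rpow (plw_nonneg x) (by linarith) (by linarith)
    have h4 : |ψ x| ≤ |ψ 0| + |ψ x - ψ 0| := by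
      have := abs_add_le (ψ 0) (ψ x - ψ 0); simpa using this
    rw [Real.norm_eq_abs]
    refine h4.trans ?_
    gcongr
    rw [mul_assoc] at h1
    refine h1.trans ?_
    gcongr
    refine h2.trans ?_
    gcongr
  refine Integrable.mono' ?_ (plw_PLD_cont hr h).aestronglyMeasurable (Eventually.of_forall hb)
  exact (integrable_const _).add (((integrable_const _).add (hW.const_mul _)).const_mul _)

open scoped ENNReal in
lemma plw_stepA {D : ℕ} {r : ℝ} (hr : 1 ≤ r) (P : Measure (Fin D → ℝ)) [IsProbabilityMeasure P]
    (hP : Integrable (plwW r) P) (ε : ℝ) (hε : 0 < ε) :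
    ∃ η : ℝ≥0∞, 0 < η ∧ ∀ Q : Measure (Fin D → ℝ), IsProbabilityMeasure Q →
      Integrable (plwW r) Q → wassR D r Q P < η → ∀ ψ : (Fin D → ℝ) → ℝ, PLD r 1 ψ →
        |∫ x, ψ x ∂Q - ∫ x, ψ x ∂P| ≤ ε := by
  set M := ∫ x, plwW r x ∂P with hM
  have hM0 : 0 ≤ M := integral_nonneg (fun x => by
    have := plwW_one_le hr x
    simp only [Pi.zero_apply]; linarith)
  set K : ℝ := 3 * 2 ^ (r - 1) with hK
  have hK0 : 0 < K := by positivity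
  obtain ⟨θ, hθ, hθ1, hθM⟩ : ∃ θ : ℝ, 0 < θ ∧ θ ≤ 1 ∧ θ * K * M ≤ ε / 2 := by
    refine ⟨min 1 (ε / 2 / (K * (M + 1))), lt_min one_pos (by positivity), min_le_left _ _, ?_⟩
    calc min 1 (ε / 2 / (K * (M + 1))) * K * M ≤ (ε / 2 / (K * (M + 1))) * K * (M + 1) := by
          gcongr
          · exact min_le_right _ _
          · linarith
      _ = ε / 2 := by field_simp
  set Cθ : ℝ := 3 * (2 / θ) ^ (r - 1) with hC
  have hC0 : 0 < Cθ := by positivity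
  refine ⟨(ENNReal.ofReal (ε / 2 / Cθ)) ^ (1 / r), ENNReal.rpow_pos (by simp; positivity) (by simp), ?_⟩
  intro Q _ hQ hlt ψ hψ
  obtain ⟨⟨γ, hγ1, hγ2⟩, hγ⟩ := iInf_lt_iff.1 hlt
  simp only at hγ
  have hcost : ∫⁻ q, ENNReal.ofReal (euclNorm (fun i => q.1 i - q.2 i) ^ r) ∂γ <
      ENNReal.ofReal (ε / 2 / Cθ) := by
    by_contra! hc
    exact absurd (ENNReal.rpow_le_rpow hc (show 0 ≤ 1 / r by positivity)) (not_le.2 hγ)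
  have hγp : IsProbabilityMeasure γ := ⟨by
    have : Q Set.univ = 1 := measure_univ
    rw [← hγ1, Measure.map_apply measurable_fst MeasurableSet.univ] at this
    simpa using this⟩
  have hψc := plw_PLD_cont hr hψ
  have iQ := plw_PLD_int hr one_pos hψ Q hQ
  have iP := plw_PLD_int hr one_pos hψ P hP
  have i1 : Integrable (fun q : (Fin D → ℝ) × (Fin D → ℝ) => ψ q.1) γ := by
    rw [← hγ1] at iQ; exact iQ.comp_measurable measurable_fst
  have i2 : Integrable (fun q : (Fin D → ℝ) × (Fin D → ℝ) => ψ q.2) γ := by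
    rw [← hγ2] at iP; exact iP.comp_measurable measurable_snd
  have i3 : Integrable (fun q : (Fin D → ℝ) × (Fin D → ℝ) => plwW r q.2) γ := by
    rw [← hγ2] at hP; exact hP.comp_measurable measurable_snd
  have e1 : ∫ x, ψ x ∂Q = ∫ q, ψ q.1 ∂γ := by
    rw [← hγ1, integral_map measurable_fst.aemeasurable hψc.aestronglyMeasurable]
  have e2 : ∫ x, ψ x ∂P = ∫ q, ψ q.2 ∂γ := by
    rw [← hγ2, integral_map measurable_snd.aemeasurable hψc.aestronglyMeasurable]
  have e3 : M = ∫ q, plwW r q.2 ∂γ := by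
    rw [hM, ← hγ2, integral_map measurable_snd.aemeasurable (plwW_cont hr).aestronglyMeasurable]
  have ct : Continuous (fun q : (Fin D → ℝ) × (Fin D → ℝ) =>
      euclNorm (fun i => q.1 i - q.2 i) ^ r) :=
    (plw_cont.comp (by fun_prop)).rpow_const (fun _ => Or.inr (by linarith))
  have nn : ∀ q : (Fin D → ℝ) × (Fin D → ℝ), 0 ≤ euclNorm (fun i => q.1 i - q.2 i) ^ r :=
    fun q => Real.rpow_nonneg (plw_nonneg _) _
  have i4 : Integrable (fun q : (Fin D → ℝ) × (Fin D → ℝ) =>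
      euclNorm (fun i => q.1 i - q.2 i) ^ r) γ := by
    refine ⟨ct.measurable.aestronglyMeasurable, ?_⟩
    rw [hasFiniteIntegral_iff_ofReal (Eventually.of_forall nn)]
    exact hcost.trans ENNReal.ofReal_lt_top
  have e4 : ∫ q, euclNorm (fun i => q.1 i - q.2 i) ^ r ∂γ ≤ ε / 2 / Cθ := by
    rw [← ofReal_integral_eq_lintegral_ofReal i4 (Eventually.of_forall nn)] at hcost
    exact ((ENNReal.ofReal_lt_ofReal_iff (by positivity)).1 hcost).le
  rw [e1, e2, ← integral_sub i1 i2]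
  calc |∫ q, (ψ q.1 - ψ q.2) ∂γ| ≤ ∫ q, |ψ q.1 - ψ q.2| ∂γ := abs_integral_le_integral_abs
    _ ≤ ∫ q, (θ * K * plwW r q.2 + Cθ * euclNorm (fun i => q.1 i - q.2 i) ^ r) ∂γ := by
      refine integral_mono (i1.sub i2).abs ((i3.const_mul _).add (i4.const_mul _)) (fun q => ?_)
      have h1 := hψ q.1 q.2
      rw [one_mul] at h1
      exact h1.trans (plw_young hr hθ hθ1 q.1 q.2)
    _ = θ * K * M + Cθ * ∫ q, euclNorm (fun i => q.1 i - q.2 i) ^ r ∂γ := by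
      rw [integral_add (i3.const_mul _) (i4.const_mul _), integral_const_mul, integral_const_mul, e3]
    _ ≤ ε / 2 + Cθ * (ε / 2 / Cθ) := by gcongr
    _ = ε := by field_simp; ring

open scoped ENNReal in
lemma plw_stepC {D : ℕ} {r : ℝ} (hr : 1 ≤ r) (P : Measure (Fin D → ℝ)) [IsProbabilityMeasure P]
    (Pn : ℕ → Measure (Fin D → ℝ)) (hPn : ∀ n, IsProbabilityMeasure (Pn n))
    (iP : Integrable (plwW r) P) (iPn : ∀ n, Integrable (plwW r) (Pn n))
    (hW : Tendsto (fun n => ∫ x, plwW r x ∂(Pn n)) atTop (nhds (∫ x, plwW r x ∂P)))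
    (hphi : ∀ k i : ℕ, Tendsto (fun n => ∫ x, plwPhi (1 / ((k : ℝ) + 1)) i x ∂(Pn n)) atTop
      (nhds (∫ x, plwPhi (1 / ((k : ℝ) + 1)) i x ∂P))) (κ : ℝ) (hκ : 0 < κ) :
    ∀ᶠ n in atTop, ∃ γ : Measure ((Fin D → ℝ) × (Fin D → ℝ)),
      γ.map Prod.fst = Pn n ∧ γ.map Prod.snd = P ∧
      ∫⁻ q, ENNReal.ofReal (euclNorm (fun i => q.1 i - q.2 i) ^ r) ∂γ ≤ ENNReal.ofReal κ := by
  set M := ∫ x, plwW r x ∂P with hM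
  have wpos : ∀ x : Fin D → ℝ, 0 ≤ plwW r x := fun x => by linarith [plwW_one_le hr x]
  have hM0 : 0 ≤ M := integral_nonneg wpos
  set C : ℝ := 2 ^ r with hC
  have hC0 : 0 < C := by positivity
  set s : ℝ := κ / (8 * C) with hs
  have hs0 : 0 < s := by positivity
  have hk0 : Tendsto (fun k : ℕ => 4 * (1 / ((k : ℝ) + 1))) atTop (nhds 0) := by
    simpa using (tendsto_one_div_add_atTop_nhds_zero_nat (𝕜 := ℝ)).const_mul 4
  have hk1 : Tendsto (fun k : ℕ => (4 * (1 / ((k : ℝ) + 1))) ^ r) atTop (nhds 0) := by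
    have := hk0.rpow_const (p := r) (Or.inr (by linarith))
    rwa [Real.zero_rpow (by linarith)] at this
  have hk2 : Tendsto (fun k : ℕ => (1 + 4 * (1 / ((k : ℝ) + 1))) ^ r * M) atTop (nhds M) := by
    have := ((hk0.const_add 1).rpow_const (p := r) (Or.inr (by linarith))).mul_const M
    simpa using this
  obtain ⟨k, hkd, hkl⟩ := ((hk1.eventually (gt_mem_nhds (show 0 < κ / 2 by positivity))).and
    (hk2.eventually (gt_mem_nhds (show M < M + s by linarith)))).exists
  set δ : ℝ := 1 / ((k : ℝ) + 1) with hδ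
  have hδ0 : 0 < δ := by positivity
  set lam : ℝ := (1 + 4 * δ) ^ r with hlam
  have hlam1 : 1 ≤ lam := Real.one_le_rpow (by linarith) (by linarith)
  set f : ℕ → (Fin D → ℝ) → ℝ≥0∞ := fun i x => ENNReal.ofReal (plwPhi δ i x) with hf
  set w : (Fin D → ℝ) → ℝ≥0∞ := fun x => ENNReal.ofReal (plwW r x) with hw
  have phic : ∀ i, Continuous (plwPhi δ i : (Fin D → ℝ) → ℝ) := fun i =>
    plw_PLD_cont hr (plwPhi_PLD hδ0 i)
  have fm : ∀ i, Measurable (f i) := fun i => (phic i).measurable.ennreal_ofReal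
  have wm : Measurable w := (plwW_cont hr).measurable.ennreal_ofReal
  have fsum : ∀ N x, ∑ i ∈ Finset.range N, f i x = ENNReal.ofReal (plwS δ N x) := by
    intro N x
    rw [← plwPhi_sum, ENNReal.ofReal_sum_of_nonneg (fun i _ => plwPhi_nonneg δ i x)]
  have iphi : ∀ (μ : Measure (Fin D → ℝ)) [IsProbabilityMeasure μ], Integrable (plwW r) μ → ∀ i,
      ∫⁻ x, f i x ∂μ = ENNReal.ofReal (∫ x, plwPhi δ i x ∂μ) := fun μ _ hμ i =>
    (ofReal_integral_eq_lintegral_ofReal (plw_PLD_int hr (by positivity) (plwPhi_PLD hδ0 i) μ hμ)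
      (Eventually.of_forall (plwPhi_nonneg δ i))).symm
  have iw : ∀ (μ : Measure (Fin D → ℝ)) [IsProbabilityMeasure μ], Integrable (plwW r) μ →
      ∫⁻ x, w x ∂μ = ENNReal.ofReal (∫ x, plwW r x ∂μ) := fun μ _ hμ =>
    (ofReal_integral_eq_lintegral_ofReal hμ (Eventually.of_forall wpos)).symm
  have fwm : ∀ i, Measurable (fun x => f i x * w x) := fun i => (fm i).mul wm
  -- choice of N
  have hF : Tendsto (fun N => ∫⁻ x, (∑ i ∈ Finset.range N, f i x) * w x ∂P) atTop
      (nhds (∫⁻ x, w x ∂P)) := by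
    refine lintegral_tendsto_of_tendsto_of_monotone
      (fun N => ((Finset.measurable_sum _ (fun i _ => fm i)).mul wm).aemeasurable)
      (Eventually.of_forall fun x => ?_) (Eventually.of_forall fun x => ?_)
    · intro a b hab
      simp only [fsum]
      gcongr
      exact plwS_mono δ x hab
    · obtain ⟨N, hN⟩ := plwS_eventually hδ0 x
      refine tendsto_const_nhds.congr' ?_
      filter_upwards [eventually_ge_atTop N] with n hn
      rw [fsum, hN n hn]; simp
  have hsE : (0 : ℝ≥0∞) < ENNReal.ofReal s := by simpa using hs0
  have wfin : ∫⁻ x, w x ∂P ≠ ⊤ := by rw [iw P iP]; exact ENNReal.ofReal_ne_top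
  obtain ⟨N, hN⟩ := ((hF.add_const (ENNReal.ofReal s)).eventually
    (lt_mem_nhds (ENNReal.lt_add_right wfin hsE.ne'))).exists
  have hFN : ∫⁻ x, (∑ i ∈ Finset.range N, f i x) * w x ∂P =
      ∑ i ∈ Finset.range N, ∫⁻ x, f i x * w x ∂P := by
    rw [← lintegral_finsetSum _ (fun i _ => fwm i)]
    simp only [Finset.sum_mul]
  rw [hFN] at hN
  have hβ : Tendsto (fun n => ∑ i ∈ Finset.range N, (min (∫⁻ x, f i x ∂(Pn n)) (∫⁻ x, f i x ∂P) *
      (∫⁻ x, f i x ∂P)⁻¹) * ∫⁻ x, f i x * w x ∂P) atTop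
      (nhds (∑ i ∈ Finset.range N, ∫⁻ x, f i x * w x ∂P)) := by
    refine tendsto_finsetSum _ (fun i _ => ?_)
    rcases eq_or_ne (∫⁻ x, f i x ∂P) 0 with h0 | h0
    · have : ∫⁻ x, f i x * w x ∂P = 0 := by
        rw [lintegral_eq_zero_iff (fm i)] at h0
        rw [lintegral_eq_zero_iff (fwm i)]
        filter_upwards [h0] with x hx
        simp only [Pi.zero_apply] at hx ⊢
        rw [hx, zero_mul]
      simp [this]
    · have hfin : ∫⁻ x, f i x ∂P ≠ ⊤ := by rw [iphi P iP]; exact ENNReal.ofReal_ne_top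
      have ha : Tendsto (fun n => ∫⁻ x, f i x ∂(Pn n)) atTop (nhds (∫⁻ x, f i x ∂P)) := by
        rw [iphi P iP i]
        simp_rw [fun n => iphi (Pn n) (iPn n) i]
        exact ENNReal.tendsto_ofReal (hphi k i)
      have h1 := ENNReal.Tendsto.mul_const (b := (∫⁻ x, f i x ∂P)⁻¹)
        (ha.min (tendsto_const_nhds (x := ∫⁻ x, f i x ∂P)))
        (Or.inr (ENNReal.inv_ne_top.2 h0))
      rw [min_self, ENNReal.mul_inv_cancel h0 hfin] at h1
      have h2 := ENNReal.Tendsto.mul_const (b := ∫⁻ x, f i x * w x ∂P) h1 (Or.inl one_ne_zero)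
      rwa [one_mul] at h2
  have ev1 := (hβ.add_const (ENNReal.ofReal s)).eventually (lt_mem_nhds hN)
  have ev2 : ∀ᶠ n in atTop, lam * ∫ x, plwW r x ∂(Pn n) < M + s :=
    (hW.const_mul lam).eventually (gt_mem_nhds hkl)
  filter_upwards [ev1, ev2] with n h1 h2
  have fpos : ∀ i x, f i x ≠ 0 → 0 < plwPhi δ i x := fun i x h => by
    simpa [hf] using h
  obtain ⟨γ, g1, g2, R, S, c1, c2, c3⟩ := plw_coupling (Pn n) P f fm N
    (fun x => by rw [fsum]; simpa using (plwS_mem δ N x).2) w wm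
    (fun q => ENNReal.ofReal (euclNorm (fun i => q.1 i - q.2 i) ^ r))
    (ENNReal.ofReal (κ / 2)) (ENNReal.ofReal C) (ENNReal.ofReal lam) (by simpa using hlam1)
    (fun i x y hx hy => by
      refine ENNReal.ofReal_le_ofReal (le_trans ?_ hkd.le)
      exact Real.rpow_le_rpow (plw_nonneg _) (plwPhi_supp2 hδ0 i x y (fpos i x hx) (fpos i y hy))
        (by linarith))
    (fun x y => by
      rw [hw, ← ENNReal.ofReal_add (wpos x) (wpos y), ← ENNReal.ofReal_mul hC0.le]
      exact ENNReal.ofReal_le_ofReal (plw_cost_le x y hr))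
    (fun i x y hx hy => by
      rw [hw, ← ENNReal.ofReal_mul (by linarith)]
      refine ENNReal.ofReal_le_ofReal ((plwW_le x y hr).trans ?_)
      have := plwPhi_supp2 hδ0 i x y (fpos i x hx) (fpos i y hy)
      have h0 := plw_nonneg (fun j => x j - y j)
      refine mul_le_mul_of_nonneg_right ?_ (wpos x)
      exact Real.rpow_le_rpow (by linarith) (by linarith) (by linarith))
  refine ⟨γ, g1, g2, c1.trans ?_⟩
  have hS : S ≤ ENNReal.ofReal s := by
    by_contra! hc
    rw [← c3, add_comm S] at h1
    exact absurd h1 (not_lt.2 (by gcongr))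
  have hR : R ≤ ENNReal.ofReal (2 * s) := by
    rw [iw P iP, iw (Pn n) (iPn n), ← ENNReal.ofReal_mul (by linarith)] at c2
    have : ENNReal.ofReal M + R ≤ ENNReal.ofReal M + ENNReal.ofReal (2 * s) := by
      refine c2.trans ?_
      calc _ ≤ ENNReal.ofReal (M + s) + ENNReal.ofReal s := by gcongr
        _ = _ := by
          rw [← ENNReal.ofReal_add (by positivity) hs0.le, ← ENNReal.ofReal_add hM0 (by positivity)]
          congr 1; ring
    exact (ENNReal.add_le_add_iff_left ENNReal.ofReal_ne_top).1 this
  calc ENNReal.ofReal (κ / 2) + ENNReal.ofReal C * (R + S)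
      ≤ ENNReal.ofReal (κ / 2) + ENNReal.ofReal C * (ENNReal.ofReal (2 * s) + ENNReal.ofReal s) := by
        gcongr
    _ = ENNReal.ofReal (κ / 2 + C * (2 * s + s)) := by
        rw [← ENNReal.ofReal_add (by positivity) hs0.le, ← ENNReal.ofReal_mul hC0.le,
          ← ENNReal.ofReal_add (by positivity) (by positivity)]
    _ ≤ ENNReal.ofReal κ := by
        refine ENNReal.ofReal_le_ofReal ?_
        have : C * (2 * s + s) = 3 * κ / 8 := by rw [hs]; field_simp; ring
        rw [this]; linarith

/-- **Equivalent characterisations of Wasserstein convergence via pseudo-Lipschitz test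
functions** (Theorem 9.1 of the paper).  There is a countable set `T ⊆ PL_D(r)` such that
for probability measures `P, (Pₙ)` with finite `r`-th moments, convergence of `∫ψ dPₙ`
for all `ψ ∈ T` is equivalent to `d̃ᵣ(Pₙ, P) → 0` (stated uniformly over `PL_D(r,1)`)
and to `d_r(Pₙ, P) → 0`; moreover each implies `∫ψ dPₙ → ∫ψ dP` for every
`ψ ∈ PL_D(r)`. -/
theorem wasserstein_pseudoLipschitz_equiv (D : ℕ) (r : ℝ) (hr : 1 ≤ r) :
    ∃ T : Set ((Fin D → ℝ) → ℝ), T.Countable ∧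
      (∀ ψ ∈ T, ∃ L : ℝ, 0 < L ∧ PLD r L ψ) ∧
      ∀ (P : Measure (Fin D → ℝ)) (Pn : ℕ → Measure (Fin D → ℝ)),
        IsProbabilityMeasure P → (∀ n, IsProbabilityMeasure (Pn n)) →
        (∫⁻ x, ENNReal.ofReal (euclNorm x ^ r) ∂P) ≠ ⊤ →
        (∀ n, (∫⁻ x, ENNReal.ofReal (euclNorm x ^ r) ∂(Pn n)) ≠ ⊤) →
        (((∀ ψ ∈ T, Tendsto (fun n => ∫ x, ψ x ∂(Pn n)) atTop (nhds (∫ x, ψ x ∂P))) ↔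
          (∀ ε : ℝ, 0 < ε → ∀ᶠ n in atTop, ∀ ψ : (Fin D → ℝ) → ℝ, PLD r 1 ψ →
            |∫ x, ψ x ∂(Pn n) - ∫ x, ψ x ∂P| ≤ ε)) ∧
        ((∀ ε : ℝ, 0 < ε → ∀ᶠ n in atTop, ∀ ψ : (Fin D → ℝ) → ℝ, PLD r 1 ψ →
            |∫ x, ψ x ∂(Pn n) - ∫ x, ψ x ∂P| ≤ ε) ↔
          Tendsto (fun n => wassR D r (Pn n) P) atTop (nhds 0)) ∧
        ((∀ ψ ∈ T, Tendsto (fun n => ∫ x, ψ x ∂(Pn n)) atTop (nhds (∫ x, ψ x ∂P))) →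
          ∀ ψ : (Fin D → ℝ) → ℝ, (∃ L : ℝ, 0 < L ∧ PLD r L ψ) →
            Tendsto (fun n => ∫ x, ψ x ∂(Pn n)) atTop (nhds (∫ x, ψ x ∂P)))) := by
  refine ⟨Set.range (fun p : ℕ × ℕ => plwPhi (1 / ((p.1 : ℝ) + 1)) p.2) ∪ {plwW r},
    (Set.countable_range _).union (Set.countable_singleton _), ?_, ?_⟩
  · rintro ψ (⟨p, rfl⟩ | rfl)
    · exact ⟨_, by positivity, plwPhi_PLD (by positivity) p.2⟩
    · exact ⟨_, by positivity, plwW_PLD hr⟩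
  intro P Pn hP hPn mP mPn
  have iP := plwW_fin hr P mP
  have iPn := fun n => plwW_fin hr (Pn n) (mPn n)
  have h12 : (∀ ψ ∈ Set.range (fun p : ℕ × ℕ => (plwPhi (1 / ((p.1 : ℝ) + 1)) p.2 :
      (Fin D → ℝ) → ℝ)) ∪ {plwW r},
      Tendsto (fun n => ∫ x, ψ x ∂(Pn n)) atTop (nhds (∫ x, ψ x ∂P))) →
      Tendsto (fun n => wassR D r (Pn n) P) atTop (nhds 0) := by
    intro h
    rw [ENNReal.tendsto_nhds_zero]
    intro ε hε
    have he0 : min ε 1 ≠ 0 := by simpa using hε.ne'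
    have het : min ε 1 ≠ ⊤ := by simp
    have hpt : (min ε 1) ^ r ≠ ⊤ := ENNReal.rpow_ne_top_of_nonneg (by linarith) het
    have hp0 : (min ε 1) ^ r ≠ 0 := (ENNReal.rpow_pos (pos_iff_ne_zero.2 he0) het).ne'
    filter_upwards [plw_stepC hr P Pn hPn iP iPn (h _ (Or.inr rfl))
      (fun k i => h _ (Or.inl ⟨(k, i), rfl⟩)) ((min ε 1) ^ r).toReal
      (ENNReal.toReal_pos hp0 hpt)] with n hn
    obtain ⟨γ, g1, g2, hc⟩ := hn
    rw [ENNReal.ofReal_toReal hpt] at hc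
    refine (iInf_le _ ⟨γ, g1, g2⟩).trans ?_
    refine (ENNReal.rpow_le_rpow hc (show 0 ≤ 1 / r by positivity)).trans ?_
    rw [← ENNReal.rpow_mul, mul_one_div_cancel (by linarith), ENNReal.rpow_one]
    exact min_le_left _ _
  have h23 : Tendsto (fun n => wassR D r (Pn n) P) atTop (nhds 0) →
      (∀ ε : ℝ, 0 < ε → ∀ᶠ n in atTop, ∀ ψ : (Fin D → ℝ) → ℝ, PLD r 1 ψ →
            |∫ x, ψ x ∂(Pn n) - ∫ x, ψ x ∂P| ≤ ε) := by
    intro h ε hε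
    obtain ⟨η, hη, hA⟩ := plw_stepA hr P iP ε hε
    filter_upwards [h.eventually (gt_mem_nhds hη)] with n hn
    exact hA (Pn n) (hPn n) (iPn n) hn
  have h31 : (∀ ε : ℝ, 0 < ε → ∀ᶠ n in atTop, ∀ ψ : (Fin D → ℝ) → ℝ, PLD r 1 ψ →
            |∫ x, ψ x ∂(Pn n) - ∫ x, ψ x ∂P| ≤ ε) →
      ∀ ψ : (Fin D → ℝ) → ℝ, (∃ L : ℝ, 0 < L ∧ PLD r L ψ) →
            Tendsto (fun n => ∫ x, ψ x ∂(Pn n)) atTop (nhds (∫ x, ψ x ∂P)) := by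
    rintro h ψ ⟨L, hL, hψ⟩
    rw [Metric.tendsto_nhds]
    intro ε hε
    have hsc : PLD r 1 (fun x => L⁻¹ * ψ x) := by
      intro x y
      rw [← mul_sub, abs_mul, abs_of_pos (inv_pos.2 hL), inv_mul_le_iff₀ hL]
      refine (hψ x y).trans (le_of_eq ?_)
      ring
    filter_upwards [h (ε / (2 * L)) (by positivity)] with n hn
    have := hn _ hsc
    rw [integral_const_mul, integral_const_mul, ← mul_sub, abs_mul, abs_of_pos (inv_pos.2 hL),
      inv_mul_le_iff₀ hL] at this
    rw [Real.dist_eq]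
    have e : L * (ε / (2 * L)) = ε / 2 := by field_simp
    linarith
  have hT : ∀ ψ ∈ Set.range (fun p : ℕ × ℕ => (plwPhi (1 / ((p.1 : ℝ) + 1)) p.2 :
      (Fin D → ℝ) → ℝ)) ∪ {plwW r}, ∃ L : ℝ, 0 < L ∧ PLD r L ψ := by
    rintro ψ (⟨p, rfl⟩ | rfl)
    · exact ⟨_, by positivity, plwPhi_PLD (by positivity) p.2⟩
    · exact ⟨_, by positivity, plwW_PLD hr⟩
  exact ⟨⟨fun h => h23 (h12 h), fun h ψ hψ => h31 h ψ (hT ψ hψ)⟩,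
    ⟨fun h => h12 (fun ψ hψ => h31 h ψ (hT ψ hψ)), h23⟩, fun h => h31 (h23 (h12 h))⟩
end

section
/- Let Σ ∈ ℝ^{2×2} be symmetric positive definite and (Z, Z′) ∼ N₂(0, Σ). Let ε̄ be a random variable with E[ε̄²] < ∞, independent of (Z, Z′), let h : ℝ² → ℝ be Borel measurable, and set Y := h(Z, ε̄). Let g : ℝ² → ℝ be such that g̃(z, u, v) := g(u, h(z, v)) is Lipschitz on ℝ³, and let ∂_z g̃ be a bounded Borel function agreeing with the partial derivative of g̃ in its first argument wherever the latter exists. Then E[∂_z g̃(Z, Z′, ε̄)] = E[ ( E[Z | σ(Z′, Y)] − (Σ₁₂/Σ₂₂) Z′ ) · g(Z′, Y) ] / ( Σ₁₁ − Σ₁₂²/Σ₂₂ ), where E[Z | σ(Z′, Y)] is the conditional expectation of Z given the σ-algebra generated by (Z′, Y), (Σ₁₂/Σ₂₂) Z′ = E[Z | Z′] and Σ₁₁ − Σ₁₂²/Σ₂₂ = Var(Z | Z′). -/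
open MeasureTheory ProbabilityTheory
open Filter Topology

lemma stein_gauss_integrable_iff (v : NNReal) (hv : v ≠ 0) (f : ℝ → ℝ) :
    Integrable f (gaussianReal 0 v) ↔ Integrable (fun x => gaussianPDFReal 0 v x * f x) := by
  rw [gaussianReal_of_var_ne_zero _ hv, integrable_withDensity_iff_integrable_smul']
  · simp [gaussianPDF, ENNReal.toReal_ofReal (gaussianPDFReal_nonneg _ _ _)]
  · exact measurable_gaussianPDF _ _
  · simp [gaussianPDF]

lemma stein_pdf_deriv (v : NNReal) (hv : v ≠ 0) (x : ℝ) :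
    HasDerivAt (gaussianPDFReal 0 v) (-(x / v) * gaussianPDFReal 0 v x) x := by
  have hv' : (v : ℝ) ≠ 0 := by exact_mod_cast hv
  rw [gaussianPDFReal_def]
  have h1 : HasDerivAt (fun x : ℝ => -(x - 0) ^ 2 / (2 * (v : ℝ))) (-(x / v)) x := by
    have := (((hasDerivAt_id x).sub_const 0).pow 2).neg.div_const (2 * (v : ℝ))
    convert! this using 1
    simp
    field_simp
  have := h1.exp.const_mul ((√(2 * Real.pi * v))⁻¹)
  convert! this using 1
  ring

lemma stein_lip_bound {K : NNReal} {f : ℝ → ℝ} (hf : LipschitzWith K f) (x : ℝ) :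
    |f x| ≤ |f 0| + K * |x| := by
  have h1 := hf.dist_le_mul x 0
  rw [Real.dist_eq, Real.dist_eq, sub_zero] at h1
  have := abs_sub_abs_le_abs_sub (f x) (f 0)
  linarith

lemma stein_lip (v : NNReal) (hv : v ≠ 0) {K : NNReal} {f : ℝ → ℝ} (hf : LipschitzWith K f) :
    ∫ x, x * f x ∂(gaussianReal 0 v) = v * ∫ x, deriv f x ∂(gaussianReal 0 v) := by
  have hv' : (v : ℝ) ≠ 0 := by exact_mod_cast hv
  have hvpos : (0 : ℝ) < v := lt_of_le_of_ne v.2 (Ne.symm hv')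
  set φ := gaussianPDFReal 0 v with hφ
  have hid2 : MemLp (fun x : ℝ => x) 2 (gaussianReal 0 v) :=
    memLp_id_gaussianReal' 2 (by norm_num)
  have hf2 : MemLp f 2 (gaussianReal 0 v) := by
    have hc : MemLp (fun _ : ℝ => |f 0|) 2 (gaussianReal 0 v) := memLp_const _
    have hk : MemLp (fun x : ℝ => (K : ℝ) * |x|) 2 (gaussianReal 0 v) := by
      have := hid2.norm
      exact this.const_mul _
    refine (hc.add hk).mono hf.continuous.aestronglyMeasurable (ae_of_all _ fun x => ?_)
    have := stein_lip_bound hf x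
    rw [Real.norm_eq_abs, Real.norm_eq_abs]
    exact this.trans (le_abs_self (|f 0| + (K : ℝ) * |x|))
  have hI1 : Integrable (fun x => x * f x) (gaussianReal 0 v) := hid2.integrable_mul hf2
  have hI2 : Integrable (fun x => deriv f x) (gaussianReal 0 v) := by
    refine Integrable.of_bound (measurable_deriv f).aestronglyMeasurable K (ae_of_all _ fun x => ?_)
    exact norm_deriv_le_of_lipschitz hf
  have hJ1 := (stein_gauss_integrable_iff v hv _).1 hI1
  have hJ2 := (stein_gauss_integrable_iff v hv _).1 hI2
  rw [integral_gaussianReal_eq_integral_smul hv, integral_gaussianReal_eq_integral_smul hv]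
  simp only [smul_eq_mul]
  have hd : deriv φ = fun x => -(x / v) * φ x := by
    ext x; exact (stein_pdf_deriv v hv x).deriv
  have hφc : ContDiff ℝ 1 φ := by
    rw [hφ, gaussianPDFReal_def]; fun_prop
  have hibp : ∀ n : ℝ, ∫ x in (-n)..n, φ x * (x * f x) =
      v * (∫ x in (-n)..n, φ x * deriv f x) - v * (f n * φ n - f (-n) * φ (-n)) := by
    intro n
    have h1 := (hf.lipschitzOnWith (s := Set.uIcc (-n) n)).absolutelyContinuousOnInterval
    have h2 := (hφc.contDiffOn (s := Set.uIcc (-n) n)).absolutelyContinuousOnInterval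
    have := h1.integral_mul_deriv_eq_deriv_mul h2
    have e1 : ∀ x, f x * deriv φ x = (-(v : ℝ)⁻¹) * (φ x * (x * f x)) := by
      intro x; rw [hd]; field_simp
    have e2 : ∀ x, deriv f x * φ x = φ x * deriv f x := fun x => mul_comm _ _
    simp only [e1, e2, intervalIntegral.integral_const_mul] at this
    generalize (∫ x in (-n)..n, φ x * (x * f x)) = I at this ⊢
    have e3 : I = -(v : ℝ) * (-(v : ℝ)⁻¹ * I) := by field_simp
    rw [e3, this]
    ring
  have hlim : Tendsto (fun x => f x * φ x) (cocompact ℝ) (𝓝 0) := by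
    have a1 := tendsto_rpow_abs_mul_exp_neg_mul_sq_cocompact (a := 1 / (2 * v)) (by positivity) 0
    have a2 := tendsto_rpow_abs_mul_exp_neg_mul_sq_cocompact (a := 1 / (2 * v)) (by positivity) 1
    have a3 := ((a1.const_mul |f 0|).add (a2.const_mul (K : ℝ))).const_mul ((√(2 * Real.pi * v))⁻¹)
    simp only [mul_zero, add_zero] at a3
    refine squeeze_zero_norm (fun x => ?_) a3
    rw [norm_mul, Real.norm_eq_abs, Real.norm_eq_abs, abs_of_nonneg (gaussianPDFReal_nonneg 0 v x),
      gaussianPDFReal_def]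
    have hb := stein_lip_bound hf x
    simp only [Real.rpow_zero, Real.rpow_one, sub_zero]
    have e : -x ^ 2 / (2 * (v : ℝ)) = -(1 / (2 * (v : ℝ))) * x ^ 2 := by ring
    rw [e]
    calc _ ≤ (|f 0| + K * |x|) * ((√(2 * Real.pi * v))⁻¹ * Real.exp (-(1 / (2 * (v : ℝ))) * x ^ 2)) := by
          gcongr
      _ = _ := by ring
  have hT : Tendsto (fun n : ℝ => n) atTop atTop := tendsto_id
  have t1 := intervalIntegral_tendsto_integral hJ1 tendsto_neg_atTop_atBot hT
  have t2 := intervalIntegral_tendsto_integral hJ2 tendsto_neg_atTop_atBot hT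
  have l1 : Tendsto (fun n : ℝ => f n * φ n) atTop (𝓝 0) := hlim.mono_left atTop_le_cocompact
  have l2 : Tendsto (fun n : ℝ => f (-n) * φ (-n)) atTop (𝓝 0) :=
    (hlim.mono_left atBot_le_cocompact).comp tendsto_neg_atTop_atBot
  have t3 := (t2.const_mul (v : ℝ)).sub ((l1.sub l2).const_mul (v : ℝ))
  simp only [sub_zero, mul_zero] at t3
  refine tendsto_nhds_unique t1 (t3.congr fun n => ?_)
  rw [hibp n]

lemma stein_indep {Ω : Type*} [m0 : MeasurableSpace Ω] (μ : Measure Ω) [IsProbabilityMeasure μ]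
    (S : Matrix (Fin 2) (Fin 2) ℝ) (hS : S.PosDef)
    (Z Z' : Ω → ℝ) (hZmeas : Measurable Z) (hZ'meas : Measurable Z')
    (hgauss : ∀ a b : ℝ,
      μ.map (fun ω => a * Z ω + b * Z' ω) =
        gaussianReal 0 (Real.toNNReal
          (a ^ 2 * S 0 0 + 2 * a * b * S 0 1 + b ^ 2 * S 1 1))) :
    MemLp Z 2 μ ∧ MemLp Z' 2 μ ∧
    IndepFun (fun ω => Z ω - (S 0 1 / S 1 1) * Z' ω) Z' μ := by
  have h00 : 0 < S 0 0 := hS.diag_pos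
  have h11 : 0 < S 1 1 := hS.diag_pos
  have hdet := hS.det_pos
  have hsym : S 1 0 = S 0 1 := by
    have := hS.isHermitian.apply 0 1
    simpa using this
  rw [Matrix.det_fin_two, hsym] at hdet
  have hG : HasGaussianLaw (fun ω => (Z ω, Z' ω)) μ := by
    refine ⟨isGaussian_of_map_eq_gaussianReal fun L => ?_⟩
    have := hgauss (L (1, 0)) (L (0, 1))
    refine ⟨0, _, Eq.trans ?_ this⟩
    · rw [Measure.map_map (by fun_prop) (by fun_prop)]
      congr 1
      ext ω
      have : (Z ω, Z' ω) = Z ω • ((1 : ℝ), (0 : ℝ)) + Z' ω • ((0 : ℝ), (1 : ℝ)) := by simp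
      simp only [Function.comp_apply]
      rw [this, map_add, map_smul, map_smul]
      simp [mul_comm]
  have hL2 := hG.memLp_two
  have hZ2 : MemLp Z 2 μ := (hG.map (ContinuousLinearMap.fst ℝ ℝ ℝ)).memLp_two
  have hZ'2 : MemLp Z' 2 μ := (hG.map (ContinuousLinearMap.snd ℝ ℝ ℝ)).memLp_two
  refine ⟨hZ2, hZ'2, ?_⟩
  have hvar : ∀ a b : ℝ, 0 ≤ a ^ 2 * S 0 0 + 2 * a * b * S 0 1 + b ^ 2 * S 1 1 →
      Var[fun ω => a * Z ω + b * Z' ω; μ] = a ^ 2 * S 0 0 + 2 * a * b * S 0 1 + b ^ 2 * S 1 1 := by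
    intro a b hab
    have h1 : Var[id; μ.map (fun ω => a * Z ω + b * Z' ω)] =
        (Real.toNNReal (a ^ 2 * S 0 0 + 2 * a * b * S 0 1 + b ^ 2 * S 1 1) : ℝ) := by
      rw [hgauss a b]; exact variance_id_gaussianReal
    rw [variance_map aemeasurable_id (by fun_prop)] at h1
    rw [Real.coe_toNNReal _ hab] at h1
    exact h1
  have v1 := hvar 1 0 (by nlinarith)
  have v2 := hvar 0 1 (by nlinarith)
  have v3 := hvar 1 1 (by
    have : 0 ≤ S 1 1 * (S 0 0 + 2 * S 0 1 + S 1 1) := by nlinarith [sq_nonneg (S 0 1 + S 1 1)]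
    have := nonneg_of_mul_nonneg_right this h11
    linarith)
  simp only [one_mul, zero_mul, add_zero, zero_add] at v1 v2 v3
  rw [variance_fun_add hZ2 hZ'2, v1, v2] at v3
  have hcov : cov[Z, Z'; μ] = S 0 1 := by linarith
  have hRG : HasGaussianLaw (fun ω => (Z ω - (S 0 1 / S 1 1) * Z' ω, Z' ω)) μ := by
    have := hG.map (((ContinuousLinearMap.fst ℝ ℝ ℝ) -
      (S 0 1 / S 1 1) • (ContinuousLinearMap.snd ℝ ℝ ℝ)).prod (ContinuousLinearMap.snd ℝ ℝ ℝ))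
    exact this
  refine hRG.indepFun_of_covariance_eq_zero ?_
  rw [covariance_fun_sub_left hZ2 (hZ'2.const_mul _) hZ'2, covariance_const_mul_left,
    covariance_self hZ'meas.aemeasurable, v2, hcov]
  field_simp
  ring

lemma stein_meas {Ω : Type*}
    (Z Z' εb : Ω → ℝ)
    (h : ℝ → ℝ → ℝ) (hhmeas : Measurable (fun q : ℝ × ℝ => h q.1 q.2))
    (g : ℝ → ℝ → ℝ)
    (hg : Measurable (fun q : ℝ × ℝ × ℝ => g q.2.1 (h q.1 q.2.2))) :
    Measurable[MeasurableSpace.comap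
            (fun ω' => (Z' ω', h (Z ω') (εb ω'))) inferInstance]
      (fun ω => g (Z' ω) (h (Z ω) (εb ω))) := by
  let F : ℝ × ℝ × ℝ → ℝ × ℝ := fun q => (q.2.1, h q.1 q.2.2)
  have hF : Measurable F := by
    refine Measurable.prodMk (by fun_prop) ?_
    exact hhmeas.comp (measurable_fst.prodMk (by fun_prop))
  let g2 : ℝ × ℝ → ℝ := fun p => g p.1 p.2
  have h1 : Measurable ((Set.range F).domRestrict g2) :=
    (hF.measurable_comp_iff_restrict (g := g2)).1 hg
  intro B hB
  obtain ⟨C, hC, hCe⟩ := h1 hB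
  refine ⟨C, hC, ?_⟩
  ext ω
  have hr : (Z' ω, h (Z ω) (εb ω)) ∈ Set.range F := ⟨(Z ω, Z' ω, εb ω), rfl⟩
  have := Set.ext_iff.1 hCe ⟨_, hr⟩
  exact this

lemma stein_main
    {Ω : Type*} [m0 : MeasurableSpace Ω] (μ : Measure Ω) [IsProbabilityMeasure μ]
    (R Z' εb : Ω → ℝ) (hR : Measurable R) (hZ' : Measurable Z') (hε : Measurable εb)
    (v : NNReal) (hv : v ≠ 0) (hlaw : μ.map R = gaussianReal 0 v)
    (hind : IndepFun R (fun ω => (Z' ω, εb ω)) μ) (ρ : ℝ)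
    (G : ℝ × ℝ × ℝ → ℝ) (K : NNReal) (hG : LipschitzWith K G)
    (D : ℝ × ℝ × ℝ → ℝ) (hDm : Measurable D) (C : ℝ) (hDb : ∀ q, |D q| ≤ C)
    (hD : ∀ u w z d : ℝ, HasDerivAt (fun t => G (t, u, w)) d z → D (z, u, w) = d)
    (hint : Integrable (fun ω => R ω * G (R ω + ρ * Z' ω, Z' ω, εb ω)) μ) :
    ∫ ω, R ω * G (R ω + ρ * Z' ω, Z' ω, εb ω) ∂μ =
      v * ∫ ω, D (R ω + ρ * Z' ω, Z' ω, εb ω) ∂μ := by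
  have hGm : Measurable G := hG.continuous.measurable
  have hp : Measurable (fun ω => (Z' ω, εb ω)) := hZ'.prodMk hε
  have hmap := (indepFun_iff_map_prod_eq_prod_map_map hR.aemeasurable hp.aemeasurable).1 hind
  rw [hlaw] at hmap
  have hpm : Measurable (fun ω => (R ω, (Z' ω, εb ω))) := hR.prodMk hp
  haveI : IsProbabilityMeasure (μ.map (fun ω => (Z' ω, εb ω))) :=
    Measure.isProbabilityMeasure_map hp.aemeasurable
  set ν := μ.map (fun ω => (Z' ω, εb ω))
  let A : ℝ × ℝ × ℝ → ℝ := fun p => p.1 * G (p.1 + ρ * p.2.1, p.2.1, p.2.2)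
  let B : ℝ × ℝ × ℝ → ℝ := fun p => D (p.1 + ρ * p.2.1, p.2.1, p.2.2)
  have hT : Measurable (fun p : ℝ × ℝ × ℝ => (p.1 + ρ * p.2.1, p.2.1, p.2.2)) := by fun_prop
  have hAm : Measurable A := measurable_fst.mul (hGm.comp hT)
  have hBm : Measurable B := hDm.comp hT
  have hAint : Integrable A ((gaussianReal 0 v).prod ν) := by
    rw [← hmap, integrable_map_measure hAm.aestronglyMeasurable hpm.aemeasurable]
    exact hint
  have hBint : Integrable B ((gaussianReal 0 v).prod ν) :=
    Integrable.of_bound hBm.aestronglyMeasurable C (ae_of_all _ fun p => hDb _)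
  have e1 : ∫ ω, R ω * G (R ω + ρ * Z' ω, Z' ω, εb ω) ∂μ = ∫ p, A p ∂((gaussianReal 0 v).prod ν) := by
    rw [← hmap, integral_map hpm.aemeasurable hAm.aestronglyMeasurable]
  have e2 : ∫ ω, D (R ω + ρ * Z' ω, Z' ω, εb ω) ∂μ = ∫ p, B p ∂((gaussianReal 0 v).prod ν) := by
    rw [← hmap, integral_map hpm.aemeasurable hBm.aestronglyMeasurable]
  rw [e1, e2, integral_prod_symm _ hAint, integral_prod_symm _ hBint, ← integral_const_mul]
  refine integral_congr_ae (ae_of_all _ fun q => ?_)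
  obtain ⟨u, w⟩ := q
  have hlip : LipschitzWith K (fun r : ℝ => G (r + ρ * u, u, w)) := by
    refine LipschitzWith.of_dist_le_mul fun a b => ?_
    refine (hG.dist_le_mul _ _).trans ?_
    simp [Prod.dist_eq]
  have hs := stein_lip v hv hlip
  simp only [A, B]
  rw [hs]
  congr 1
  refine integral_congr_ae ?_
  have hac : gaussianReal 0 v ≪ volume := gaussianReal_absolutelyContinuous 0 hv
  filter_upwards [hac.ae_le hlip.ae_differentiableAt_real] with r hr
  symm
  apply hD
  have h1 : HasDerivAt (fun r : ℝ => G (r + ρ * u, u, w))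
      (deriv (fun r : ℝ => G (r + ρ * u, u, w)) r) (r + ρ * u - ρ * u) := by
    rw [add_sub_cancel_right]; exact hr.hasDerivAt
  have h2 := h1.comp_sub_const
  simpa using h2

/-- **Stein's identity for the GAMP state evolution** (Lemma 10 of the paper).
Let `(Z, Z')` be a centred bivariate Gaussian with positive definite covariance `Σ`,
let `ε̄` be square-integrable and independent of `(Z, Z')`, let `Y = h(Z, ε̄)` and let
`g̃(z, u, v) = g(u, h(z, v))` be Lipschitz with bounded Borel partial derivative
`∂_z g̃`.  Then
`E[∂_z g̃(Z, Z', ε̄)] = E[(E[Z | σ(Z',Y)] − (Σ₁₂/Σ₂₂) Z') g(Z', Y)] / (Σ₁₁ − Σ₁₂²/Σ₂₂)`. -/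
theorem gamp_stein_identity
    {Ω : Type*} [m0 : MeasurableSpace Ω] (μ : Measure Ω) [IsProbabilityMeasure μ]
    (S : Matrix (Fin 2) (Fin 2) ℝ) (hS : S.PosDef)
    (Z Z' : Ω → ℝ) (hZmeas : Measurable Z) (hZ'meas : Measurable Z')
    -- (Z, Z') ∼ N₂(0, Σ): every linear functional is centred Gaussian with the right variance
    (hgauss : ∀ a b : ℝ,
      μ.map (fun ω => a * Z ω + b * Z' ω) =
        gaussianReal 0 (Real.toNNReal
          (a ^ 2 * S 0 0 + 2 * a * b * S 0 1 + b ^ 2 * S 1 1)))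
    (εb : Ω → ℝ) (hεmeas : Measurable εb) (hεsq : Integrable (fun ω => (εb ω) ^ 2) μ)
    (hindep : IndepFun (fun ω => (Z ω, Z' ω)) εb μ)
    (h : ℝ → ℝ → ℝ) (hhmeas : Measurable (fun q : ℝ × ℝ => h q.1 q.2))
    (g : ℝ → ℝ → ℝ)
    (hglip : ∃ K : NNReal,
      LipschitzWith K (fun q : ℝ × ℝ × ℝ => g q.2.1 (h q.1 q.2.2)))
    (Dg : ℝ → ℝ → ℝ → ℝ)
    (hDgbdd : ∃ C : ℝ, ∀ z u v : ℝ, |Dg z u v| ≤ C)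
    (hDgmeas : Measurable (fun q : ℝ × ℝ × ℝ => Dg q.1 q.2.1 q.2.2))
    (hDgderiv : ∀ u v z d : ℝ, HasDerivAt (fun t => g u (h t v)) d z → Dg z u v = d) :
    ∫ ω, Dg (Z ω) (Z' ω) (εb ω) ∂μ =
      (∫ ω, ((μ[Z | MeasurableSpace.comap
            (fun ω' => (Z' ω', h (Z ω') (εb ω'))) inferInstance]) ω -
          (S 0 1 / S 1 1) * Z' ω) * g (Z' ω) (h (Z ω) (εb ω)) ∂μ) /
        (S 0 0 - (S 0 1) ^ 2 / S 1 1) := by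
  obtain ⟨K, hK⟩ := hglip
  obtain ⟨C, hC⟩ := hDgbdd
  obtain ⟨hZ2, hZ'2, hRZ'⟩ := stein_indep μ S hS Z Z' hZmeas hZ'meas hgauss
  have h11 : 0 < S 1 1 := hS.diag_pos
  have hdet := hS.det_pos
  have hsym : S 1 0 = S 0 1 := by
    have := hS.isHermitian.apply 0 1
    simpa using this
  rw [Matrix.det_fin_two, hsym] at hdet
  have hspos : 0 < S 0 0 - (S 0 1) ^ 2 / S 1 1 := by
    rw [sub_pos, div_lt_iff₀ h11]
    nlinarith
  set ρ := S 0 1 / S 1 1 with hρ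
  set s := S 0 0 - (S 0 1) ^ 2 / S 1 1 with hs
  let R : Ω → ℝ := fun ω => Z ω - ρ * Z' ω
  have hR : Measurable R := by fun_prop
  let G : ℝ × ℝ × ℝ → ℝ := fun q => g q.2.1 (h q.1 q.2.2)
  have hK' : LipschitzWith K G := hK
  have hGm : Measurable G := hK'.continuous.measurable
  have hε2 : MemLp εb 2 μ := (memLp_two_iff_integrable_sq hεmeas.aestronglyMeasurable).2 hεsq
  have hXm : Measurable (fun ω => (Z ω, Z' ω, εb ω)) := hZmeas.prodMk (hZ'meas.prodMk hεmeas)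
  set W : Ω → ℝ := fun ω => g (Z' ω) (h (Z ω) (εb ω)) with hW
  have hWm : Measurable W := hGm.comp hXm
  have hW2 : MemLp W 2 μ := by
    have hc : MemLp (fun _ : Ω => |G 0|) 2 μ := memLp_const _
    have hb : MemLp (fun ω => (K : ℝ) * (|Z ω| + (|Z' ω| + |εb ω|))) 2 μ :=
      (hZ2.norm.add (hZ'2.norm.add hε2.norm)).const_mul _
    refine (hc.add hb).mono hWm.aestronglyMeasurable (ae_of_all _ fun ω => ?_)
    have h1 := hK'.dist_le_mul (Z ω, Z' ω, εb ω) 0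
    have h2 : dist (Z ω, Z' ω, εb ω) 0 ≤ |Z ω| + (|Z' ω| + |εb ω|) := by
      rw [dist_zero_right, Prod.norm_def, Prod.norm_def]
      simp only [Real.norm_eq_abs]
      have a1 := abs_nonneg (Z ω)
      have a2 := abs_nonneg (Z' ω)
      have a3 := abs_nonneg (εb ω)
      refine max_le (by linarith) (max_le (by linarith) (by linarith))
    rw [Real.dist_eq] at h1
    have h3 := abs_sub_abs_le_abs_sub (G (Z ω, Z' ω, εb ω)) (G 0)
    have h4 := mul_le_mul_of_nonneg_left h2 K.2
    have h5 : |W ω| ≤ |G 0| + (K : ℝ) * (|Z ω| + (|Z' ω| + |εb ω|)) := by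
      change |G (Z ω, Z' ω, εb ω)| ≤ _
      change (K : ℝ) * _ ≤ (K : ℝ) * _ at h4
      linarith
    rw [Real.norm_eq_abs, Real.norm_eq_abs]
    exact h5.trans (le_abs_self _)
  have hZW : Integrable (Z * W) μ := hZ2.integrable_mul hW2
  have hZ'W : Integrable (fun ω => ρ * Z' ω * W ω) μ := (hZ'2.const_mul ρ).integrable_mul hW2
  have hlaw : μ.map R = gaussianReal 0 (Real.toNNReal s) := by
    have := hgauss 1 (-ρ)
    convert this using 2
    · ext ω; simp only [R]; ring
    · congr 1
      rw [hs, hρ]; field_simp; ring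
  have hv : Real.toNNReal s ≠ 0 := by
    rw [Ne, Real.toNNReal_eq_zero, not_le]; exact hspos
  have hRε : IndepFun (fun ω => (R ω, Z' ω)) εb μ :=
    hindep.comp (φ := fun p : ℝ × ℝ => (p.1 - ρ * p.2, p.2)) (ψ := id) (by fun_prop) measurable_id
  have hZ'ε : IndepFun Z' εb μ :=
    hindep.comp (φ := fun p : ℝ × ℝ => p.2) (ψ := id) (by fun_prop) measurable_id
  have hind : IndepFun R (fun ω => (Z' ω, εb ω)) μ := by
    rw [indepFun_iff_map_prod_eq_prod_map_map hR.aemeasurable (by fun_prop)]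
    rw [(indepFun_iff_map_prod_eq_prod_map_map hZ'meas.aemeasurable hεmeas.aemeasurable).1 hZ'ε]
    have := Measure.isProbabilityMeasure_map (μ := μ) hR.aemeasurable
    have := Measure.isProbabilityMeasure_map (μ := μ) hZ'meas.aemeasurable
    have := Measure.isProbabilityMeasure_map (μ := μ) hεmeas.aemeasurable
    rw [← Measure.prodAssoc_prod,
      ← (indepFun_iff_map_prod_eq_prod_map_map hR.aemeasurable hZ'meas.aemeasurable).1 hRZ',
      ← (indepFun_iff_map_prod_eq_prod_map_map (by fun_prop) hεmeas.aemeasurable).1 hRε,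
      Measure.map_map (by fun_prop) (by fun_prop)]
    rfl
  have hRZ : ∀ ω, R ω + ρ * Z' ω = Z ω := fun ω => by simp [R]
  have hmain := stein_main μ R Z' εb hR hZ'meas hεmeas _ hv hlaw hind ρ G K hK'
    (fun q => Dg q.1 q.2.1 q.2.2) hDgmeas C (fun q => hC _ _ _)
    (fun u w z d hd => hDgderiv u w z d hd) (by
      simp only [hRZ]
      exact (hZ2.sub (hZ'2.const_mul ρ)).integrable_mul hW2)
  simp only [hRZ, Real.coe_toNNReal s hspos.le] at hmain
  set m : MeasurableSpace Ω := MeasurableSpace.comap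
            (fun ω' => (Z' ω', h (Z ω') (εb ω'))) inferInstance with hm
  have hmle : m ≤ m0 := by
    refine Measurable.comap_le (hZ'meas.prodMk ?_)
    exact hhmeas.comp (hZmeas.prodMk hεmeas)
  have hWsm : StronglyMeasurable[m] W :=
    (stein_meas Z Z' εb h hhmeas g hGm).stronglyMeasurable
  have hpull := condExp_mul_of_stronglyMeasurable_right hWsm hZW (hZ2.integrable one_le_two)
  have hCW : Integrable (μ[Z | m] * W) μ := integrable_condExp.congr hpull
  have hCWe : ∫ ω, (μ[Z | m] * W) ω ∂μ = ∫ ω, (Z * W) ω ∂μ := by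
    rw [← integral_congr_ae hpull, integral_condExp hmle]
  have hnum : ∫ ω, ((μ[Z | m]) ω - ρ * Z' ω) * W ω ∂μ = ∫ ω, R ω * W ω ∂μ := by
    have e1 : ∫ ω, ((μ[Z | m]) ω - ρ * Z' ω) * W ω ∂μ
        = ∫ ω, (μ[Z | m] * W) ω ∂μ - ∫ ω, ρ * Z' ω * W ω ∂μ := by
      rw [← integral_sub hCW hZ'W]
      congr 1; ext ω; simp only [Pi.mul_apply]; ring
    have e2 : ∫ ω, R ω * W ω ∂μ
        = ∫ ω, (Z * W) ω ∂μ - ∫ ω, ρ * Z' ω * W ω ∂μ := by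
      rw [← integral_sub hZW hZ'W]
      congr 1; ext ω; simp only [Pi.mul_apply, R]; ring
    rw [e1, e2, hCWe]
  rw [hnum, eq_div_iff hspos.ne']
  refine Eq.trans ?_ hmain.symm
  ring
end

section
/- Let π be a Borel probability measure on ℝ with finite second moment, and let V ∼ π and G ∼ N(0,1) be independent. Define mmse(ρ) := E[(V − E[V | √ρ V + G])²] for ρ ∈ [0,∞), where E[V | √ρ V + G] denotes conditional expectation. Then ρ ↦ mmse(ρ) is non-increasing on [0,∞). If, in addition, either V has a log-concave Lebesgue density, or V is equal in distribution to U₀ + V₀ where U₀ is Gaussian, V₀ is compactly supported and U₀, V₀ are independent, then ρ ↦ mmse(ρ) is continuous on (0,∞), and indeed Lipschitz on (ρ′, ∞) for every ρ′ > 0. -/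
open MeasureTheory ProbabilityTheory

abbrev sigY (s : ℝ) : MeasurableSpace (ℝ × ℝ) :=
  MeasurableSpace.comap (fun q' : ℝ × ℝ => s * q'.1 + q'.2) inferInstance

theorem aux_estimator (π : Measure ℝ) [IsProbabilityMeasure π]
    (hπ2 : Integrable (fun x => x ^ 2) π) (s : ℝ) (hs : 0 ≤ s) :
    ∃ g : ℝ → ℝ, Measurable g ∧
      (∀ q, ((π.prod (gaussianReal 0 1))[(fun q' : ℝ × ℝ => q'.1) |
          MeasurableSpace.comap (fun q' : ℝ × ℝ => s * q'.1 + q'.2)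
            inferInstance]) q = g (s * q.1 + q.2)) ∧
      MemLp (fun q : ℝ × ℝ => q.1) 2 (π.prod (gaussianReal 0 1)) ∧
      MemLp (fun q : ℝ × ℝ => g (s * q.1 + q.2)) 2 (π.prod (gaussianReal 0 1)) ∧
      (∀ h : ℝ → ℝ, Measurable h →
        Integrable (fun q : ℝ × ℝ => h (s * q.1 + q.2) * (q.1 - g (s * q.1 + q.2)))
          (π.prod (gaussianReal 0 1)) →
        ∫ q, h (s * q.1 + q.2) * (q.1 - g (s * q.1 + q.2)) ∂(π.prod (gaussianReal 0 1)) = 0) ∧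
      (0 < s → Integrable (fun q : ℝ × ℝ => (q.1 - g (s * q.1 + q.2)) ^ 4)
          (π.prod (gaussianReal 0 1)) ∧
        s ^ 4 * ∫ q, (q.1 - g (s * q.1 + q.2)) ^ 4 ∂(π.prod (gaussianReal 0 1)) ≤
          16 * ∫ x, x ^ 4 ∂(gaussianReal 0 1)) := by
  set μ := π.prod (gaussianReal 0 1) with hμ
  set Y : ℝ × ℝ → ℝ := fun q' : ℝ × ℝ => s * q'.1 + q'.2 with hY
  have hYm : Measurable Y := by fun_prop
  have hle : sigY s ≤ Prod.instMeasurableSpace := hYm.comap_le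
  have hV : MemLp (fun q : ℝ × ℝ => q.1) 2 μ := by
    rw [memLp_two_iff_integrable_sq (by fun_prop)]
    exact hπ2.comp_fst (gaussianReal 0 1)
  have hVi : Integrable (fun q : ℝ × ℝ => q.1) μ := hV.integrable (by norm_num)
  have hG4 : Integrable (fun x : ℝ => x ^ 4) (gaussianReal 0 1) := by
    have := (memLp_id_gaussianReal (μ := 0) (v := 1) 4).integrable_norm_pow (by norm_num)
    simpa [(show Even 4 by decide).pow_abs] using this
  have hGi : Integrable (fun q : ℝ × ℝ => q.2) μ := by
    have := (memLp_id_gaussianReal (μ := 0) (v := 1) 1).integrable (by norm_num)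
    exact this.comp_snd π
  have hG4' : Integrable (fun q : ℝ × ℝ => q.2 ^ 4) μ := hG4.comp_snd π
  obtain ⟨g, hg, hgeq⟩ := (stronglyMeasurable_condExp
    (f := (fun q' : ℝ × ℝ => q'.1)) (μ := μ) (m := sigY s)).measurable.exists_eq_measurable_comp
  have hgeq' : ∀ q, (μ[(fun q' : ℝ × ℝ => q'.1) | sigY s]) q = g (Y q) := fun q => by rw [hgeq]; rfl
  have hgL : MemLp (fun q : ℝ × ℝ => g (Y q)) 2 μ := by
    have := hV.condExp (m := sigY s) (by norm_num)
    rw [hgeq] at this; exact this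
  refine ⟨g, hg, hgeq', hV, hgL, ?_, ?_⟩
  · intro h hh hint
    have hYm' : Measurable[sigY s] Y := comap_measurable Y
    have hhY : StronglyMeasurable[sigY s] (fun q => h (Y q)) := (hh.comp hYm').stronglyMeasurable
    have hgY : StronglyMeasurable[sigY s] (fun q => g (Y q)) := (hg.comp hYm').stronglyMeasurable
    have hgi : Integrable (fun q => g (Y q)) μ := hgL.integrable (by norm_num)
    have h1 := condExp_mul_of_stronglyMeasurable_left (μ := μ) hhY
      (g := fun q => q.1 - g (Y q)) hint (hVi.sub hgi)
    have h2 : μ[(fun q : ℝ × ℝ => q.1 - g (Y q)) | sigY s] =ᵐ[μ] 0 := by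
      have h3 := condExp_sub hVi hgi (sigY s)
      have h4 := condExp_of_stronglyMeasurable hle hgY hgi
      filter_upwards [h3] with q hq
      rw [show (fun q : ℝ × ℝ => q.1 - g (Y q)) = (fun q : ℝ × ℝ => q.1) - (fun q => g (Y q)) from rfl, hq, h4]
      simp [hgeq']
    change ∫ q, ((fun q => h (Y q)) * (fun q : ℝ × ℝ => q.1 - g (Y q))) q ∂μ = 0
    rw [← integral_condExp hle]
    rw [integral_eq_zero_of_ae]
    filter_upwards [h1, h2] with q h1 h2
    rw [h1, Pi.mul_apply, h2]; simp
  · intro hs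
    have hYm' : Measurable[sigY s] Y := comap_measurable Y
    have hYi : Integrable Y μ := (hVi.const_mul s).add hGi
    have hY1 := condExp_of_stronglyMeasurable hle hYm'.stronglyMeasurable hYi
    have hY2 : μ[Y | sigY s] =ᵐ[μ] s • μ[(fun q' : ℝ × ℝ => q'.1) | sigY s] + μ[(fun q' : ℝ × ℝ => q'.2) | sigY s] :=
      (condExp_add (hVi.const_mul s) hGi (sigY s)).trans
        ((condExp_smul s (fun q' : ℝ × ℝ => q'.1) (sigY s)).add (ae_eq_refl _))
    set W := μ[(fun q' : ℝ × ℝ => q'.2) | sigY s] with hW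
    have hG4'' : Integrable (fun q : ℝ × ℝ => ‖q.2‖ ^ (4:ℝ)) μ := by
      convert hG4' using 2 with q
      norm_cast
      simp [(show Even 4 by decide).pow_abs]
    have hWle := integral_norm_condExp_rpow_le (m := sigY s) (by norm_num : (1:ℝ) ≤ 4) hG4''
    have e1 : ∫ q, W q ^ 4 ∂μ ≤ ∫ q : ℝ × ℝ, q.2 ^ 4 ∂μ := by
      convert hWle using 3 with q q
      · norm_cast
        simp [(show Even 4 by decide).pow_abs, hW]
      · norm_cast
        simp [(show Even 4 by decide).pow_abs]
    have hW4 : Integrable (fun q => W q ^ 4) μ := by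
      have h4 : MemLp (fun q : ℝ × ℝ => q.2) 4 μ :=
        (memLp_id_gaussianReal' (μ := 0) (v := 1) 4 (by norm_num)).comp_snd π
      have := (h4.condExp (m := sigY s) (by norm_num)).integrable_norm_pow (p := 4) (by norm_num)
      simpa [(show Even 4 by decide).pow_abs] using this
    have hD : ∀ᵐ q ∂μ, s * (q.1 - g (Y q)) = W q - q.2 := by
      filter_upwards [hY2] with q hq
      rw [hY1] at hq
      simp only [Pi.add_apply, Pi.smul_apply, smul_eq_mul, hgeq'] at hq
      have : Y q = s * q.1 + q.2 := rfl
      linarith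
    have hb : ∀ᵐ q ∂μ, s ^ 4 * (q.1 - g (Y q)) ^ 4 ≤ 8 * W q ^ 4 + 8 * q.2 ^ 4 := by
      filter_upwards [hD] with q hq
      rw [← mul_pow, hq]
      nlinarith [sq_nonneg (W q + q.2), sq_nonneg (W q - q.2), sq_nonneg (W q ^2 - q.2^2), mul_nonneg (sq_nonneg (W q + q.2)) (sq_nonneg (W q - q.2)), mul_nonneg (sq_nonneg (W q + q.2)) (sq_nonneg (W q + q.2))]
    have hbi : Integrable (fun q : ℝ × ℝ => 8 * W q ^ 4 + 8 * q.2 ^ 4) μ :=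
      (hW4.const_mul 8).add (hG4'.const_mul 8)
    have hi : Integrable (fun q : ℝ × ℝ => s ^ 4 * (q.1 - g (Y q)) ^ 4) μ := by
      refine hbi.mono' (by fun_prop) ?_
      filter_upwards [hb] with q hq
      rw [Real.norm_of_nonneg (by positivity)]; exact hq
    refine ⟨?_, ?_⟩
    · have := hi.const_mul ((s ^ 4)⁻¹)
      refine this.congr (ae_of_all _ fun q => ?_)
      simp only
      field_simp; rfl
    · rw [← integral_const_mul]
      refine (integral_mono_ae hi hbi hb).trans ?_
      rw [integral_add (hW4.const_mul 8) (hG4'.const_mul 8), integral_const_mul, integral_const_mul]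
      have : ∫ q : ℝ × ℝ, q.2 ^ 4 ∂μ = ∫ x, x ^ 4 ∂(gaussianReal 0 1) := by
        rw [hμ]
        have := integral_fun_snd (μ := π) (ν := gaussianReal 0 1) (fun x : ℝ => x ^ 4)
        simpa using this
      rw [← this]; linarith

theorem aux_opt (π : Measure ℝ) [IsProbabilityMeasure π]
    (hπ2 : Integrable (fun x => x ^ 2) π) (s : ℝ) (hs : 0 ≤ s) (h : ℝ → ℝ) (hh : Measurable h) :
    ENNReal.ofReal (∫ q, (q.1 - ((π.prod (gaussianReal 0 1))[(fun q' : ℝ × ℝ => q'.1) |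
          MeasurableSpace.comap (fun q' : ℝ × ℝ => s * q'.1 + q'.2)
            inferInstance]) q) ^ 2 ∂(π.prod (gaussianReal 0 1))) ≤
    ∫⁻ q, ENNReal.ofReal ((q.1 - h (s * q.1 + q.2)) ^ 2) ∂(π.prod (gaussianReal 0 1)) := by
  obtain ⟨g, hg, hgeq, hV, hgL, horth, -⟩ := aux_estimator π hπ2 s hs
  simp_rw [hgeq]
  set μ := π.prod (gaussianReal 0 1) with hμ
  by_cases hfin : ∫⁻ q, ENNReal.ofReal ((q.1 - h (s * q.1 + q.2)) ^ 2) ∂μ = ⊤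
  · rw [hfin]; exact le_top
  have hi : Integrable (fun q : ℝ × ℝ => (q.1 - h (s * q.1 + q.2)) ^ 2) μ := by
    refine ⟨by fun_prop, ?_⟩
    rw [hasFiniteIntegral_iff_ofReal (ae_of_all _ fun q => sq_nonneg _)]
    exact lt_top_iff_ne_top.2 hfin
  rw [← ofReal_integral_eq_lintegral_ofReal hi (ae_of_all _ fun q => sq_nonneg _)]
  apply ENNReal.ofReal_le_ofReal
  have hVh : MemLp (fun q : ℝ × ℝ => q.1 - h (s * q.1 + q.2)) 2 μ := by
    rw [memLp_two_iff_integrable_sq (by fun_prop)]; exact hi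
  have hD : MemLp (fun q : ℝ × ℝ => q.1 - g (s * q.1 + q.2)) 2 μ := hV.sub hgL
  have hgh : MemLp (fun q : ℝ × ℝ => g (s * q.1 + q.2) - h (s * q.1 + q.2)) 2 μ := by
    have := hVh.sub hD
    refine this.ae_eq (ae_of_all _ fun q => ?_)
    simp
  have hc : Integrable (fun q : ℝ × ℝ => (g (s * q.1 + q.2) - h (s * q.1 + q.2)) *
      (q.1 - g (s * q.1 + q.2))) μ := hgh.integrable_mul hD
  have h0 := horth (fun y => g y - h y) (hg.sub hh) hc
  have hle : ∫ q, (q.1 - g (s * q.1 + q.2)) ^ 2 +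
      2 * ((g (s * q.1 + q.2) - h (s * q.1 + q.2)) * (q.1 - g (s * q.1 + q.2))) ∂μ ≤
      ∫ q, (q.1 - h (s * q.1 + q.2)) ^ 2 ∂μ := by
    refine integral_mono (hD.integrable_sq.add (hc.const_mul 2)) hi fun q => ?_
    simp only
    nlinarith [sq_nonneg (g (s * q.1 + q.2) - h (s * q.1 + q.2))]
  rw [integral_add hD.integrable_sq (hc.const_mul 2), integral_const_mul, h0] at hle
  linarith

theorem aux_gauss_split (a b : ℝ) (hab : a ^ 2 + b ^ 2 = 1) (φ : ℝ → ENNReal) (hφ : Measurable φ) :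
    ∫⁻ x, φ x ∂(gaussianReal 0 1) =
      ∫⁻ x', ∫⁻ x, φ (a * x + b * x') ∂(gaussianReal 0 1) ∂(gaussianReal 0 1) := by
  have h1 : (gaussianReal 0 1) = ((gaussianReal 0 1).map (b * ·)).conv
      ((gaussianReal 0 1).map (a * ·)) := by
    rw [gaussianReal_map_const_mul, gaussianReal_map_const_mul, gaussianReal_conv_gaussianReal]
    congr 1
    · simp
    · ext; push_cast; simp; linarith
  conv_lhs => rw [h1]
  rw [Measure.lintegral_conv hφ, lintegral_map (by fun_prop) (by fun_prop)]
  refine lintegral_congr fun x' => ?_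
  rw [lintegral_map (by fun_prop) (by fun_prop)]
  refine lintegral_congr fun x => ?_
  rw [add_comm]

theorem aux_mono (π : Measure ℝ) [IsProbabilityMeasure π]
    (hπ2 : Integrable (fun x => x ^ 2) π) (s₁ s₂ : ℝ) (h1 : 0 ≤ s₁) (h12 : s₁ ≤ s₂) :
    ∫ q, (q.1 - ((π.prod (gaussianReal 0 1))[(fun q' : ℝ × ℝ => q'.1) |
          MeasurableSpace.comap (fun q' : ℝ × ℝ => s₂ * q'.1 + q'.2)
            inferInstance]) q) ^ 2 ∂(π.prod (gaussianReal 0 1)) ≤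
    ∫ q, (q.1 - ((π.prod (gaussianReal 0 1))[(fun q' : ℝ × ℝ => q'.1) |
          MeasurableSpace.comap (fun q' : ℝ × ℝ => s₁ * q'.1 + q'.2)
            inferInstance]) q) ^ 2 ∂(π.prod (gaussianReal 0 1)) := by
  rcases eq_or_lt_of_le (h1.trans h12) with h0 | h0
  · have : s₁ = s₂ := by linarith
    rw [this]
  obtain ⟨g, hg, hgeq, hV, hgL, -, -⟩ := aux_estimator π hπ2 s₁ h1
  have hopt := aux_opt π hπ2 s₂ h0.le
  generalize (∫ q, (q.1 - ((π.prod (gaussianReal 0 1))[(fun q' : ℝ × ℝ => q'.1) |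
          MeasurableSpace.comap (fun q' : ℝ × ℝ => s₂ * q'.1 + q'.2)
            inferInstance]) q) ^ 2 ∂(π.prod (gaussianReal 0 1))) = A at hopt ⊢
  simp_rw [hgeq]
  have hD : Integrable (fun q : ℝ × ℝ => (q.1 - g (s₁ * q.1 + q.2)) ^ 2)
    (π.prod (gaussianReal 0 1)) := (hV.sub hgL).integrable_sq
  rw [← ENNReal.ofReal_le_ofReal_iff (integral_nonneg fun q => sq_nonneg _),
    ofReal_integral_eq_lintegral_ofReal hD (ae_of_all _ fun q => sq_nonneg _)]
  set a := s₁ / s₂ with ha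
  have ha0 : 0 ≤ a := by positivity
  have ha1 : a ≤ 1 := by rw [ha, div_le_one h0]; exact h12
  set b := Real.sqrt (1 - a ^ 2) with hb
  have hab : a ^ 2 + b ^ 2 = 1 := by
    rw [hb, Real.sq_sqrt (by nlinarith)]; ring
  have has : a * s₂ = s₁ := by rw [ha]; field_simp
  rw [lintegral_prod _ (by fun_prop)]
  have e1 : ∀ v : ℝ, ∫⁻ x, ENNReal.ofReal ((v - g (s₁ * v + x)) ^ 2) ∂(gaussianReal 0 1) =
      ∫⁻ x', ∫⁻ x, ENNReal.ofReal ((v - g (a * (s₂ * v + x) + b * x')) ^ 2)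
        ∂(gaussianReal 0 1) ∂(gaussianReal 0 1) := by
    intro v
    rw [aux_gauss_split a b hab (fun x => ENNReal.ofReal ((v - g (s₁ * v + x)) ^ 2)) (by fun_prop)]
    refine lintegral_congr fun x' => lintegral_congr fun x => ?_
    rw [← has]; ring_nf
  simp_rw [e1]
  rw [lintegral_lintegral_swap]
  · have e2 : ∀ x' : ℝ, ENNReal.ofReal A ≤
        ∫⁻ v, ∫⁻ x, ENNReal.ofReal ((v - g (a * (s₂ * v + x) + b * x')) ^ 2)
        ∂(gaussianReal 0 1) ∂π := by
      intro x'
      refine (hopt (fun y => g (a * y + b * x')) (by fun_prop)).trans ?_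
      rw [lintegral_prod _ (by fun_prop)]
    calc ENNReal.ofReal A = ∫⁻ x' : ℝ, ENNReal.ofReal A ∂(gaussianReal 0 1) := by simp
      _ ≤ _ := lintegral_mono e2
  · apply Measurable.aemeasurable
    have : Measurable (fun p : (ℝ × ℝ) × ℝ =>
      ENNReal.ofReal ((p.1.1 - g (a * (s₂ * p.1.1 + p.2) + b * p.1.2)) ^ 2)) := by fun_prop
    exact this.lintegral_prod_right'

noncomputable def lik (c x : ℝ) : ℝ := c⁻¹ * Real.exp (x ^ 2 / 2 - x ^ 2 / (2 * c ^ 2))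

theorem lik_meas (c : ℝ) : Measurable (lik c) := by unfold lik; fun_prop

theorem aux_cov (π : Measure ℝ) [IsProbabilityMeasure π] (c : ℝ) (hc : 0 < c) :
    (π.prod (gaussianReal 0 1)).map (fun q => (q.1, c * q.2)) =
      (π.prod (gaussianReal 0 1)).withDensity (fun q => ENNReal.ofReal (lik c q.2)) := by
  have h1 : (gaussianReal 0 1).map (c * ·) =
      (gaussianReal 0 1).withDensity (fun x => ENNReal.ofReal (lik c x)) := by
    have hv : (NNReal.mk (c ^ 2) (sq_nonneg _) * 1 : NNReal) ≠ 0 := by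
      intro h
      have := congrArg NNReal.toReal h
      simp at this
      exact hc.ne' this
    rw [gaussianReal_map_const_mul, gaussianReal_of_var_ne_zero _ hv,
      gaussianReal_of_var_ne_zero _ one_ne_zero,
      ← withDensity_mul _ (by fun_prop) ((lik_meas c).ennreal_ofReal)]
    congr 1
    ext x
    simp only [gaussianPDF, Pi.mul_apply]
    rw [← ENNReal.ofReal_mul (gaussianPDFReal_nonneg _ _ _)]
    congr 1
    simp only [gaussianPDFReal, lik]
    have : Real.sqrt (2 * Real.pi * c ^ 2) = Real.sqrt (2 * Real.pi) * c := by
      rw [Real.sqrt_mul (by positivity), Real.sqrt_sq hc.le]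
    simp only [mul_zero, sub_zero, NNReal.coe_mul, NNReal.coe_one, mul_one, NNReal.coe_mk, this]
    rw [mul_mul_mul_comm, ← Real.exp_add, mul_inv]
    congr 2
    ring
  have h2 := Measure.map_prod_map π (gaussianReal 0 1) measurable_id (measurable_const_mul c)
  rw [Measure.map_id, h1, prod_withDensity_right ((lik_meas c).ennreal_ofReal)] at h2
  rw [h2]; rfl

theorem lik_nonneg (c : ℝ) (hc : 0 < c) (x : ℝ) : 0 ≤ lik c x := by unfold lik; positivity

theorem aux_cov_int (π : Measure ℝ) [IsProbabilityMeasure π] (c : ℝ) (hc : 0 < c)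
    (F : ℝ × ℝ → ℝ) (hF : Measurable F) :
    (Integrable (fun q => lik c q.2 * F q) (π.prod (gaussianReal 0 1)) ↔
      Integrable (fun q => F (q.1, c * q.2)) (π.prod (gaussianReal 0 1))) ∧
    ∫ q, lik c q.2 * F q ∂(π.prod (gaussianReal 0 1)) =
      ∫ q, F (q.1, c * q.2) ∂(π.prod (gaussianReal 0 1)) := by
  have hm : Measurable (fun q : ℝ × ℝ => ENNReal.ofReal (lik c q.2)) :=
    ((lik_meas c).comp measurable_snd).ennreal_ofReal
  have hT : Measurable (fun q : ℝ × ℝ => (q.1, c * q.2)) := by fun_prop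
  constructor
  · have h1 := integrable_withDensity_iff_integrable_smul' (μ := π.prod (gaussianReal 0 1)) hm
      (ae_of_all _ fun q => ENNReal.ofReal_lt_top) (g := F)
    rw [← aux_cov π c hc, integrable_map_measure hF.aestronglyMeasurable hT.aemeasurable] at h1
    simp only [smul_eq_mul, ENNReal.toReal_ofReal (lik_nonneg c hc _)] at h1
    exact h1.symm
  · have h1 := integral_withDensity_eq_integral_toReal_smul (μ := π.prod (gaussianReal 0 1)) hm
      (ae_of_all _ fun q => ENNReal.ofReal_lt_top) F
    rw [← aux_cov π c hc, integral_map hT.aemeasurable hF.aestronglyMeasurable] at h1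
    simp only [smul_eq_mul, ENNReal.toReal_ofReal (lik_nonneg c hc _)] at h1
    exact h1.symm

theorem aux_exp (b : ℝ) (hb : b < 1 / 2) :
    Integrable (fun x => Real.exp (b * x ^ 2)) (gaussianReal 0 1) ∧
    ∫ x, Real.exp (b * x ^ 2) ∂(gaussianReal 0 1) = (Real.sqrt (1 - 2 * b))⁻¹ := by
  have key : ∀ x : ℝ, gaussianPDFReal 0 1 x * Real.exp (b * x ^ 2) =
      (Real.sqrt (2 * Real.pi))⁻¹ * Real.exp (-(1 / 2 - b) * x ^ 2) := by
    intro x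
    simp only [gaussianPDFReal, NNReal.coe_one, mul_one, sub_zero]
    rw [mul_assoc, ← Real.exp_add]
    congr 2; ring
  constructor
  · rw [gaussianReal_of_var_ne_zero _ one_ne_zero,
      integrable_withDensity_iff_integrable_smul' (by fun_prop)
        (ae_of_all _ fun q => gaussianPDF_lt_top)]
    simp only [toReal_gaussianPDF, smul_eq_mul, key]
    exact (integrable_exp_neg_mul_sq (by linarith)).const_mul _
  · rw [integral_gaussianReal_eq_integral_smul one_ne_zero]
    simp only [smul_eq_mul, key]
    rw [integral_const_mul, integral_gaussian, ← Real.sqrt_inv, ← Real.sqrt_inv,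
      ← Real.sqrt_mul (by positivity)]
    congr 1
    have : (1 / 2 - b) ≠ 0 := by linarith
    have : (1 - 2 * b) ≠ 0 := by linarith
    field_simp

theorem aux_lik (c : ℝ) (hc : 1 ≤ c) (hd : c ^ 2 - 1 ≤ 1 / 4) :
    Integrable (fun x => (lik c (c * x) - 1) ^ 2) (gaussianReal 0 1) ∧
    ∫ x, (lik c (c * x) - 1) ^ 2 ∂(gaussianReal 0 1) ≤ 4 * (c ^ 2 - 1) ^ 2 := by
  obtain ⟨i1, v1⟩ := aux_exp ((c ^ 2 - 1) / 2) (by linarith)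
  obtain ⟨i2, v2⟩ := aux_exp (c ^ 2 - 1) (by linarith)
  have hc0 : 0 < c := by linarith
  have key : ∀ x, (lik c (c * x) - 1) ^ 2 = (c ^ 2)⁻¹ * Real.exp ((c ^ 2 - 1) * x ^ 2) -
      2 * c⁻¹ * Real.exp ((c ^ 2 - 1) / 2 * x ^ 2) + 1 := by
    intro x
    have e1 : (c * x) ^ 2 / 2 - (c * x) ^ 2 / (2 * c ^ 2) = (c ^ 2 - 1) / 2 * x ^ 2 := by
      field_simp
    have e2 : Real.exp ((c ^ 2 - 1) * x ^ 2) = Real.exp ((c ^ 2 - 1) / 2 * x ^ 2) ^ 2 := by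
      rw [← Real.exp_nat_mul]; congr 1; push_cast; ring
    rw [lik, e1, e2]; ring
  simp_rw [key]
  have I1 := i1.const_mul (2 * c⁻¹)
  have I2 := i2.const_mul ((c ^ 2)⁻¹)
  refine ⟨(I2.sub I1).add (integrable_const 1), ?_⟩
  rw [integral_add (f := fun x => (c ^ 2)⁻¹ * Real.exp ((c ^ 2 - 1) * x ^ 2) -
      2 * c⁻¹ * Real.exp ((c ^ 2 - 1) / 2 * x ^ 2)) (I2.sub I1) (integrable_const 1),
    integral_sub I2 I1, integral_const_mul, integral_const_mul, v1, v2]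
  simp only [integral_const, probReal_univ, smul_eq_mul, mul_one]
  set d := c ^ 2 - 1 with hd'
  have hd0 : 0 ≤ d := by nlinarith
  have hcd : c ^ 2 = 1 + d := by rw [hd']; ring
  have A1 : 1 ≤ c⁻¹ * (Real.sqrt (1 - 2 * (d / 2)))⁻¹ := by
    rw [← mul_inv]
    apply (one_le_inv₀ (mul_pos hc0 (Real.sqrt_pos.2 (by linarith)))).2
    apply (sq_le_one_iff₀ (mul_nonneg hc0.le (Real.sqrt_nonneg _))).1
    rw [mul_pow, Real.sq_sqrt (by linarith), hcd]
    nlinarith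
  have A2 : (c ^ 2)⁻¹ * (Real.sqrt (1 - 2 * d))⁻¹ ≤ 1 + 4 * d ^ 2 := by
    have hr : 0 < Real.sqrt (1 - 2 * d) := Real.sqrt_pos.2 (by linarith)
    rw [← mul_inv, inv_le_iff_one_le_mul₀ (by positivity)]
    apply (one_le_sq_iff₀ (by positivity)).1
    rw [mul_pow, mul_pow, Real.sq_sqrt (by linarith), hcd]
    have e1 : 1 - 7 / 2 * d ^ 2 ≤ (1 + d) ^ 2 * (1 - 2 * d) := by
      nlinarith [mul_nonneg (sq_nonneg d) hd0, mul_nonneg (sq_nonneg d) (sub_nonneg.2 hd)]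
    have e2 : d ^ 2 ≤ 1 / 16 := by nlinarith
    have e3 : (1:ℝ) ≤ (1 - 7 / 2 * d ^ 2) * (1 + 4 * d ^ 2) ^ 2 := by
      nlinarith [mul_nonneg (sq_nonneg d) (sub_nonneg.2 e2),
        mul_nonneg (sq_nonneg (d ^ 2)) (sub_nonneg.2 e2)]
    nlinarith [mul_le_mul_of_nonneg_right e1 (sq_nonneg (1 + 4 * d ^ 2))]
  nlinarith

theorem aux_lip (π : Measure ℝ) [IsProbabilityMeasure π]
    (hπ2 : Integrable (fun x => x ^ 2) π) (s₁ s₂ : ℝ) (h1 : 0 < s₁) (h12 : s₁ < s₂) :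
    (∫ q, (q.1 - ((π.prod (gaussianReal 0 1))[(fun q' : ℝ × ℝ => q'.1) |
          MeasurableSpace.comap (fun q' : ℝ × ℝ => s₁ * q'.1 + q'.2)
            inferInstance]) q) ^ 2 ∂(π.prod (gaussianReal 0 1))) -
    ∫ q, (q.1 - ((π.prod (gaussianReal 0 1))[(fun q' : ℝ × ℝ => q'.1) |
          MeasurableSpace.comap (fun q' : ℝ × ℝ => s₂ * q'.1 + q'.2)
            inferInstance]) q) ^ 2 ∂(π.prod (gaussianReal 0 1)) ≤
    (2 + 32 * ∫ x, x ^ 4 ∂(gaussianReal 0 1)) / (s₁ ^ 2 * s₁ ^ 2) * (s₂ ^ 2 - s₁ ^ 2) := by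
  obtain ⟨g₁, hg₁, hgeq₁, hV, hgL₁, horth₁, h4⟩ := aux_estimator π hπ2 s₁ h1.le
  obtain ⟨g₂, hg₂, hgeq₂, -, hgL₂, -, -⟩ := aux_estimator π hπ2 s₂ (h1.trans h12).le
  simp_rw [hgeq₁, hgeq₂]
  obtain ⟨i4, v4⟩ := h4 h1
  have hM0 : 0 ≤ ∫ x, x ^ 4 ∂(gaussianReal 0 1) := integral_nonneg fun x => by positivity
  set M := ∫ x, x ^ 4 ∂(gaussianReal 0 1) with hM
  set μ := π.prod (gaussianReal 0 1) with hμ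
  set D : ℝ × ℝ → ℝ := fun q => q.1 - g₁ (s₁ * q.1 + q.2) with hD
  set B : ℝ × ℝ → ℝ := fun q => q.1 - g₂ (s₂ * q.1 + q.2) with hB
  change ∫ q, D q ^ 2 ∂μ - ∫ q, B q ^ 2 ∂μ ≤ _
  change Integrable (fun q => D q ^ 4) μ at i4
  change s₁ ^ 4 * ∫ q, D q ^ 4 ∂μ ≤ _ at v4
  have hDm : Measurable D := by fun_prop
  have hBm : Measurable B := by fun_prop
  have hD2 : MemLp D 2 μ := hV.sub hgL₁
  have hB2 : MemLp B 2 μ := hV.sub hgL₂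
  set c := s₂ / s₁ with hc
  have hc1 : 1 < c := by rw [hc, one_lt_div h1]; exact h12
  have hc0 : 0 < c := by linarith
  have hcs : c * s₁ = s₂ := by rw [hc]; field_simp
  set d := c ^ 2 - 1 with hd
  have hd0 : 0 < d := by rw [hd]; nlinarith
  set r := s₁ ^ 2 with hr
  have hr0 : 0 < r := by positivity
  have hds : s₂ ^ 2 - s₁ ^ 2 = d * r := by rw [← hcs, hd, hr]; ring
  rw [hds]
  have hrhs : (2 + 32 * M) / (r * r) * (d * r) = (2 + 32 * M) * d / r := by field_simp
  rw [hrhs]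
  have v4' : r * ∫ q, D q ^ 4 ∂μ ≤ 16 * M / r := by
    rw [le_div_iff₀ hr0]
    calc _ = s₁ ^ 4 * ∫ q, D q ^ 4 ∂μ := by rw [hr]; ring
      _ ≤ _ := v4
  have hB0 : 0 ≤ ∫ q, B q ^ 2 ∂μ := integral_nonneg fun q => sq_nonneg _
  rcases le_or_gt d (1 / 4) with hd4 | hd4
  swap
  · -- large gap
    have hb : ∫ q, D q ^ 2 ∂μ ≤ ∫ q, ((1 / 2) * (r * D q ^ 4) + 1 / (2 * r)) ∂μ := by
      refine integral_mono hD2.integrable_sq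
        (((i4.const_mul r).const_mul (1 / 2)).add (integrable_const _)) fun q => ?_
      have : (1 / 2) * (r * D q ^ 4) + 1 / (2 * r) - D q ^ 2 = (r * D q ^ 2 - 1) ^ 2 / (2 * r) := by
        field_simp; ring
      have h' : 0 ≤ (r * D q ^ 2 - 1) ^ 2 / (2 * r) := by positivity
      simp only; linarith
    rw [integral_add ((i4.const_mul r).const_mul (1 / 2)) (integrable_const _),
      integral_const_mul, integral_const_mul] at hb
    simp only [integral_const, probReal_univ, smul_eq_mul, one_mul] at hb
    have e1 : 1 / (2 * r) + 1 / 2 * (16 * M / r) = (1 / 2 + 8 * M) / r := by field_simp; ring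
    have e2 : (1 / 2 + 8 * M) / r ≤ (2 + 32 * M) * d / r := by
      apply div_le_div_of_nonneg_right _ hr0.le
      nlinarith
    linarith
  -- small gap
  obtain ⟨iL, vL⟩ := aux_lik c hc1.le hd4
  set ℓ : ℝ × ℝ → ℝ := fun q => lik c (c * q.2) with hℓ
  have hlm := lik_meas c
  have hℓm : Measurable ℓ := by fun_prop
  have iL' : Integrable (fun q => (ℓ q - 1) ^ 2) μ := iL.comp_snd π
  have vL' : ∫ q, (ℓ q - 1) ^ 2 ∂μ ≤ 4 * d ^ 2 := by
    have := integral_fun_snd (μ := π) (ν := gaussianReal 0 1) (fun x : ℝ => (lik c (c * x) - 1) ^ 2)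
    simp only [probReal_univ, one_smul] at this
    exact this.trans_le vL
  -- pointwise AM-GM
  have hdr : 0 < d * r := by positivity
  have ibound : Integrable (fun q => (d / 2) * (r * D q ^ 4) + 1 / (2 * (d * r)) * (ℓ q - 1) ^ 2) μ :=
    ((i4.const_mul r).const_mul (d / 2)).add (iL'.const_mul _)
  have hpt : ∀ q, |D q ^ 2 * (ℓ q - 1)| ≤
      (d / 2) * (r * D q ^ 4) + 1 / (2 * (d * r)) * (ℓ q - 1) ^ 2 := by
    intro q
    rw [abs_le]
    have e1 : (d / 2) * (r * D q ^ 4) + 1 / (2 * (d * r)) * (ℓ q - 1) ^ 2 - D q ^ 2 * (ℓ q - 1)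
      = (d * r * D q ^ 2 - (ℓ q - 1)) ^ 2 / (2 * (d * r)) := by field_simp; ring
    have e2 : (d / 2) * (r * D q ^ 4) + 1 / (2 * (d * r)) * (ℓ q - 1) ^ 2 + D q ^ 2 * (ℓ q - 1)
      = (d * r * D q ^ 2 + (ℓ q - 1)) ^ 2 / (2 * (d * r)) := by field_simp; ring
    have h1' : 0 ≤ (d * r * D q ^ 2 - (ℓ q - 1)) ^ 2 / (2 * (d * r)) := by positivity
    have h2' : 0 ≤ (d * r * D q ^ 2 + (ℓ q - 1)) ^ 2 / (2 * (d * r)) := by positivity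
    constructor <;> linarith
  have iDL : Integrable (fun q => D q ^ 2 * (ℓ q - 1)) μ :=
    ibound.mono' (by fun_prop) (ae_of_all _ fun q => hpt q)
  have vDL : ∫ q, D q ^ 2 * (ℓ q - 1) ∂μ ≤ (2 + 32 * M) * d / r := by
    have h' := integral_mono iDL ibound fun q => (le_abs_self _).trans (hpt q)
    rw [integral_add ((i4.const_mul r).const_mul (d / 2)) (iL'.const_mul _),
      integral_const_mul, integral_const_mul, integral_const_mul] at h'
    have e1 : d / 2 * (r * ∫ q, D q ^ 4 ∂μ) ≤ d / 2 * (16 * M / r) :=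
      mul_le_mul_of_nonneg_left v4' (by positivity)
    have e2 : 1 / (2 * (d * r)) * ∫ q, (ℓ q - 1) ^ 2 ∂μ ≤ 1 / (2 * (d * r)) * (4 * d ^ 2) :=
      mul_le_mul_of_nonneg_left vL' (by positivity)
    have e3 : d / 2 * (16 * M / r) + 1 / (2 * (d * r)) * (4 * d ^ 2) = (2 + 8 * M) * d / r := by
      field_simp; ring
    have e4 : (2 + 8 * M) * d / r ≤ (2 + 32 * M) * d / r := by
      apply div_le_div_of_nonneg_right _ hr0.le
      nlinarith
    linarith
  have iDl : Integrable (fun q => D q ^ 2 * ℓ q) μ := by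
    refine (iDL.add hD2.integrable_sq).congr (ae_of_all _ fun q => ?_)
    simp only [Pi.add_apply]; ring
  have vDl : ∫ q, D q ^ 2 * ℓ q ∂μ = ∫ q, D q ^ 2 * (ℓ q - 1) ∂μ + ∫ q, D q ^ 2 ∂μ := by
    rw [← integral_add iDL hD2.integrable_sq]
    congr 1; ext q; ring
  -- the test variable
  set E : ℝ × ℝ → ℝ := fun q => D (q.1, q.2 / c) with hE
  have hEm : Measurable E := by fun_prop
  have hEc : ∀ q : ℝ × ℝ, E (q.1, c * q.2) = D q := by
    intro q; simp only [hE]; rw [mul_div_cancel_left₀ _ hc0.ne']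
  obtain ⟨z1, z2⟩ := aux_cov_int π c hc0 (fun q => E q ^ 2 * lik c q.2) (by fun_prop)
  simp only [hEc] at z1 z2
  have iZ2 : Integrable (fun q : ℝ × ℝ => (lik c q.2 * E q) ^ 2) μ := by
    refine (z1.2 iDl).congr (ae_of_all _ fun q => ?_)
    simp only; ring
  have vZ2 : ∫ q : ℝ × ℝ, (lik c q.2 * E q) ^ 2 ∂μ = ∫ q, D q ^ 2 * ℓ q ∂μ := by
    rw [← z2]; congr 1; ext q; ring
  have hZ : MemLp (fun q : ℝ × ℝ => lik c q.2 * E q) 2 μ := by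
    rw [memLp_two_iff_integrable_sq (by fun_prop)]; exact iZ2
  have iBZ : Integrable (fun q : ℝ × ℝ => lik c q.2 * (E q * B q)) μ := by
    refine (hZ.integrable_mul hB2).congr (ae_of_all _ fun q => ?_)
    simp only [Pi.mul_apply]; ring
  obtain ⟨b1, b2⟩ := aux_cov_int π c hc0 (fun q => E q * B q) (by fun_prop)
  simp only [hEc] at b1 b2
  have iDB : Integrable (fun q : ℝ × ℝ => D q * B (q.1, c * q.2)) μ := b1.1 iBZ
  -- orthogonality
  have iVD : Integrable (fun q : ℝ × ℝ => q.1 * D q) μ := hV.integrable_mul hD2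
  have igD : Integrable (fun q : ℝ × ℝ => g₁ (s₁ * q.1 + q.2) * D q) μ := hgL₁.integrable_mul hD2
  have hBc : ∀ q : ℝ × ℝ, D q * B (q.1, c * q.2) =
      q.1 * D q - g₂ (c * (s₁ * q.1 + q.2)) * D q := by
    intro q
    have : s₂ * q.1 + c * q.2 = c * (s₁ * q.1 + q.2) := by rw [← hcs]; ring
    simp only [hB, this]; ring
  have igD2 : Integrable (fun q : ℝ × ℝ => g₂ (c * (s₁ * q.1 + q.2)) * D q) μ := by
    refine (iVD.sub iDB).congr (ae_of_all _ fun q => ?_)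
    simp only [Pi.sub_apply, hBc]; ring
  have o1 : ∫ q, g₁ (s₁ * q.1 + q.2) * D q ∂μ = 0 := horth₁ g₁ hg₁ igD
  have o2 : ∫ q, g₂ (c * (s₁ * q.1 + q.2)) * D q ∂μ = 0 :=
    horth₁ (fun y => g₂ (c * y)) (by fun_prop) igD2
  have vDB : ∫ q, D q * B (q.1, c * q.2) ∂μ = ∫ q, D q ^ 2 ∂μ := by
    simp_rw [hBc]
    rw [integral_sub iVD igD2, o2, ← o1, ← integral_sub iVD igD]
    congr 1; ext q; simp only [hD]; ring
  have fin : ∫ q : ℝ × ℝ, (2 * (lik c q.2 * (E q * B q)) - (lik c q.2 * E q) ^ 2) ∂μ ≤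
      ∫ q, B q ^ 2 ∂μ := by
    refine integral_mono ((iBZ.const_mul 2).sub iZ2) hB2.integrable_sq fun q => ?_
    simp only
    nlinarith [sq_nonneg (B q - lik c q.2 * E q)]
  rw [integral_sub (iBZ.const_mul 2) iZ2, integral_const_mul, b2, vDB, vZ2, vDl] at fin
  linarith



/-- **Monotonicity and continuity of the minimum mean squared error** (Corollary `mmse`
of the paper).  With `V ∼ π` (finite second moment) and `G ∼ N(0,1)` independent,
realised as the two coordinates of the product space `π ⊗ N(0,1)`, define
`mmse(ρ) = E[(V − E[V | √ρ V + G])²]`.  Then `mmse` is non-increasing on `[0,∞)`;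
and if `π` has a log-concave Lebesgue density, or is the law of an independent sum of a
Gaussian and a compactly supported random variable, then `mmse` is continuous on
`(0,∞)`, indeed Lipschitz on `(ρ', ∞)` for every `ρ' > 0`. -/
theorem mmse_monotone_and_continuous
    (π : Measure ℝ) [IsProbabilityMeasure π]
    (hπ2 : Integrable (fun x => x ^ 2) π)
    (mmse : ℝ → ℝ)
    (hmmse : ∀ ρ : ℝ, mmse ρ =
      ∫ q, (q.1 - ((π.prod (gaussianReal 0 1))[(fun q' : ℝ × ℝ => q'.1) |
          MeasurableSpace.comap (fun q' : ℝ × ℝ => Real.sqrt ρ * q'.1 + q'.2)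
            inferInstance]) q) ^ 2
        ∂(π.prod (gaussianReal 0 1))) :
    (∀ ρ₁ ρ₂ : ℝ, 0 ≤ ρ₁ → ρ₁ ≤ ρ₂ → mmse ρ₂ ≤ mmse ρ₁) ∧
    (((∃ f : ℝ → ℝ, (∀ x, 0 ≤ f x) ∧
          π = volume.withDensity (fun x => ENNReal.ofReal (f x)) ∧
          (∀ x y θ : ℝ, 0 ≤ θ → θ ≤ 1 →
            f x ^ θ * f y ^ (1 - θ) ≤ f (θ * x + (1 - θ) * y))) ∨
        (∃ (m : ℝ) (v : NNReal) (ν : Measure ℝ) (_ : IsProbabilityMeasure ν) (R : ℝ),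
          ν {x | R < |x|} = 0 ∧
          π = ((gaussianReal m v).prod ν).map (fun q => q.1 + q.2))) →
      ContinuousOn mmse (Set.Ioi (0 : ℝ)) ∧
      ∀ ρ' : ℝ, 0 < ρ' → ∃ K : NNReal, LipschitzOnWith K mmse (Set.Ioi ρ')) := by
  have hmono : ∀ ρ₁ ρ₂ : ℝ, 0 ≤ ρ₁ → ρ₁ ≤ ρ₂ → mmse ρ₂ ≤ mmse ρ₁ := by
    intro ρ₁ ρ₂ h1 h2
    rw [hmmse, hmmse]
    exact aux_mono π hπ2 _ _ (Real.sqrt_nonneg _) (Real.sqrt_le_sqrt h2)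
  refine ⟨hmono, fun _ => ?_⟩
  have hlip : ∀ ρ' : ℝ, 0 < ρ' → ∃ K : NNReal, LipschitzOnWith K mmse (Set.Ioi ρ') := by
    intro ρ' hρ'
    have hM0 : 0 ≤ ∫ x, x ^ 4 ∂(gaussianReal 0 1) := integral_nonneg fun x => by positivity
    set M := ∫ x, x ^ 4 ∂(gaussianReal 0 1) with hM
    have key : ∀ x y : ℝ, ρ' < x → x ≤ y →
        |mmse x - mmse y| ≤ (2 + 32 * M) / (ρ' * ρ') * (y - x) := by
      intro x y hx hxy
      have hx0 : 0 < x := hρ'.trans hx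
      rw [abs_of_nonneg (sub_nonneg.2 (hmono x y hx0.le hxy))]
      rcases eq_or_lt_of_le hxy with rfl | hlt
      · simp
      have h := aux_lip π hπ2 (Real.sqrt x) (Real.sqrt y) (Real.sqrt_pos.2 hx0)
        (Real.sqrt_lt_sqrt hx0.le hlt)
      rw [← hmmse, ← hmmse, Real.sq_sqrt hx0.le, Real.sq_sqrt (hx0.trans hlt).le] at h
      refine h.trans ?_
      have : 0 ≤ y - x := by linarith
      gcongr
    refine ⟨Real.toNNReal ((2 + 32 * M) / (ρ' * ρ')), LipschitzOnWith.of_dist_le_mul ?_⟩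
    intro x hx y hy
    rw [Real.coe_toNNReal _ (by positivity), Real.dist_eq, Real.dist_eq]
    rcases le_total x y with hxy | hxy
    · have := key x y hx hxy
      rwa [abs_of_nonpos (by linarith : x - y ≤ 0), neg_sub]
    · have := key y x hy hxy
      rwa [abs_of_nonneg (by linarith : 0 ≤ x - y), abs_sub_comm]
  refine ⟨?_, hlip⟩
  intro x hx
  have hx0 : (0:ℝ) < x := hx
  obtain ⟨K, hK⟩ := hlip (x / 2) (by linarith)
  have : x ∈ Set.Ioi (x / 2) := by simp only [Set.mem_Ioi]; linarith
  exact (hK.continuousOn.continuousAt (Ioi_mem_nhds (by linarith))).continuousWithinAt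
end

section
/- Let V ∼ π be a real random variable and suppose either (i) V has a log-concave Lebesgue density, or (ii) V is equal in distribution to U₀ + V₀, where U₀ is Gaussian, V₀ is compactly supported and U₀, V₀ are independent. Fix μ ≠ 0 and σ > 0, and let G ∼ N(0,1) be independent of V. Then the random variable μV + σG has a strictly positive, infinitely differentiable Lebesgue density p given by p(y) = ∫ φ_σ(y − μx) dπ(x), where φ_σ is the N(0,σ²) density; the function g* : ℝ → ℝ defined by g*(y) := (y + σ²·p′(y)/p(y)) / μ satisfies g*(μV + σG) = E[V | μV + σG] almost surely (Tweedie's formula); and g* is infinitely differentiable and Lipschitz on ℝ. -/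
open MeasureTheory ProbabilityTheory


noncomputable def gdm (π : Measure ℝ) (a : ℝ) : Measure ℝ :=
  π.withDensity (fun x => ENNReal.ofReal (Real.exp (-(a * x ^ 2))))

lemma gdm_integrable_iff (π : Measure ℝ) (a : ℝ) (F : ℝ → ℝ) :
    Integrable F (gdm π a) ↔ Integrable (fun x => Real.exp (-(a * x ^ 2)) * F x) π := by
  unfold gdm
  rw [integrable_withDensity_iff_integrable_smul' (by fun_prop) (by simp)]
  simp [ENNReal.toReal_ofReal, Real.exp_nonneg]

lemma gdm_integral (π : Measure ℝ) (a : ℝ) (F : ℝ → ℝ) :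
    ∫ x, F x ∂(gdm π a) = ∫ x, Real.exp (-(a * x ^ 2)) * F x ∂π := by
  unfold gdm
  rw [integral_withDensity_eq_integral_toReal_smul (by fun_prop) (by simp)]
  simp [ENNReal.toReal_ofReal, Real.exp_nonneg]

lemma gdm_ne_zero (π : Measure ℝ) [IsProbabilityMeasure π] (a : ℝ) : gdm π a ≠ 0 := by
  unfold gdm
  intro h
  rw [withDensity_eq_zero_iff (by fun_prop)] at h
  have : ∀ᵐ x ∂π, False := by
    filter_upwards [h] with x hx
    simp at hx
    linarith [Real.exp_pos (-(a * x ^ 2))]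
  simp at this
  exact IsProbabilityMeasure.ne_zero π this

lemma gdm_set (π : Measure ℝ) [IsProbabilityMeasure π] {a : ℝ} (ha : 0 < a) :
    integrableExpSet id (gdm π a) = Set.univ := by
  ext t
  simp only [integrableExpSet, Set.mem_ofPred_eq, Set.mem_univ, iff_true]
  rw [gdm_integrable_iff]
  refine Integrable.mono' (integrable_const (Real.exp (t ^ 2 / (4 * a)))) (by fun_prop) ?_
  refine Filter.Eventually.of_forall fun x => ?_
  rw [← Real.exp_add, Real.norm_of_nonneg (Real.exp_nonneg _)]
  apply Real.exp_le_exp.2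
  rw [le_div_iff₀ (by positivity)]
  simp only [id]
  nlinarith [sq_nonneg (2 * a * x - t)]

lemma gdm_mem (π : Measure ℝ) [IsProbabilityMeasure π] {a : ℝ} (ha : 0 < a) (t : ℝ) :
    t ∈ interior (integrableExpSet id (gdm π a)) := by
  rw [gdm_set π ha]; simp

lemma gdm_mgf_pos (π : Measure ℝ) [IsProbabilityMeasure π] {a : ℝ} (ha : 0 < a) (t : ℝ) :
    0 < mgf id (gdm π a) t :=
  mgf_pos' (gdm_ne_zero π a) (interior_subset (s := integrableExpSet id (gdm π a)) (gdm_mem π ha t))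

lemma tw_exp (μ σ : ℝ) (hσ : 0 < σ) (x y : ℝ) :
    Real.exp (-(y - μ * x) ^ 2 / (2 * σ ^ 2)) = Real.exp (-(y ^ 2 / (2 * σ ^ 2))) *
      (Real.exp (-((μ ^ 2 / (2 * σ ^ 2)) * x ^ 2)) * Real.exp (y * μ / σ ^ 2 * x)) := by
  rw [← Real.exp_add, ← Real.exp_add]
  congr 1
  field_simp
  ring

section core
variable (π : Measure ℝ) [IsProbabilityMeasure π] (μ σ : ℝ) (hμ : μ ≠ 0) (hσ : 0 < σ)
    (p : ℝ → ℝ)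
    (hp : ∀ y : ℝ, p y = ∫ x, (Real.sqrt (2 * Real.pi * σ ^ 2))⁻¹ *
        Real.exp (-(y - μ * x) ^ 2 / (2 * σ ^ 2)) ∂π)
include hμ hσ hp

omit hμ in
lemma tw_p_eq (y : ℝ) : p y = (Real.sqrt (2 * Real.pi * σ ^ 2))⁻¹ *
    Real.exp (-(y ^ 2 / (2 * σ ^ 2))) * mgf id (gdm π (μ ^ 2 / (2 * σ ^ 2))) (y * μ / σ ^ 2) := by
  rw [hp, mgf, gdm_integral, ← integral_const_mul]
  congr 1; ext x
  rw [tw_exp μ σ hσ]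
  simp only [id]; ring

lemma tw_p_pos (y : ℝ) : 0 < p y := by
  rw [tw_p_eq π μ σ hσ p hp]
  have := gdm_mgf_pos π (a := μ ^ 2 / (2 * σ ^ 2)) (by positivity) (y * μ / σ ^ 2)
  have := Real.pi_pos
  positivity

lemma tw_p_smooth (k : ℕ) : ContDiff ℝ k p := by
  have h1 : ContDiff ℝ k (mgf id (gdm π (μ ^ 2 / (2 * σ ^ 2)))) := by
    rw [contDiff_iff_contDiffAt]
    exact fun t => (analyticAt_mgf (gdm_mem π (by positivity) t)).contDiffAt
  rw [funext (tw_p_eq π μ σ hσ p hp)]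
  have h2 : ContDiff ℝ k (fun y : ℝ => y * μ / σ ^ 2) := by fun_prop
  have := h1.comp h2
  simp only [Function.comp_def] at this
  refine ContDiff.mul ?_ this
  fun_prop

/-- log-derivative -/
lemma tw_logderiv (y : ℝ) : deriv p y / p y =
    -(y / σ ^ 2) + μ / σ ^ 2 * deriv (cgf id (gdm π (μ ^ 2 / (2 * σ ^ 2)))) (y * μ / σ ^ 2) := by
  set a := μ ^ 2 / (2 * σ ^ 2) with ha
  have ha0 : 0 < a := by positivity
  have hm := hasDerivAt_mgf (gdm_mem π ha0 (y * μ / σ ^ 2))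
  have h2 : HasDerivAt (fun y : ℝ => y * μ / σ ^ 2) (1 * μ / σ ^ 2) y :=
    ((hasDerivAt_id y).mul_const μ).div_const _
  have h3 := hm.comp y h2
  have h4 : HasDerivAt (fun y : ℝ => Real.exp (-(y ^ 2 / (2 * σ ^ 2))))
      (Real.exp (-(y ^ 2 / (2 * σ ^ 2))) * (-(2 * y / (2 * σ ^ 2)))) y := by
    have := (((hasDerivAt_pow 2 y).div_const (2 * σ ^ 2)).neg).exp
    simpa using this
  have h5 := (h4.const_mul (Real.sqrt (2 * Real.pi * σ ^ 2))⁻¹).mul h3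
  have h6 := h5.congr_of_eventuallyEq
    (Filter.Eventually.of_forall (tw_p_eq π μ σ hσ p hp))
  replace h6 := h6.deriv
  have hpos := gdm_mgf_pos π ha0 (y * μ / σ ^ 2)
  rw [h6, tw_p_eq π μ σ hσ p hp, deriv_cgf (gdm_mem π ha0 _)]
  have hs : 0 < Real.sqrt (2 * Real.pi * σ ^ 2) := by
    have := Real.pi_pos
    positivity
  simp only [Function.comp_def, ← ha]
  have he := Real.exp_pos (-(y ^ 2 / (2 * σ ^ 2)))
  generalize Real.exp (-(y ^ 2 / (2 * σ ^ 2))) = E at *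
  generalize Real.sqrt (2 * Real.pi * σ ^ 2) = S at *
  generalize mgf id (gdm π a) (y * μ / σ ^ 2) = M at *
  generalize (∫ (x : ℝ), id x * Real.exp (y * μ / σ ^ 2 * id x) ∂gdm π a) = N at *
  field_simp

lemma tw_g (gstar : ℝ → ℝ)
    (hgstar : ∀ y : ℝ, gstar y = (y + σ ^ 2 * (deriv p y / p y)) / μ) (y : ℝ) :
    gstar y = deriv (cgf id (gdm π (μ ^ 2 / (2 * σ ^ 2)))) (y * μ / σ ^ 2) := by
  rw [hgstar, tw_logderiv π μ σ hμ hσ p hp]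
  field_simp
  ring

lemma tw_g_smooth (gstar : ℝ → ℝ)
    (hgstar : ∀ y : ℝ, gstar y = (y + σ ^ 2 * (deriv p y / p y)) / μ) (k : ℕ) :
    ContDiff ℝ k gstar := by
  have h1 : ContDiff ℝ k (deriv (cgf id (gdm π (μ ^ 2 / (2 * σ ^ 2))))) := by
    rw [contDiff_iff_contDiffAt]
    exact fun t => (analyticAt_cgf (gdm_mem π (by positivity) t)).deriv.contDiffAt
  rw [funext (tw_g π μ σ hμ hσ p hp gstar hgstar)]
  have h2 : ContDiff ℝ k (fun y : ℝ => y * μ / σ ^ 2) := by fun_prop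
  exact h1.comp h2

lemma tw_gp (gstar : ℝ → ℝ)
    (hgstar : ∀ y : ℝ, gstar y = (y + σ ^ 2 * (deriv p y / p y)) / μ) (y : ℝ) :
    Integrable (fun x => x * ((Real.sqrt (2 * Real.pi * σ ^ 2))⁻¹ *
        Real.exp (-(y - μ * x) ^ 2 / (2 * σ ^ 2)))) π ∧
    gstar y * p y = ∫ x, x * ((Real.sqrt (2 * Real.pi * σ ^ 2))⁻¹ *
        Real.exp (-(y - μ * x) ^ 2 / (2 * σ ^ 2))) ∂π := by
  set a := μ ^ 2 / (2 * σ ^ 2) with ha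
  have ha0 : 0 < a := by positivity
  have hpos := gdm_mgf_pos π ha0 (y * μ / σ ^ 2)
  have key : (fun x => x * ((Real.sqrt (2 * Real.pi * σ ^ 2))⁻¹ *
        Real.exp (-(y - μ * x) ^ 2 / (2 * σ ^ 2)))) = fun x =>
      ((Real.sqrt (2 * Real.pi * σ ^ 2))⁻¹ * Real.exp (-(y ^ 2 / (2 * σ ^ 2)))) *
      (Real.exp (-(a * x ^ 2)) * (id x * Real.exp (y * μ / σ ^ 2 * id x))) := by
    ext x
    rw [tw_exp μ σ hσ]
    simp only [id]; ring
  constructor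
  · rw [key]
    refine Integrable.const_mul ?_ _
    rw [← gdm_integrable_iff]
    have := integrable_pow_mul_exp_of_mem_interior_integrableExpSet
      (gdm_mem π ha0 (y * μ / σ ^ 2)) 1
    simpa using this
  · rw [key, integral_const_mul, ← gdm_integral,
      tw_g π μ σ hμ hσ p hp gstar hgstar, tw_p_eq π μ σ hσ p hp, deriv_cgf (gdm_mem π ha0 _)]
    simp only [← ha]
    generalize (∫ (x : ℝ), id x * Real.exp (y * μ / σ ^ 2 * id x) ∂gdm π a) = N at *
    generalize mgf id (gdm π a) (y * μ / σ ^ 2) = M at *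
    field_simp

lemma tw_lip (C : ℝ)
    (hC : ∀ t : ℝ, Var[id; (gdm π (μ ^ 2 / (2 * σ ^ 2))).tilted (fun x => t * x)] ≤ C) :
    ∃ K : NNReal, LipschitzWith K (fun y => deriv p y / p y) := by
  set a := μ ^ 2 / (2 * σ ^ 2) with ha
  have ha0 : 0 < a := by positivity
  have hd : ∀ t, HasDerivAt (deriv (cgf id (gdm π a)))
      (Var[id; (gdm π a).tilted (fun x => t * x)]) t := by
    intro t
    have h1 := variance_tilted_mul (gdm_mem π ha0 t)
    rw [iteratedDeriv_succ, iteratedDeriv_one] at h1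
    simp only [id] at h1 ⊢
    erw [h1]
    exact ((analyticAt_cgf (gdm_mem π ha0 t)).deriv.differentiableAt).hasDerivAt
  have hC0 : 0 ≤ C := (variance_nonneg _ _).trans (hC 0)
  have hL : LipschitzWith C.toNNReal (deriv (cgf id (gdm π a))) := by
    refine lipschitzWith_of_nnnorm_deriv_le (fun t => (hd t).differentiableAt) fun t => ?_
    rw [(hd t).deriv, ← NNReal.coe_le_coe, coe_nnnorm, Real.norm_of_nonneg (variance_nonneg _ _),
      Real.coe_toNNReal _ hC0]
    exact hC t
  have h1 : LipschitzWith (Real.toNNReal |μ / σ ^ 2|) (fun y : ℝ => μ / σ ^ 2 * y) :=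
    LipschitzWith.of_dist_le_mul fun x y => by
      rw [Real.coe_toNNReal _ (abs_nonneg _), Real.dist_eq, Real.dist_eq, ← abs_mul, mul_sub]
  have h2 : LipschitzWith (Real.toNNReal |-1 / σ ^ 2|) (fun y : ℝ => -1 / σ ^ 2 * y) :=
    LipschitzWith.of_dist_le_mul fun x y => by
      rw [Real.coe_toNNReal _ (abs_nonneg _), Real.dist_eq, Real.dist_eq, ← abs_mul, mul_sub]
  have h3 := h2.add (h1.comp (hL.comp h1))
  have h4 : (fun y => deriv p y / p y) = fun y => -1 / σ ^ 2 * y +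
      ((fun y : ℝ => μ / σ ^ 2 * y) ∘ deriv (cgf id (gdm π a)) ∘ fun y => μ / σ ^ 2 * y) y := by
    ext y
    rw [tw_logderiv π μ σ hμ hσ p hp]
    simp only [Function.comp_def]
    rw [show μ / σ ^ 2 * y = y * μ / σ ^ 2 by ring]
    ring
  rw [h4]
  exact ⟨_, h3⟩

end core

section joint
variable (π : Measure ℝ) [IsProbabilityMeasure π] (μ σ : ℝ) (hμ : μ ≠ 0) (hσ : 0 < σ)

noncomputable def twphi (μ σ x y : ℝ) : ℝ :=
  (Real.sqrt (2 * Real.pi * σ ^ 2))⁻¹ * Real.exp (-(y - μ * x) ^ 2 / (2 * σ ^ 2))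

lemma twphi_nonneg (μ σ x y : ℝ) : 0 ≤ twphi μ σ x y := by
  unfold twphi; positivity

@[fun_prop]
lemma twphi_meas (μ σ : ℝ) : Measurable (fun z : ℝ × ℝ => twphi μ σ z.1 z.2) := by
  unfold twphi; fun_prop

lemma tw_gauss_map (μ σ : ℝ) (hσ : 0 < σ) (x : ℝ) :
    (gaussianReal 0 1).map (fun g => μ * x + σ * g) =
      volume.withDensity (fun y => ENNReal.ofReal (twphi μ σ x y)) := by
  have h1 : (gaussianReal 0 1).map (fun g => μ * x + σ * g) =
      gaussianReal (μ * x) (NNReal.mk (σ ^ 2) (sq_nonneg σ)) := by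
    have : (fun g => μ * x + σ * g) = (fun g => μ * x + g) ∘ (fun g => σ * g) := rfl
    rw [this, ← Measure.map_map (by fun_prop) (by fun_prop), gaussianReal_map_const_mul,
      gaussianReal_map_const_add]
    congr 1
    · simp
    · simp
  rw [h1, gaussianReal_of_var_ne_zero]
  · rfl
  · intro h
    have := congrArg NNReal.toReal h
    simp at this
    exact hσ.ne' this

include hσ in
lemma tw_joint : (π.prod (gaussianReal 0 1)).map (fun q : ℝ × ℝ => (q.1, μ * q.1 + σ * q.2)) =
    (π.prod volume).withDensity (fun z => ENNReal.ofReal (twphi μ σ z.1 z.2)) := by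
  ext s hs
  rw [← lintegral_indicator_one hs, ← lintegral_indicator_one hs,
    lintegral_map (measurable_one.indicator hs) (by fun_prop),
    lintegral_withDensity_eq_lintegral_mul _ (by fun_prop) (measurable_one.indicator hs),
    lintegral_prod, lintegral_prod]
  · congr 1; ext x
    have hm : Measurable (fun y : ℝ => s.indicator (1 : ℝ × ℝ → ENNReal) (x, y)) :=
      (measurable_one.indicator hs).comp (by fun_prop)
    have h1 := lintegral_map (μ := gaussianReal 0 1) hm
      (g := fun g => μ * x + σ * g) (by fun_prop)
    rw [← h1, tw_gauss_map μ σ hσ x,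
      lintegral_withDensity_eq_lintegral_mul _ _ hm]
    · rfl
    · exact ((twphi_meas μ σ).comp (by fun_prop : Measurable (fun y : ℝ => (x, y)))).ennreal_ofReal
  · refine Measurable.aemeasurable ?_
    exact ((twphi_meas μ σ).ennreal_ofReal).mul (measurable_one.indicator hs)
  · refine Measurable.aemeasurable ?_
    exact (measurable_one.indicator hs).comp (by fun_prop)

lemma twphi_int (π : Measure ℝ) [IsProbabilityMeasure π] (μ σ y : ℝ) :
    Integrable (fun x => twphi μ σ x y) π := by
  unfold twphi
  refine Integrable.const_mul ?_ _
  refine Integrable.mono' (integrable_const 1) (by fun_prop) ?_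
  refine Filter.Eventually.of_forall fun x => ?_
  rw [Real.norm_of_nonneg (Real.exp_nonneg _)]
  apply Real.exp_le_one_iff.2
  rw [neg_div]
  have : 0 ≤ (y - μ * x) ^ 2 / (2 * σ ^ 2) := by positivity
  linarith

include hσ in
lemma tw_law (p : ℝ → ℝ) (hp : ∀ y : ℝ, p y = ∫ x, twphi μ σ x y ∂π) :
    (π.prod (gaussianReal 0 1)).map (fun q : ℝ × ℝ => μ * q.1 + σ * q.2) =
      volume.withDensity (fun y => ENNReal.ofReal (p y)) := by
  have h : (π.prod (gaussianReal 0 1)).map (fun q : ℝ × ℝ => μ * q.1 + σ * q.2) =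
      ((π.prod (gaussianReal 0 1)).map
        (fun q : ℝ × ℝ => (q.1, μ * q.1 + σ * q.2))).map Prod.snd := by
    rw [Measure.map_map (by fun_prop) (by fun_prop)]; rfl
  rw [h, tw_joint π μ σ hσ]
  ext s hs
  rw [Measure.map_apply measurable_snd hs, withDensity_apply _ (measurable_snd hs),
    withDensity_apply _ hs, ← lintegral_indicator (measurable_snd hs),
    ← lintegral_indicator hs, lintegral_prod_symm]
  · congr 1; ext y
    by_cases hy : y ∈ s
    · simp only [Set.indicator, Set.mem_preimage, hy, if_true]
      rw [hp, ofReal_integral_eq_lintegral_ofReal (twphi_int π μ σ y)]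
      exact Filter.Eventually.of_forall fun x => twphi_nonneg μ σ x y
    · simp [Set.indicator, hy]
  · exact ((twphi_meas μ σ).ennreal_ofReal.indicator (measurable_snd hs)).aemeasurable

include hσ in
lemma tw_cond (p g : ℝ → ℝ) (hp : ∀ y : ℝ, p y = ∫ x, twphi μ σ x y ∂π)
    (hV : Integrable id π) (K : NNReal) (hg : LipschitzWith K g)
    (hgp : ∀ y, g y * p y = ∫ x, x * twphi μ σ x y ∂π) :
    ((π.prod (gaussianReal 0 1))[(fun q : ℝ × ℝ => q.1) |
        MeasurableSpace.comap (fun q : ℝ × ℝ => μ * q.1 + σ * q.2) inferInstance])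
      =ᵐ[π.prod (gaussianReal 0 1)] fun q : ℝ × ℝ => g (μ * q.1 + σ * q.2) := by
  have hY : Measurable (fun q : ℝ × ℝ => μ * q.1 + σ * q.2) := by fun_prop
  have hG : Integrable id (gaussianReal 0 1) := (memLp_id_gaussianReal 1).integrable (by simp)
  have hV1 : Integrable (fun q : ℝ × ℝ => q.1) (π.prod (gaussianReal 0 1)) := hV.comp_fst _
  have hG1 : Integrable (fun q : ℝ × ℝ => q.2) (π.prod (gaussianReal 0 1)) := hG.comp_snd _
  have hYi : Integrable (fun q : ℝ × ℝ => μ * q.1 + σ * q.2) (π.prod (gaussianReal 0 1)) :=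
    (hV1.const_mul μ).add (hG1.const_mul σ)
  have hgY : Integrable (fun q : ℝ × ℝ => g (μ * q.1 + σ * q.2)) (π.prod (gaussianReal 0 1)) := by
    refine Integrable.mono' ((integrable_const |g 0|).add (hYi.norm.const_mul K))
      (hg.continuous.measurable.comp hY).aestronglyMeasurable ?_
    refine Filter.Eventually.of_forall fun q => ?_
    have := hg.dist_le_mul (μ * q.1 + σ * q.2) 0
    rw [Real.dist_eq, Real.dist_eq, sub_zero] at this
    simp only [Real.norm_eq_abs, Pi.add_apply]
    have h2 := abs_sub_abs_le_abs_sub (g (μ * q.1 + σ * q.2)) (g 0)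
    linarith
  have hT : Measurable (fun q : ℝ × ℝ => (q.1, μ * q.1 + σ * q.2)) := by fun_prop
  have conv : ∀ F : ℝ × ℝ → ℝ, Measurable F →
      Integrable (fun q : ℝ × ℝ => F (q.1, μ * q.1 + σ * q.2)) (π.prod (gaussianReal 0 1)) →
      ∀ B : Set ℝ, MeasurableSet B →
      ∫ q in (fun q : ℝ × ℝ => μ * q.1 + σ * q.2) ⁻¹' B, F (q.1, μ * q.1 + σ * q.2)
        ∂(π.prod (gaussianReal 0 1)) =
      ∫ y in B, ∫ x, twphi μ σ x y * F (x, y) ∂π := by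
    intro F hF hFi B hB
    have e1 : ∫ q in (fun q : ℝ × ℝ => μ * q.1 + σ * q.2) ⁻¹' B, F (q.1, μ * q.1 + σ * q.2)
        ∂(π.prod (gaussianReal 0 1)) = ∫ z in Prod.snd ⁻¹' B, F z
        ∂((π.prod (gaussianReal 0 1)).map (fun q : ℝ × ℝ => (q.1, μ * q.1 + σ * q.2))) := by
      rw [setIntegral_map (measurable_snd hB) hF.aestronglyMeasurable hT.aemeasurable]
      rfl
    have hi2 := (integrable_map_measure hF.aestronglyMeasurable hT.aemeasurable).2 hFi
    rw [tw_joint π μ σ hσ, integrable_withDensity_iff_integrable_smul' (by fun_prop) (by simp)]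
      at hi2
    simp only [ENNReal.toReal_ofReal (twphi_nonneg μ σ _ _), smul_eq_mul] at hi2
    rw [e1, tw_joint π μ σ hσ,
      setIntegral_withDensity_eq_setIntegral_toReal_smul (by fun_prop) (by simp) _
        (measurable_snd hB)]
    simp only [ENNReal.toReal_ofReal (twphi_nonneg μ σ _ _), smul_eq_mul]
    have e2 : (π.prod volume).restrict (Prod.snd ⁻¹' B) =
        π.prod ((volume : Measure ℝ).restrict B) := by
      rw [← Set.univ_prod, ← Measure.prod_restrict, Measure.restrict_univ]
    have hi3 : Integrable (fun z : ℝ × ℝ => twphi μ σ z.1 z.2 * F z)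
        (π.prod ((volume : Measure ℝ).restrict B)) := by
      rw [← e2]; exact hi2.integrableOn
    rw [e2, integral_prod_symm _ hi3]
  symm
  refine ae_eq_condExp_of_forall_setIntegral_eq hY.comap_le hV1 (fun s _ _ => hgY.integrableOn)
    ?_ ?_
  · rintro s ⟨B, hB, rfl⟩ -
    rw [conv (fun z => g z.2) (hg.continuous.measurable.comp measurable_snd) hgY B hB,
      conv (fun z => z.1) measurable_fst hV1 B hB]
    congr 1; ext y
    simp only
    rw [integral_mul_const, ← hp, mul_comm, hgp]
    congr 1; ext x; ring
  · refine Measurable.aestronglyMeasurable ?_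
    exact hg.continuous.measurable.comp (comap_measurable _)

end joint

def IsLC (f : ℝ → ℝ) : Prop := (∀ x, 0 ≤ f x) ∧ ∀ x y θ : ℝ, 0 ≤ θ → θ ≤ 1 →
          f x ^ θ * f y ^ (1 - θ) ≤ f (θ * x + (1 - θ) * y)

lemma IsLC.meas {f : ℝ → ℝ} (hf : IsLC f) : Measurable f := by
  refine measurable_of_Ici fun t => ?_
  by_cases ht : t ≤ 0
  · have : f ⁻¹' Set.Ici t = Set.univ := by
      ext x; simp [ht.trans (hf.1 x)]
    rw [this]; exact MeasurableSet.univ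
  · push Not at ht
    have : Convex ℝ (f ⁻¹' Set.Ici t) := by
      intro x hx y hy a b ha hb hab
      have hb' : b = 1 - a := by linarith
      subst hb'
      simp only [Set.mem_preimage, Set.mem_Ici, smul_eq_mul] at *
      refine le_trans ?_ (hf.2 x y a ha (by linarith))
      calc t = t ^ a * t ^ (1 - a) := by rw [← Real.rpow_add ht]; simp
        _ ≤ _ := by
          have := Real.rpow_nonneg (hf.1 x) a
          gcongr
    exact this.ordConnected.measurableSet

lemma IsLC.anti {g : ℝ → ℝ} (hg : IsLC g) (s d e : ℝ) (h : |d| ≤ |e|) :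
    g (s + e) * g (s - e) ≤ g (s + d) * g (s - d) := by
  by_cases he : e = 0
  · subst he
    have : d = 0 := by simpa using h
    subst this; rfl
  have hde : |d / e| ≤ 1 := by
    rw [abs_div]; exact div_le_one_of_le₀ h (abs_nonneg _)
  obtain ⟨h1, h2⟩ := abs_le.1 hde
  set θ := (1 + d / e) / 2 with hθ
  have t0 : 0 ≤ θ := by linarith
  have t1 : θ ≤ 1 := by linarith
  have hd : d = (2 * θ - 1) * e := by rw [hθ]; field_simp; ring
  have k1 := hg.2 (s + e) (s - e) θ t0 t1
  have k2 := hg.2 (s + e) (s - e) (1 - θ) (by linarith) (by linarith)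
  rw [show θ * (s + e) + (1 - θ) * (s - e) = s + d by rw [hd]; ring] at k1
  rw [show (1 - θ) * (s + e) + (1 - (1 - θ)) * (s - e) = s - d by rw [hd]; ring,
    sub_sub_cancel] at k2
  have k3 : ∀ z : ℝ, 0 ≤ z → z ^ θ * z ^ (1 - θ) = z := fun z hz => by
    rw [← Real.rpow_add_of_nonneg hz t0 (by linarith)]; simp
  calc g (s + e) * g (s - e)
      = (g (s + e) ^ θ * g (s + e) ^ (1 - θ)) * (g (s - e) ^ θ * g (s - e) ^ (1 - θ)) := by
        rw [k3 _ (hg.1 _), k3 _ (hg.1 _)]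
    _ = (g (s + e) ^ θ * g (s - e) ^ (1 - θ)) * (g (s + e) ^ (1 - θ) * g (s - e) ^ θ) := by ring
    _ ≤ _ := mul_le_mul k1 k2
      (mul_nonneg (Real.rpow_nonneg (hg.1 _) _) (Real.rpow_nonneg (hg.1 _) _)) (hg.1 _)

lemma lc_inner {a : ℝ} (ha : 0 < a) : ∃ C : ℝ, 0 ≤ C ∧ ∀ h : ℝ → ℝ, Measurable h → (∀ x, 0 ≤ h x) →
    (∀ d e : ℝ, |d| ≤ |e| → h e ≤ h d) →
    ∫⁻ d, ENNReal.ofReal (d ^ 2 * Real.exp (-a * d ^ 2) * h d) ≤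
      ENNReal.ofReal C * ∫⁻ d, ENNReal.ofReal (Real.exp (-a * d ^ 2) * h d) := by
  have i0 : Integrable (fun d : ℝ => Real.exp (-a * d ^ 2)) := integrable_exp_neg_mul_sq ha
  have i2 : Integrable (fun d : ℝ => d ^ 2 * Real.exp (-a * d ^ 2)) := by
    have := integrable_rpow_mul_exp_neg_mul_sq ha (s := 2) (by norm_num)
    simpa using this
  set I0 := ∫ d : ℝ, Real.exp (-a * d ^ 2) with hI0
  set I2 := ∫ d : ℝ, d ^ 2 * Real.exp (-a * d ^ 2) with hI2
  have hI0p : 0 < I0 := by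
    rw [hI0, integral_gaussian]; have := Real.pi_pos; positivity
  have hI2p : 0 ≤ I2 := integral_nonneg fun d => by positivity
  refine ⟨I2 / I0, by positivity, ?_⟩
  intro h hm h0 hanti
  set C := I2 / I0 with hC
  have hCp : 0 ≤ C := by positivity
  have hCI : C * I0 = I2 := by rw [hC]; field_simp
  set d0 := Real.sqrt C
  have hd0 : d0 ^ 2 = C := Real.sq_sqrt hCp
  have pt : ∀ d : ℝ, d ^ 2 * Real.exp (-a * d ^ 2) * h d + C * h d0 * Real.exp (-a * d ^ 2) ≤
      C * (Real.exp (-a * d ^ 2) * h d) + h d0 * (d ^ 2 * Real.exp (-a * d ^ 2)) := by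
    intro d
    have key : (d ^ 2 - C) * (h d - h d0) ≤ 0 := by
      rcases le_total |d| |d0| with hh | hh
      · have := hanti _ _ hh
        have := sq_le_sq.2 hh
        apply mul_nonpos_of_nonpos_of_nonneg <;> linarith
      · have := hanti _ _ hh
        have := sq_le_sq.2 hh
        apply mul_nonpos_of_nonneg_of_nonpos <;> linarith
    have := mul_le_mul_of_nonneg_left key (Real.exp_nonneg (-a * d ^ 2))
    linarith
  have m1 : Measurable fun d : ℝ => ENNReal.ofReal (C * h d0 * Real.exp (-a * d ^ 2)) := by fun_prop
  have m2 : Measurable fun d : ℝ => ENNReal.ofReal (h d0 * (d ^ 2 * Real.exp (-a * d ^ 2))) := by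
    fun_prop
  have L : ∫⁻ d, (ENNReal.ofReal (d ^ 2 * Real.exp (-a * d ^ 2) * h d) +
        ENNReal.ofReal (C * h d0 * Real.exp (-a * d ^ 2))) ≤
      ∫⁻ d, (ENNReal.ofReal C * ENNReal.ofReal (Real.exp (-a * d ^ 2) * h d) +
        ENNReal.ofReal (h d0 * (d ^ 2 * Real.exp (-a * d ^ 2)))) := by
    refine lintegral_mono fun d => ?_
    have := h0 d
    have := h0 d0
    simp only
    rw [← ENNReal.ofReal_mul hCp, ← ENNReal.ofReal_add (by positivity) (by positivity),
      ← ENNReal.ofReal_add (by positivity) (by positivity)]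
    exact ENNReal.ofReal_le_ofReal (pt d)
  rw [lintegral_add_right _ m1, lintegral_add_right _ m2,
    lintegral_const_mul' _ _ (by simp)] at L
  have e1 : ∫⁻ d : ℝ, ENNReal.ofReal (C * h d0 * Real.exp (-a * d ^ 2)) =
      ENNReal.ofReal (h d0 * I2) := by
    rw [← ofReal_integral_eq_lintegral_ofReal (i0.const_mul _), integral_const_mul, ← hI0, ← hCI]
    · congr 1; ring
    · have := h0 d0
      exact Filter.Eventually.of_forall fun d => by simp only [Pi.zero_apply]; positivity
  have e2 : ∫⁻ d : ℝ, ENNReal.ofReal (h d0 * (d ^ 2 * Real.exp (-a * d ^ 2))) =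
      ENNReal.ofReal (h d0 * I2) := by
    rw [← ofReal_integral_eq_lintegral_ofReal (i2.const_mul _), integral_const_mul, ← hI2]
    · have := h0 d0
      exact Filter.Eventually.of_forall fun d => by simp only [Pi.zero_apply]; positivity
  rw [e1, e2] at L
  exact (ENNReal.add_le_add_iff_right (by simp)).1 L

lemma lc_change (F : ℝ → ℝ → ENNReal) (hF : Measurable (Function.uncurry F)) :
    ∫⁻ x, ∫⁻ x', F x x' = ∫⁻ s, ∫⁻ e, F (s + e / 2) (s - e / 2) := by
  calc ∫⁻ x, ∫⁻ x', F x x' = ∫⁻ x, ∫⁻ e, F x (x - e) := by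
        congr 1; ext x
        exact (lintegral_sub_left_eq_self (F x) x).symm
    _ = ∫⁻ e, ∫⁻ x, F x (x - e) := by
        refine lintegral_lintegral_swap (Measurable.aemeasurable ?_)
        exact hF.comp (by fun_prop : Measurable fun z : ℝ × ℝ => (z.1, z.1 - z.2))
    _ = ∫⁻ e, ∫⁻ s, F (s + e / 2) (s - e / 2) := by
        congr 1; ext e
        rw [← lintegral_add_right_eq_self (fun x => F x (x - e)) (e / 2)]
        congr 1; ext s
        congr 1; ring
    _ = _ := by
        refine lintegral_lintegral_swap (Measurable.aemeasurable ?_)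
        exact hF.comp (by fun_prop : Measurable fun z : ℝ × ℝ => (z.2 + z.1 / 2, z.2 - z.1 / 2))

lemma lc_double {a : ℝ} (ha : 0 < a) : ∃ C : ℝ, 0 ≤ C ∧ ∀ g : ℝ → ℝ, IsLC g →
    ∫⁻ x, ∫⁻ x', ENNReal.ofReal ((x - x') ^ 2 *
      ((Real.exp (-(a * x ^ 2)) * g x) * (Real.exp (-(a * x' ^ 2)) * g x'))) ≤
    ENNReal.ofReal C * ∫⁻ x, ∫⁻ x', ENNReal.ofReal
      ((Real.exp (-(a * x ^ 2)) * g x) * (Real.exp (-(a * x' ^ 2)) * g x')) := by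
  obtain ⟨C, hC, H⟩ := lc_inner (half_pos ha)
  refine ⟨C, hC, fun g hg => ?_⟩
  have hgm := hg.meas
  rw [lc_change (fun x x' => ENNReal.ofReal ((x - x') ^ 2 *
      ((Real.exp (-(a * x ^ 2)) * g x) * (Real.exp (-(a * x' ^ 2)) * g x'))))
      (by simp only [Function.uncurry_def]; fun_prop),
    lc_change (fun x x' => ENNReal.ofReal
      ((Real.exp (-(a * x ^ 2)) * g x) * (Real.exp (-(a * x' ^ 2)) * g x')))
      (by simp only [Function.uncurry_def]; fun_prop),
    ← lintegral_const_mul' _ _ (by simp)]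
  refine lintegral_mono fun s => ?_
  have := H (fun e => Real.exp (-(2 * a * s ^ 2)) * (g (s + e / 2) * g (s - e / 2)))
    (by fun_prop)
    (fun e => mul_nonneg (Real.exp_nonneg _) (mul_nonneg (hg.1 _) (hg.1 _)))
    (fun d e h => mul_le_mul_of_nonneg_left (hg.anti s _ _ (by
      rw [abs_div, abs_div]; gcongr)) (Real.exp_nonneg _))
  have ee : ∀ e : ℝ, Real.exp (-(a * (s + e / 2) ^ 2)) * g (s + e / 2) *
      (Real.exp (-(a * (s - e / 2) ^ 2)) * g (s - e / 2)) =
      Real.exp (-(a / 2) * e ^ 2) * (Real.exp (-(2 * a * s ^ 2)) * (g (s + e / 2) * g (s - e / 2))) := by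
    intro e
    have : Real.exp (-(a * (s + e / 2) ^ 2)) * Real.exp (-(a * (s - e / 2) ^ 2)) =
        Real.exp (-(a / 2) * e ^ 2) * Real.exp (-(2 * a * s ^ 2)) := by
      rw [← Real.exp_add, ← Real.exp_add]; congr 1; ring
    linear_combination g (s + e / 2) * g (s - e / 2) * this
  simp only [ee]
  refine le_trans (le_of_eq ?_) this
  congr 1; ext e
  congr 1; ring

lemma lc_var {a : ℝ} (ha : 0 < a) : ∃ C : ℝ, 0 ≤ C ∧ ∀ g : ℝ → ℝ, IsLC g → ∀ κ : Measure ℝ,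
    IsProbabilityMeasure κ →
    κ = volume.withDensity (fun x => ENNReal.ofReal (Real.exp (-(a * x ^ 2)) * g x)) →
    MemLp id 2 κ → Var[id; κ] ≤ C := by
  obtain ⟨C, hC, H⟩ := lc_double ha
  refine ⟨C, hC, fun g hg κ hκ hκd hL => ?_⟩
  have hgm := hg.meas
  have hw : ∀ x, 0 ≤ Real.exp (-(a * x ^ 2)) * g x := fun x =>
    mul_nonneg (Real.exp_nonneg _) (hg.1 x)
  have hwm : Measurable (fun x => ENNReal.ofReal (Real.exp (-(a * x ^ 2)) * g x)) := by fun_prop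
  have key : ∀ x' : ℝ, ENNReal.ofReal (Var[id; κ]) ≤ ∫⁻ x, ENNReal.ofReal ((x' - x) ^ 2) ∂κ := by
    intro x'
    have h1 : Var[id; κ] = Var[fun x => id x - x'; κ] :=
      (variance_sub_const hL.aestronglyMeasurable x').symm
    have hLc : MemLp (fun x => id x - x') 2 κ := hL.sub (memLp_const x')
    rw [h1, ← ofReal_integral_eq_lintegral_ofReal]
    · refine ENNReal.ofReal_le_ofReal ((variance_le_expectation_sq hLc.aestronglyMeasurable).trans
        (le_of_eq ?_))
      congr 1; ext x; simp only [Pi.pow_apply, id]; ring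
    · refine hLc.integrable_sq.congr (Filter.Eventually.of_forall fun x => ?_)
      simp only [id]; ring
    · exact Filter.Eventually.of_forall fun x => sq_nonneg _
  have key2 : ENNReal.ofReal (Var[id; κ]) ≤ ∫⁻ x', ∫⁻ x, ENNReal.ofReal ((x' - x) ^ 2) ∂κ ∂κ := by
    calc ENNReal.ofReal (Var[id; κ]) = ∫⁻ x' : ℝ, ENNReal.ofReal (Var[id; κ]) ∂κ := by simp
      _ ≤ _ := lintegral_mono key
  have d1 : ∀ F : ℝ → ℝ → ENNReal, Measurable (Function.uncurry F) →
      ∫⁻ x', ∫⁻ x, F x' x ∂κ ∂κ = ∫⁻ x', ∫⁻ x, F x' x *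
        (ENNReal.ofReal ((Real.exp (-(a * x' ^ 2)) * g x') * (Real.exp (-(a * x ^ 2)) * g x))) := by
    intro F hF
    rw [hκd, lintegral_withDensity_eq_lintegral_mul _ hwm]
    · congr 1; ext x'
      simp only [Pi.mul_apply]
      rw [lintegral_withDensity_eq_lintegral_mul _ hwm (by fun_prop),
        ← lintegral_const_mul' _ _ (by simp)]
      congr 1; ext x
      simp only [Pi.mul_apply]
      rw [ENNReal.ofReal_mul (hw x')]
      ring
    · exact hF.lintegral_prod_right'
  have h1 := d1 (fun _ _ => 1) (by fun_prop)
  have h2 := d1 (fun x' x => ENNReal.ofReal ((x' - x) ^ 2))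
    (by simp only [Function.uncurry_def]; fun_prop)
  have h3 := H g hg
  simp only [one_mul, lintegral_const, measure_univ, mul_one] at h1
  rw [← h1, mul_one] at h3
  rw [h2] at key2
  simp only [← ENNReal.ofReal_mul (sq_nonneg _)] at key2
  exact (ENNReal.ofReal_le_ofReal_iff hC).1 (key2.trans h3)


lemma IsLC.tail {f : ℝ → ℝ} (hf : IsLC f) (hi : Integrable f) :
    ∃ b M k : ℝ, 0 ≤ M ∧ 0 < k ∧ ∀ x, b ≤ x → f x ≤ M * Real.exp (-k * x) := by
  by_cases h0 : ∀ x, f x = 0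
  · exact ⟨0, 0, 1, le_rfl, one_pos, fun x _ => by simp [h0 x]⟩
  push Not at h0
  obtain ⟨a, ha⟩ := h0
  have hap : 0 < f a := lt_of_le_of_ne (hf.1 a) (Ne.symm ha)
  have hb : ∃ b, a < b ∧ f b ≤ f a * Real.exp (-1) := by
    by_contra hcon
    push Not at hcon
    have h1 : IntegrableOn (fun _ : ℝ => f a * Real.exp (-1)) (Set.Ioi a) := by
      refine Integrable.mono' (hi.integrableOn (s := Set.Ioi a)) (by fun_prop) ?_
      filter_upwards [ae_restrict_mem measurableSet_Ioi] with x hx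
      rw [Real.norm_of_nonneg (by positivity)]
      exact (hcon x hx).le
    rw [integrableOn_const_iff] at h1
    rcases h1 with h1 | h1
    · have : 0 < f a * Real.exp (-1) := by positivity
      exact this.ne' (by simpa using h1)
    · simp at h1
  obtain ⟨b, hab, hfb⟩ := hb
  have hba : 0 < b - a := by linarith
  refine ⟨b, f a * Real.exp (a / (b - a)), 1 / (b - a), by positivity, by positivity, ?_⟩
  intro x hx
  have hxa : 0 < x - a := by linarith
  set θ := (b - a) / (x - a) with hθ
  have t0 : 0 < θ := by positivity
  have t1 : θ ≤ 1 := (div_le_one hxa).2 (by linarith)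
  have k := hf.2 x a θ t0.le t1
  rw [show θ * x + (1 - θ) * a = b by rw [hθ]; field_simp; ring] at k
  have k1 : f x ^ θ * f a ^ (1 - θ) ≤ (f a * Real.exp (-1 / θ)) ^ θ * f a ^ (1 - θ) := by
    refine (k.trans hfb).trans (le_of_eq ?_)
    rw [Real.mul_rpow hap.le (Real.exp_nonneg _), ← Real.exp_mul, mul_right_comm,
      ← Real.rpow_add hap, div_mul_cancel₀ _ t0.ne']
    simp
  have k2 := le_of_mul_le_mul_right k1 (Real.rpow_pos_of_pos hap _)
  have k3 := (Real.rpow_le_rpow_iff (hf.1 x) (by positivity) t0).1 k2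
  refine k3.trans (le_of_eq ?_)
  rw [mul_assoc, ← Real.exp_add]
  congr 2
  rw [hθ]; field_simp; ring

lemma IsLC.refl {f : ℝ → ℝ} (hf : IsLC f) : IsLC (fun x => f (-x)) := by
  refine ⟨fun x => hf.1 _, fun x y θ h0 h1 => ?_⟩
  have := hf.2 (-x) (-y) θ h0 h1
  rwa [show θ * -x + (1 - θ) * -y = -(θ * x + (1 - θ) * y) by ring] at this

lemma exp_tail_bound {k : ℝ} (hk : 0 < k) (x : ℝ) (hx : 0 ≤ x) :
    x * Real.exp (-k * x) ≤ (1 / k + 6 / k ^ 3) * (1 + x ^ 2)⁻¹ := by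
  have h1 := Real.pow_div_factorial_le_exp (k * x) (by positivity) 1
  have h3 := Real.pow_div_factorial_le_exp (k * x) (by positivity) 3
  norm_num [Nat.factorial] at h1 h3
  rw [neg_mul, Real.exp_neg, ← div_eq_mul_inv, ← div_eq_mul_inv,
    div_le_div_iff₀ (Real.exp_pos _) (by positivity)]
  have e1 : x ≤ 1 / k * Real.exp (k * x) := by
    rw [div_mul_eq_mul_div, le_div_iff₀ hk]; linarith
  have e3 : x ^ 3 ≤ 6 / k ^ 3 * Real.exp (k * x) := by
    rw [div_mul_eq_mul_div, le_div_iff₀ (by positivity)]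
    rw [mul_pow] at h3; linarith
  nlinarith

lemma IsLC.int_id {f : ℝ → ℝ} (hf : IsLC f) (hi : Integrable f) :
    Integrable (fun x => f x * x) := by
  obtain ⟨b, M, k, hM, hk, H⟩ := hf.tail hi
  obtain ⟨b', M', k', hM', hk', H'⟩ := hf.refl.tail hi.comp_neg
  have hm := hf.meas
  refine Integrable.mono' (g := fun x => (|b| + |b'|) * f x +
    (M * (1 / k + 6 / k ^ 3) + M' * (1 / k' + 6 / k' ^ 3)) * (1 + x ^ 2)⁻¹)
    ((hi.const_mul _).add (integrable_inv_one_add_sq.const_mul _)) (by fun_prop) ?_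
  refine Filter.Eventually.of_forall fun x => ?_
  have hfx := hf.1 x
  rw [norm_mul, Real.norm_of_nonneg hfx, Real.norm_eq_abs]
  have p1 : 0 ≤ M * (1 / k + 6 / k ^ 3) * (1 + x ^ 2)⁻¹ := by positivity
  have p2 : 0 ≤ M' * (1 / k' + 6 / k' ^ 3) * (1 + x ^ 2)⁻¹ := by positivity
  have p3 : 0 ≤ (|b| + |b'|) * f x := by positivity
  by_cases hx : |x| ≤ |b| + |b'|
  · have := mul_le_mul_of_nonneg_right hx hfx
    linarith
  push Not at hx
  rcases le_total 0 x with h | h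
  · rw [abs_of_nonneg h] at hx ⊢
    have q := H x (by linarith [le_abs_self b, abs_nonneg b'])
    have q1 := mul_le_mul_of_nonneg_right q h
    have q2 := mul_le_mul_of_nonneg_left (exp_tail_bound hk x h) hM
    linarith
  · rw [abs_of_nonpos h] at hx ⊢
    have h' : 0 ≤ -x := by linarith
    have q := H' (-x) (by linarith [le_abs_self b', abs_nonneg b])
    simp only [neg_neg] at q
    have q1 := mul_le_mul_of_nonneg_right q h'
    have q2 := mul_le_mul_of_nonneg_left (exp_tail_bound hk' (-x) h') hM'
    rw [neg_sq] at q2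
    linarith

lemma lc_case (f : ℝ → ℝ) (hf : IsLC f) (π : Measure ℝ) [IsProbabilityMeasure π]
    (hπ : π = volume.withDensity (fun x => ENNReal.ofReal (f x))) :
    Integrable id π ∧ ∀ a : ℝ, 0 < a →
      ∃ C : ℝ, ∀ t : ℝ, Var[id; (gdm π a).tilted (fun x => t * x)] ≤ C := by
  have hm := hf.meas
  constructor
  · have hi : Integrable f := by
      refine ⟨hm.aestronglyMeasurable, ?_⟩
      rw [hasFiniteIntegral_iff_ofReal (Filter.Eventually.of_forall hf.1)]
      have : π Set.univ = 1 := measure_univ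
      rw [hπ, withDensity_apply _ MeasurableSet.univ, Measure.restrict_univ] at this
      rw [this]; simp
    rw [hπ, integrable_withDensity_iff_integrable_smul' (by fun_prop) (by simp)]
    simp only [ENNReal.toReal_ofReal (hf.1 _), smul_eq_mul, id]
    exact hf.int_id hi
  · intro a ha
    obtain ⟨C, hC, H⟩ := lc_var ha
    refine ⟨C, fun t => ?_⟩
    set Z := ∫ x, Real.exp (t * x) ∂(gdm π a) with hZ
    have hZ0 : 0 < Z := gdm_mgf_pos π ha t
    have hmem := gdm_mem π ha t
    have : NeZero (gdm π a) := ⟨gdm_ne_zero π a⟩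
    have hint : Integrable (fun x => Real.exp (t * x)) (gdm π a) :=
      interior_subset (s := integrableExpSet id (gdm π a)) hmem
    refine H (fun x => f x * (Real.exp (t * x) / Z)) ?_ _ ?_ ?_ ?_
    · refine ⟨fun x => mul_nonneg (hf.1 x) (by positivity), fun x y θ h0 h1 => ?_⟩
      have h1' : 0 ≤ 1 - θ := by linarith
      rw [Real.mul_rpow (hf.1 x) (by positivity), Real.mul_rpow (hf.1 y) (by positivity)]
      have e : (Real.exp (t * x) / Z) ^ θ * (Real.exp (t * y) / Z) ^ (1 - θ) =
          Real.exp (t * (θ * x + (1 - θ) * y)) / Z := by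
        rw [Real.div_rpow (Real.exp_nonneg _) hZ0.le, Real.div_rpow (Real.exp_nonneg _) hZ0.le,
          div_mul_div_comm, ← Real.rpow_add hZ0, ← Real.exp_mul, ← Real.exp_mul, ← Real.exp_add]
        simp only [add_sub_cancel, Real.rpow_one]
        congr 2; ring
      calc _ = (f x ^ θ * f y ^ (1 - θ)) *
            ((Real.exp (t * x) / Z) ^ θ * (Real.exp (t * y) / Z) ^ (1 - θ)) := by ring
        _ ≤ _ := by
          rw [e]
          exact mul_le_mul_of_nonneg_right (hf.2 x y θ h0 h1) (by positivity)
    · exact isProbabilityMeasure_tilted hint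
    · unfold Measure.tilted
      rw [← hZ]
      conv_lhs => rw [gdm, hπ]
      rw [← withDensity_mul _ (by fun_prop) (by fun_prop),
        ← withDensity_mul _ (by fun_prop) (by fun_prop)]
      congr 1; ext x
      simp only [Pi.mul_apply]
      rw [← mul_assoc, ← ENNReal.ofReal_mul (hf.1 x),
        ← ENNReal.ofReal_mul (mul_nonneg (hf.1 x) (Real.exp_nonneg _))]
      congr 1; ring
    · exact memLp_tilted_mul hmem 2

lemma cpt_case (ν : Measure ℝ) [IsProbabilityMeasure ν] (R : ℝ) (hR : ν {x | R < |x|} = 0)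
    (a : ℝ) (ha : 0 < a) :
      ∃ C : ℝ, ∀ t : ℝ, Var[id; (gdm ν a).tilted (fun x => t * x)] ≤ C := by
  refine ⟨((R - -R) / 2) ^ 2, fun t => ?_⟩
  have : NeZero (gdm ν a) := ⟨gdm_ne_zero ν a⟩
  have hint : Integrable (fun x => Real.exp (t * x)) (gdm ν a) :=
    interior_subset (s := integrableExpSet id (gdm ν a)) (gdm_mem ν ha t)
  have : IsProbabilityMeasure ((gdm ν a).tilted (fun x => t * x)) :=
    isProbabilityMeasure_tilted hint
  refine variance_le_sq_of_bounded ?_ (by fun_prop)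
  have h1 : ∀ᵐ x ∂ν, id x ∈ Set.Icc (-R) R := by
    rw [ae_iff]
    refine measure_mono_null ?_ hR
    intro x hx
    simp only [id, Set.mem_Icc, Set.mem_ofPred_eq] at hx ⊢
    rw [← abs_le] at hx
    exact not_le.1 hx
  exact ((tilted_absolutelyContinuous _ _).trans (withDensity_absolutelyContinuous _ _)) h1

/-- Gaussian convolution: the density for `π = N(m,v) * ν`. -/
lemma gauss_case (m : ℝ) (v : NNReal) (ν π : Measure ℝ) [IsProbabilityMeasure ν]
    [IsProbabilityMeasure π] (hπ : π = ((gaussianReal m v).prod ν).map (fun q => q.1 + q.2))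
    (μ σ : ℝ) (hμ : μ ≠ 0) (hσ : 0 < σ) (p : ℝ → ℝ) (hp : ∀ y : ℝ, p y = ∫ x, twphi μ σ x y ∂π) :
    ∃ τ : ℝ, 0 < τ ∧ ∀ y, p y = ∫ x, twphi μ τ x (y - μ * m) ∂ν := by
  set τ := Real.sqrt (σ ^ 2 + μ ^ 2 * v) with hτ
  have hτ0 : 0 < τ := Real.sqrt_pos.2 (by positivity)
  have hτ2 : τ ^ 2 = σ ^ 2 + μ ^ 2 * v := Real.sq_sqrt (by positivity)
  refine ⟨τ, hτ0, ?_⟩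
  set q : ℝ → ℝ := fun y => ∫ x, twphi μ τ x y ∂ν with hq
  have hqc : Continuous q := (tw_p_smooth ν μ τ hμ hτ0 q (fun y => rfl) 0).continuous
  have hpc : Continuous p := (tw_p_smooth π μ σ hμ hσ p hp 0).continuous
  have l1 := tw_law π μ σ hσ p hp
  have l2 := tw_law ν μ τ hτ0 q (fun y => rfl)
  -- Gaussian convolution identity
  have gg : ((gaussianReal m v).prod (gaussianReal 0 1)).map (fun z : ℝ × ℝ => μ * z.1 + σ * z.2) =
      (gaussianReal 0 1).map (fun g => μ * m + τ * g) := by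
    have a1 : (fun z : ℝ × ℝ => μ * z.1 + σ * z.2) =
      (fun z : ℝ × ℝ => z.1 + z.2) ∘ (Prod.map (fun x => μ * x) (fun x => σ * x)) := rfl
    have a2 : (fun g => μ * m + τ * g) = (fun g => μ * m + g) ∘ (fun g => τ * g) := rfl
    rw [a1, ← Measure.map_map (by fun_prop) (by fun_prop),
      ← Measure.map_prod_map _ _ (by fun_prop) (by fun_prop), a2,
      ← Measure.map_map (by fun_prop) (by fun_prop), gaussianReal_map_const_mul,
      gaussianReal_map_const_mul, gaussianReal_map_const_mul, gaussianReal_map_const_add]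
    have := gaussianReal_conv_gaussianReal (m₁ := μ * m) (m₂ := σ * 0)
      (v₁ := NNReal.mk (μ ^ 2) (sq_nonneg _) * v) (v₂ := NNReal.mk (σ ^ 2) (sq_nonneg _) * 1)
    rw [Measure.conv] at this
    rw [this]
    congr 1
    · simp
    · ext
      push_cast
      change μ ^ 2 * (v : ℝ) + σ ^ 2 * 1 = τ ^ 2 * 1
      rw [hτ2]; ring
  have hlaw : (π.prod (gaussianReal 0 1)).map (fun q : ℝ × ℝ => μ * q.1 + σ * q.2) =
      ((ν.prod (gaussianReal 0 1)).map (fun q : ℝ × ℝ => μ * q.1 + τ * q.2)).map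
        (fun y => μ * m + y) := by
    refine Measure.ext_of_lintegral _ fun F hF => ?_
    rw [Measure.map_map (by fun_prop) (by fun_prop), lintegral_map hF (by fun_prop),
      lintegral_map hF (by fun_prop), lintegral_prod _ (by fun_prop), hπ,
      lintegral_map (by fun_prop) (by fun_prop), lintegral_prod_symm _ (by fun_prop),
      lintegral_prod _ (by fun_prop)]
    congr 1; ext w
    have b1 := lintegral_map (μ := (gaussianReal m v).prod (gaussianReal 0 1))
      (f := fun t => F (μ * w + t)) (by fun_prop)
      (g := fun z : ℝ × ℝ => μ * z.1 + σ * z.2) (by fun_prop)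
    rw [gg, lintegral_map (by fun_prop) (by fun_prop), lintegral_prod _ (by fun_prop)] at b1
    simp only [Function.comp_def]
    refine Eq.trans ?_ (b1.symm.trans ?_)
    · congr 1; ext x; congr 1; ext g; congr 1; ring
    · congr 1; ext g; congr 1; ring
  have hshift : (volume.withDensity (fun y => ENNReal.ofReal (q y))).map (fun y => μ * m + y) =
      volume.withDensity (fun y => ENNReal.ofReal (q (y - μ * m))) := by
    have hqm := hqc.measurable
    refine Measure.ext_of_lintegral _ fun F hF => ?_
    rw [lintegral_map hF (by fun_prop), lintegral_withDensity_eq_lintegral_mul _ (by fun_prop)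
      (by fun_prop), lintegral_withDensity_eq_lintegral_mul _ (by fun_prop) hF,
      ← lintegral_add_left_eq_self ((fun y => ENNReal.ofReal (q (y - μ * m))) * F) (μ * m)]
    congr 1; ext y
    simp
  rw [l1, l2, hshift] at hlaw
  have hpm := hpc.measurable
  have hqm := hqc.measurable
  have hae := (withDensity_eq_iff_of_sigmaFinite (by fun_prop) (by fun_prop)).1 hlaw
  have hae2 : p =ᵐ[volume] fun y => q (y - μ * m) := by
    filter_upwards [hae] with y hy
    have n1 : 0 ≤ p y := by rw [hp]; exact integral_nonneg fun x => twphi_nonneg _ _ _ _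
    have n2 : 0 ≤ q (y - μ * m) := integral_nonneg fun x => twphi_nonneg _ _ _ _
    exact (ENNReal.ofReal_eq_ofReal_iff n1 n2).1 hy
  have := (hpc.ae_eq_iff_eq volume (by fun_prop : Continuous fun y => q (y - μ * m))).1 hae2
  exact congrFun this

lemma gauss_int (m : ℝ) (v : NNReal) (ν π : Measure ℝ) [IsProbabilityMeasure ν]
    (R : ℝ) (hR : ν {x | R < |x|} = 0)
    (hπ : π = ((gaussianReal m v).prod ν).map (fun q => q.1 + q.2)) : Integrable id π := by
  rw [hπ, integrable_map_measure (by fun_prop) (by fun_prop)]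
  have h1 : Integrable id (gaussianReal m v) := (memLp_id_gaussianReal 1).integrable (by simp)
  have h2 : Integrable id ν := by
    refine Integrable.mono' (integrable_const R) (by fun_prop) ?_
    rw [ae_iff]
    simpa using hR
  exact (h1.comp_fst ν).add (h2.comp_snd _)

/-- **Tweedie's formula and Lipschitz posterior means** (Lemma `tweedie` of the paper).
Suppose `V ∼ π` either has a log-concave Lebesgue density or is an independent sum of a
Gaussian and a compactly supported random variable.  Fix `μ ≠ 0`, `σ > 0` and let
`G ∼ N(0,1)` be independent of `V` (realised on the product space `π ⊗ N(0,1)`).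
Then `μ V + σ G` has the strictly positive, infinitely differentiable density
`p(y) = ∫ φ_σ(y − μ x) dπ(x)`; the function `g*(y) = (y + σ² p'(y)/p(y))/μ` satisfies
`g*(μ V + σ G) = E[V ∣ μ V + σ G]` almost surely; and `g*` is infinitely
differentiable and Lipschitz. -/
theorem tweedie_formula_lipschitz
    (π : Measure ℝ) [IsProbabilityMeasure π]
    (hπ : (∃ f : ℝ → ℝ, (∀ x, 0 ≤ f x) ∧
        π = volume.withDensity (fun x => ENNReal.ofReal (f x)) ∧
        (∀ x y θ : ℝ, 0 ≤ θ → θ ≤ 1 →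
          f x ^ θ * f y ^ (1 - θ) ≤ f (θ * x + (1 - θ) * y))) ∨
      (∃ (m : ℝ) (v : NNReal) (ν : Measure ℝ) (_ : IsProbabilityMeasure ν) (R : ℝ),
        ν {x | R < |x|} = 0 ∧
        π = ((gaussianReal m v).prod ν).map (fun q => q.1 + q.2)))
    (μ σ : ℝ) (hμ : μ ≠ 0) (hσ : 0 < σ)
    (p : ℝ → ℝ)
    (hp : ∀ y : ℝ, p y = ∫ x, (Real.sqrt (2 * Real.pi * σ ^ 2))⁻¹ *
        Real.exp (-(y - μ * x) ^ 2 / (2 * σ ^ 2)) ∂π)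
    (gstar : ℝ → ℝ)
    (hgstar : ∀ y : ℝ, gstar y = (y + σ ^ 2 * (deriv p y / p y)) / μ) :
    (∀ y : ℝ, 0 < p y) ∧
    (∀ k : ℕ, ContDiff ℝ k p) ∧
    ((π.prod (gaussianReal 0 1)).map (fun q : ℝ × ℝ => μ * q.1 + σ * q.2) =
      volume.withDensity (fun y => ENNReal.ofReal (p y))) ∧
    (((π.prod (gaussianReal 0 1))[(fun q : ℝ × ℝ => q.1) |
        MeasurableSpace.comap (fun q : ℝ × ℝ => μ * q.1 + σ * q.2) inferInstance])
      =ᵐ[π.prod (gaussianReal 0 1)] fun q : ℝ × ℝ => gstar (μ * q.1 + σ * q.2)) ∧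
    (∀ k : ℕ, ContDiff ℝ k gstar) ∧
    (∃ K : NNReal, LipschitzWith K gstar) := by
  have hpt : ∀ y : ℝ, p y = ∫ x, twphi μ σ x y ∂π := hp
  have hmain : Integrable id π ∧ ∃ K : NNReal, LipschitzWith K (fun y => deriv p y / p y) := by
    rcases hπ with ⟨f, h0, hd, hlc⟩ | ⟨m, v, ν, hν, R, hR, hd⟩
    · obtain ⟨h1, h2⟩ := lc_case f ⟨h0, hlc⟩ π hd
      refine ⟨h1, ?_⟩
      obtain ⟨C, hC⟩ := h2 (μ ^ 2 / (2 * σ ^ 2)) (by positivity)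
      exact tw_lip π μ σ hμ hσ p hp C hC
    · refine ⟨gauss_int m v ν π R hR hd, ?_⟩
      obtain ⟨τ, hτ, hpq⟩ := gauss_case m v ν π hd μ σ hμ hσ p hpt
      obtain ⟨C, hC⟩ := cpt_case ν R hR (μ ^ 2 / (2 * τ ^ 2)) (by positivity)
      obtain ⟨K, hK⟩ := tw_lip ν μ τ hμ hτ (fun y => ∫ x, twphi μ τ x y ∂ν) (fun y => rfl) C hC
      refine ⟨K, ?_⟩
      have e : (fun y => deriv p y / p y) = fun y =>
          deriv (fun y => ∫ x, twphi μ τ x y ∂ν) (y - μ * m) /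
            ∫ x, twphi μ τ x (y - μ * m) ∂ν := by
        ext y
        rw [hpq y, funext hpq, deriv_comp_sub_const (fun y => ∫ x, twphi μ τ x y ∂ν)]
      rw [e]
      refine LipschitzWith.of_dist_le_mul fun x y => ?_
      have := hK.dist_le_mul (x - μ * m) (y - μ * m)
      simpa using this
  obtain ⟨hV, K, hK⟩ := hmain
  have hgL : ∃ K : NNReal, LipschitzWith K gstar := by
    refine ⟨Real.toNNReal ((1 + σ ^ 2 * K) / |μ|), LipschitzWith.of_dist_le_mul fun x y => ?_⟩
    have hμ' : 0 < |μ| := abs_pos.2 hμ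
    have := hK.dist_le_mul x y
    rw [Real.coe_toNNReal _ (by positivity), Real.dist_eq, hgstar, hgstar, ← sub_div, abs_div,
      div_mul_eq_mul_div]
    rw [Real.dist_eq] at this
    refine div_le_div_of_nonneg_right ?_ hμ'.le
    rw [show x + σ ^ 2 * (deriv p x / p x) - (y + σ ^ 2 * (deriv p y / p y)) =
      (x - y) + σ ^ 2 * (deriv p x / p x - deriv p y / p y) by ring]
    refine (abs_add_le _ _).trans ?_
    rw [abs_mul, abs_of_nonneg (sq_nonneg σ), add_mul, one_mul, mul_assoc]
    refine add_le_add (le_of_eq (Real.dist_eq x y).symm) ?_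
    exact mul_le_mul_of_nonneg_left this (sq_nonneg σ)
  obtain ⟨K', hK'⟩ := hgL
  exact ⟨tw_p_pos π μ σ hμ hσ p hp, tw_p_smooth π μ σ hμ hσ p hp, tw_law π μ σ hσ p hpt,
    tw_cond π μ σ hσ p gstar hpt hV K' hK'
      (fun y => (tw_gp π μ σ hμ hσ p hp gstar hgstar y).2),
    tw_g_smooth π μ σ hμ hσ p hp gstar hgstar, K', hK'⟩
end
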